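/- Let p be an odd prime and let G be a non-trivial finite p-group such that Aut(G) is an abelian p-group. Then |Aut(G)| ≥ p^{12}. (Equivalently: for p odd, no abelian p-group of order smaller than p^{12} occurs as the full automorphism group of a non-trivial p-group.) -/

import Mathlib

namespace AbelianAut

section

variable {L : Type*} [AddCommGroup L]

/-- `φ` preserves the bracket `B`. -/
def IsLieAut (B : L →+ L →+ L) (φ : L ≃+ L) : Prop := ∀ x y, φ (B x y) = B (φ x) (φ y)

/-- The centre of a bracket. -/
def center (B : L →+ L →+ L) : AddSubgroup L where
  carrier := {x | ∀ y, B x y = 0}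
  zero_mem' := by simp
  add_mem' := by intro a b ha hb y; simp [ha y, hb y]
  neg_mem' := by intro a ha y; simp [ha y]

/-- The subgroup generated by all brackets. -/
def derived (B : L →+ L →+ L) : AddSubgroup L := AddSubgroup.closure {z | ∃ x y, B x y = z}

theorem mem_center {B : L →+ L →+ L} {x : L} : x ∈ center B ↔ ∀ y, B x y = 0 := Iff.rfl

theorem br_mem_derived (B : L →+ L →+ L) (x y : L) : B x y ∈ derived B :=
  AddSubgroup.subset_closure ⟨x, y, rfl⟩

/-- A class-two Lie ring of odd `p`-power order whose automorphisms commute and include no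
involution. -/
structure Rigid (p : ℕ) (B : L →+ L →+ L) : Prop where
  prime : p.Prime
  odd : Odd p
  torsion : ∀ x : L, ∃ k : ℕ, p ^ k • x = 0
  alt : ∀ x, B x x = 0
  nil : ∀ x y z, B (B x y) z = 0
  comm : ∀ φ ψ : L ≃+ L, IsLieAut B φ → IsLieAut B ψ → ∀ x, φ (ψ x) = ψ (φ x)
  noinv : ∀ φ : L ≃+ L, IsLieAut B φ → (∀ x, φ (φ x) = x) → ∀ x, φ x = x

namespace Rigid

variable {p : ℕ} {B : L →+ L →+ L} (hR : Rigid p B)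
include hR

theorem skew (x y : L) : B x y = -B y x := by
  have h := hR.alt (x + y)
  simp only [map_add, AddMonoidHom.add_apply, hR.alt, zero_add, add_zero] at h
  exact eq_neg_of_add_eq_zero_right h

theorem br_right_eq_zero {x y : L} (hy : y ∈ center B) : B x y = 0 := by
  rw [hR.skew, hy x, neg_zero]

theorem derived_le_center : derived B ≤ center B := by
  rw [derived, AddSubgroup.closure_le]
  rintro _ ⟨x, y, rfl⟩ z
  exact hR.nil x y z

theorem eq_zero_of_two_zsmul {x : L} (h : x + x = 0) : x = 0 := by
  obtain ⟨k, hk⟩ := hR.torsion x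
  obtain ⟨j, hj⟩ := hR.odd.pow (n := k)
  rw [hj, add_smul, mul_comm, mul_smul, two_smul, one_smul, h] at hk
  simpa using hk

theorem zsmul_eq_zero_of_coprime {x : L} {s : ℤ} (h : s • x = 0) (hs : ¬ (p : ℤ) ∣ s) : x = 0 := by
  obtain ⟨k, hk⟩ := hR.torsion x
  have hc : IsCoprime s ((p : ℤ) ^ k) := by
    apply IsCoprime.pow_right
    exact ((Nat.prime_iff_prime_int.mp hR.prime).coprime_iff_not_dvd.mpr hs).symm
  obtain ⟨u, v, huv⟩ := hc
  have hk' : ((p : ℤ) ^ k) • x = 0 := by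
    have := hk
    rw [← natCast_zsmul] at this
    simpa using this
  calc x = (u * s + v * (p : ℤ) ^ k) • x := by rw [huv, one_smul]
    _ = 0 := by rw [add_smul, mul_smul, mul_smul, h, hk']; simp

theorem mem_of_zsmul_mem {S : AddSubgroup L} {x : L} {s : ℤ} (h : s • x ∈ S)
    (hs : ¬ (p : ℤ) ∣ s) : x ∈ S := by
  obtain ⟨k, hk⟩ := hR.torsion x
  have hc : IsCoprime s ((p : ℤ) ^ k) := by
    apply IsCoprime.pow_right
    exact ((Nat.prime_iff_prime_int.mp hR.prime).coprime_iff_not_dvd.mpr hs).symm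
  obtain ⟨u, v, huv⟩ := hc
  have hk' : ((p : ℤ) ^ k) • x = 0 := by
    have := hk
    rw [← natCast_zsmul] at this
    simpa using this
  have : x = u • (s • x) := by
    calc x = (u * s + v * (p : ℤ) ^ k) • x := by rw [huv, one_smul]
      _ = _ := by rw [add_smul, mul_smul, mul_smul, hk']; simp
  rw [this]
  exact S.zsmul_mem h u

/-- A `ℤ/2`-grading of the Lie ring has trivial odd part. -/
theorem odd_part_eq_bot {P M : AddSubgroup L} (hc : IsCompl P M)
    (hPP : ∀ x ∈ P, ∀ y ∈ P, B x y ∈ P) (hMM : ∀ x ∈ M, ∀ y ∈ M, B x y ∈ P)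
    (hPM : ∀ x ∈ P, ∀ y ∈ M, B x y ∈ M) : M = ⊥ := by
  have hdec : ∀ z : L, ∃ x ∈ P, ∃ y ∈ M, x + y = z := fun z => by
    have : z ∈ P ⊔ M := by rw [hc.sup_eq_top]; trivial
    exact AddSubgroup.mem_sup.mp this
  choose a ha b hb hab using hdec
  have huniq : ∀ x ∈ P, ∀ y ∈ M, ∀ x' ∈ P, ∀ y' ∈ M, x + y = x' + y' → x = x' ∧ y = y' := by
    intro x hx y hy x' hx' y' hy' h
    have h1 : x - x' = y' - y := by rw [sub_eq_sub_iff_add_eq_add, h, add_comm]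
    have h2 : x - x' ∈ P ⊓ M := ⟨P.sub_mem hx hx', h1 ▸ M.sub_mem hy' hy⟩
    rw [hc.inf_eq_bot, AddSubgroup.mem_bot] at h2
    exact ⟨sub_eq_zero.mp h2, (sub_eq_zero.mp (h1 ▸ h2)).symm⟩
  have hval : ∀ x ∈ P, ∀ y ∈ M, a (x + y) = x ∧ b (x + y) = y := fun x hx y hy =>
    huniq _ (ha _) _ (hb _) x hx y hy (hab _)
  let f : L →+ L := AddMonoidHom.mk' (fun z => a z - b z) (by
    intro z z'
    have := hval (a z + a z') (P.add_mem (ha _) (ha _)) (b z + b z') (M.add_mem (hb _) (hb _))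
    rw [show a z + a z' + (b z + b z') = z + z' by
      conv_rhs => rw [← hab z, ← hab z']
      abel] at this
    rw [this.1, this.2]; abel)
  have hf : ∀ x ∈ P, ∀ y ∈ M, f (x + y) = x - y := fun x hx y hy => by
    change a _ - b _ = _
    rw [(hval x hx y hy).1, (hval x hx y hy).2]
  have hff : ∀ z, f (f z) = z := fun z => by
    change f (a z - b z) = z
    rw [sub_eq_add_neg, hf _ (ha z) _ (M.neg_mem (hb z)), sub_neg_eq_add, hab]
  let φ : L ≃+ L := { f with invFun := f, left_inv := hff, right_inv := hff }
  have hφ : IsLieAut B φ := by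
    intro z z'
    change f (B z z') = B (f z) (f z')
    have e : B z z' = (B (a z) (a z') + B (b z) (b z')) + (B (a z) (b z') + B (b z) (a z')) := by
      conv_lhs => rw [← hab z, ← hab z']
      simp only [map_add, AddMonoidHom.add_apply]; abel
    have e' : B (f z) (f z') =
        (B (a z) (a z') + B (b z) (b z')) - (B (a z) (b z') + B (b z) (a z')) := by
      change B (a z - b z) (a z' - b z') = _
      simp only [map_sub, AddMonoidHom.sub_apply]; abel
    rw [e, e']
    apply hf
    · exact P.add_mem (hPP _ (ha _) _ (ha _)) (hMM _ (hb _) _ (hb _))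
    · refine M.add_mem (hPM _ (ha _) _ (hb _)) ?_
      rw [hR.skew]; exact M.neg_mem (hPM _ (ha _) _ (hb _))
  rw [eq_bot_iff]
  intro y hy
  have h1 : f (0 + y) = 0 - y := hf 0 P.zero_mem y hy
  have h2 : f (0 + y) = 0 + y := hR.noinv φ hφ hff _
  rw [h1] at h2
  rw [AddSubgroup.mem_bot]
  apply hR.eq_zero_of_two_zsmul
  have : -y = y := by simpa using h2
  nth_rewrite 1 [← this]
  simp

/-- A homomorphism `f` into the centre vanishing on brackets has no eigenvalue `-1`. -/
theorem eq_zero_of_add_eq_zero [Finite L] {f : L →+ L} (hZ : ∀ x, f x ∈ center B)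
    (hD : ∀ x y, f (B x y) = 0) {x : L} (hx : x + f x = 0) : x = 0 := by
  let g : L →ₗ[ℤ] L := f.toIntLinearMap
  obtain ⟨n, hn⟩ := (g.eventually_isCompl_ker_pow_range_pow.and
    (Filter.eventually_ge_atTop 1)).exists
  obtain ⟨hc, hn1⟩ := hn
  obtain ⟨k, rfl⟩ : ∃ k, n = k + 1 := ⟨n - 1, by omega⟩
  have hrange : ∀ z ∈ LinearMap.range (g ^ (k + 1)), z ∈ center B := by
    rintro _ ⟨y, rfl⟩
    rw [pow_succ']
    exact hZ _
  have hker : ∀ y z, B y z ∈ LinearMap.ker (g ^ (k + 1)) := by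
    intro y z
    rw [LinearMap.mem_ker, pow_succ]
    change (g ^ k) (f (B y z)) = 0
    rw [hD, map_zero]
  have hc' : IsCompl (LinearMap.ker (g ^ (k + 1))).toAddSubgroup
      (LinearMap.range (g ^ (k + 1))).toAddSubgroup := by
    constructor
    · rw [AddSubgroup.disjoint_def]
      intro y hy hy'
      exact Submodule.disjoint_def.mp hc.disjoint y hy hy'
    · rw [codisjoint_iff, eq_top_iff]
      intro y _
      have : y ∈ LinearMap.ker (g ^ (k + 1)) ⊔ LinearMap.range (g ^ (k + 1)) := by
        rw [hc.sup_eq_top]; trivial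
      obtain ⟨u, hu, v, hv, h⟩ := Submodule.mem_sup.mp this
      exact AddSubgroup.mem_sup.mpr ⟨u, hu, v, hv, h⟩
  have hbot := hR.odd_part_eq_bot hc' (fun y _ z _ => hker y z) (fun y _ z _ => hker y z)
    (fun y _ z hz => by
      rw [hR.br_right_eq_zero (hrange z hz)]; exact AddSubgroup.zero_mem _)
  have hgx : g x = -x := (neg_eq_of_add_eq_zero_right hx).symm
  have hpow : ∀ j : ℕ, (g ^ j) x = x ∨ (g ^ j) x = -x := by
    intro j
    induction j with
    | zero => left; rfl
    | succ j ih =>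
      rw [pow_succ']
      rcases ih with h | h
      · right; rw [Module.End.mul_apply, h, hgx]
      · left; rw [Module.End.mul_apply, h, map_neg, hgx, neg_neg]
  have h0 : (g ^ (k + 1)) x = 0 := by
    have : (g ^ (k + 1)) x ∈ (LinearMap.range (g ^ (k + 1))).toAddSubgroup := ⟨x, rfl⟩
    rw [hbot] at this
    exact this
  rcases hpow (k + 1) with h | h
  · rw [← h, h0]
  · rw [← neg_eq_zero, ← h, h0]

omit hR in
/-- A bracket-compatible perturbation of the identity. -/
theorem exists_lieAut [Finite L] {f : L →+ L} (hD : ∀ x y, f (B x y) = 0)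
    (hf : ∀ x y, B (f x) y + B x (f y) + B (f x) (f y) = 0)
    (hinj : ∀ x, x + f x = 0 → x = 0) :
    ∃ φ : L ≃+ L, IsLieAut B φ ∧ ∀ x, φ x = x + f x := by
  have hi : Function.Injective (AddMonoidHom.id L + f) := by
    rw [injective_iff_map_eq_zero]
    exact hinj
  refine ⟨AddEquiv.ofBijective (AddMonoidHom.id L + f) (Finite.injective_iff_bijective.mp hi),
    ?_, fun x => rfl⟩
  intro x y
  change B x y + f (B x y) = B (x + f x) (y + f y)
  rw [hD]
  simp only [map_add, AddMonoidHom.add_apply]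
  have := hf x y
  rw [show B x y + B (f x) y + (B x (f y) + B (f x) (f y)) =
    B x y + (B (f x) y + B x (f y) + B (f x) (f y)) by abel, this]

theorem exists_central_lieAut [Finite L] {f : L →+ L} (hZ : ∀ x, f x ∈ center B)
    (hD : ∀ x y, f (B x y) = 0) : ∃ φ : L ≃+ L, IsLieAut B φ ∧ ∀ x, φ x = x + f x :=
  exists_lieAut hD (fun x y => by
    rw [hZ x y, hZ x (f y), hR.br_right_eq_zero (hZ y)]; simp)
    (fun _ hx => hR.eq_zero_of_add_eq_zero hZ hD hx)

/-- Automorphisms commute with homomorphisms from the abelianization to the centre. -/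
theorem comm_central [Finite L] {f : L →+ L} (hZ : ∀ x, f x ∈ center B)
    (hD : ∀ x y, f (B x y) = 0) {φ : L ≃+ L} (hφ : IsLieAut B φ) (x : L) :
    φ (f x) = f (φ x) := by
  obtain ⟨ψ, hψ, h⟩ := hR.exists_central_lieAut hZ hD
  have := hR.comm φ ψ hφ hψ x
  rw [h, h, map_add] at this
  exact add_left_cancel this

theorem central_comm_central [Finite L] {f g : L →+ L} (hfZ : ∀ x, f x ∈ center B)
    (hfD : ∀ x y, f (B x y) = 0) (hgZ : ∀ x, g x ∈ center B)
    (hgD : ∀ x y, g (B x y) = 0) (x : L) : g (f x) = f (g x) := by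
  obtain ⟨φ, hφ, h⟩ := hR.exists_central_lieAut hgZ hgD
  have := hR.comm_central hfZ hfD hφ x
  rw [h, h, map_add] at this
  exact add_left_cancel this

/-- Every automorphism is central. -/
theorem sub_mem_center [Finite L] {φ : L ≃+ L} (hφ : IsLieAut B φ) (x : L) :
    φ x - x ∈ center B := by
  intro y
  have h := hR.comm_central (f := B x) (fun z => hR.derived_le_center (br_mem_derived B x z))
    (fun y z => hR.br_right_eq_zero (hR.derived_le_center (br_mem_derived B y z))) hφ (φ.symm y)
  rw [hφ, AddEquiv.apply_symm_apply] at h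
  rw [map_sub, AddMonoidHom.sub_apply, h, sub_self]

theorem perturbation_mem_center [Finite L] {f : L →+ L} (hD : ∀ x y, f (B x y) = 0)
    (hf : ∀ x y, B (f x) y + B x (f y) + B (f x) (f y) = 0)
    (hinj : ∀ x, x + f x = 0 → x = 0) (x : L) : f x ∈ center B := by
  obtain ⟨φ, hφ, h⟩ := exists_lieAut hD hf hinj
  have := hR.sub_mem_center hφ x
  rwa [h, add_sub_cancel_left] at this

end Rigid

end

section

variable {L : Type*} [AddCommGroup L] {ι : Type*} [Fintype ι]

/-- The family `x` is a basis of `L` modulo `N`, with orders `q`. -/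
structure RelBasis (N : AddSubgroup L) (x : ι → L) (q : ι → ℕ) : Prop where
  mem : ∀ i, q i • x i ∈ N
  dvd : ∀ s : ι → ℤ, ∑ i, s i • x i ∈ N → ∀ i, (q i : ℤ) ∣ s i
  span : ∀ y, ∃ s : ι → ℤ, ∃ d ∈ N, y = ∑ i, s i • x i + d

namespace RelBasis

variable {N : AddSubgroup L} {x : ι → L} {q : ι → ℕ} (hb : RelBasis N x q)
include hb

theorem sum_mem_of_dvd {s : ι → ℤ} (hs : ∀ i, (q i : ℤ) ∣ s i) : ∑ i, s i • x i ∈ N := by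
  refine N.sum_mem fun i _ => ?_
  obtain ⟨c, hc⟩ := hs i
  rw [hc, mul_comm, mul_smul, natCast_zsmul]
  exact N.zsmul_mem (hb.mem i) c

theorem zsmul_mem_iff (i : ι) (c : ℤ) : c • x i ∈ N ↔ (q i : ℤ) ∣ c := by
  classical
  constructor
  · intro h
    have := hb.dvd (Pi.single i c) (by
      rw [Finset.sum_eq_single i]
      · simpa using h
      · intro j _ hj; simp [hj]
      · simp) i
    simpa using this
  · rintro ⟨k, rfl⟩
    rw [mul_comm, mul_smul, natCast_zsmul]
    exact N.zsmul_mem (hb.mem i) k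

theorem notMem (i : ι) (hq : q i ≠ 1) : x i ∉ N := by
  intro h
  have := (hb.zsmul_mem_iff i 1).mp (by simpa using h)
  exact hq (by exact_mod_cast Int.eq_one_of_dvd_one (by positivity) this)

/-- Extension of homomorphisms along a relative basis. -/
theorem exists_extend {M : Type*} [AddCommGroup M] (h : N →+ M) (y : ι → M)
    (hy : ∀ i, q i • y i = h ⟨q i • x i, hb.mem i⟩) :
    ∃ φ : L →+ M, (∀ i, φ (x i) = y i) ∧ ∀ d : N, φ d = h d := by
  classical
  let π : (ι → ℤ) × N →+ L := AddMonoidHom.mk' (fun s => ∑ i, s.1 i • x i + s.2) (by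
    intro a b
    simp only [Prod.fst_add, Pi.add_apply, add_smul, Finset.sum_add_distrib, Prod.snd_add,
      AddSubgroup.coe_add]
    abel)
  let Φ : (ι → ℤ) × N →+ M := AddMonoidHom.mk' (fun s => ∑ i, s.1 i • y i + h s.2) (by
    intro a b
    simp only [Prod.fst_add, Pi.add_apply, add_smul, Finset.sum_add_distrib, Prod.snd_add,
      map_add]
    abel)
  have hπ : Function.Surjective π := by
    intro z
    obtain ⟨s, d, hd, rfl⟩ := hb.span z
    exact ⟨(s, ⟨d, hd⟩), rfl⟩
  have hker : π.ker ≤ Φ.ker := by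
    rintro ⟨s, d⟩ hs
    have hs' : ∑ i, s i • x i + (d : L) = 0 := hs
    have hsum : ∑ i, s i • x i = -(d : L) := eq_neg_of_add_eq_zero_left hs'
    have hdv := hb.dvd s (hsum ▸ N.neg_mem d.2)
    choose c hc using hdv
    change ∑ i, s i • y i + h d = 0
    have h1 : ∑ i, s i • y i = h (∑ i, c i • ⟨q i • x i, hb.mem i⟩) := by
      rw [map_sum]
      refine Finset.sum_congr rfl fun i _ => ?_
      rw [map_zsmul, ← hy, ← natCast_zsmul, ← mul_smul, mul_comm, hc]
    have h2 : (∑ i, c i • (⟨q i • x i, hb.mem i⟩ : N)) = -d := by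
      apply Subtype.ext
      rw [AddSubgroup.coe_neg, ← hsum, AddSubgroup.val_finsetSum]
      refine Finset.sum_congr rfl fun i _ => ?_
      rw [AddSubgroup.coe_zsmul, hc, mul_comm, mul_smul, natCast_zsmul]
    rw [h1, h2, map_neg, neg_add_cancel]
  refine ⟨π.liftOfSurjective hπ ⟨Φ, hker⟩, fun i => ?_, fun d => ?_⟩
  · have : π (Pi.single i 1, 0) = x i := by
      change ∑ j, (Pi.single i 1 : ι → ℤ) j • x j + ((0 : N) : L) = x i
      rw [Finset.sum_eq_single i] <;> simp +contextual
    rw [← this, AddMonoidHom.liftOfRightInverse_comp_apply]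
    change ∑ j, (Pi.single i 1 : ι → ℤ) j • y j + h 0 = y i
    rw [Finset.sum_eq_single i] <;> simp +contextual
  · have : π (0, d) = d := by
      change ∑ j, (0 : ι → ℤ) j • x j + (d : L) = d
      simp
    rw [← this, AddMonoidHom.liftOfRightInverse_comp_apply]
    change ∑ j, (0 : ι → ℤ) j • y j + h d = h d
    simp

theorem exists_hom {M : Type*} [AddCommGroup M] (t : ι → M) (ht : ∀ i, q i • t i = 0) :
    ∃ f : L →+ M, (∀ i, f (x i) = t i) ∧ ∀ d ∈ N, f d = 0 := by
  obtain ⟨f, h1, h2⟩ := hb.exists_extend (0 : N →+ M) t (by simpa using ht)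
  exact ⟨f, h1, fun d hd => h2 ⟨d, hd⟩⟩

theorem br_mem {B : L →+ L →+ L} (hR : ∀ y, ∀ d ∈ N, B y d = 0 ∧ B d y = 0) {S : AddSubgroup L}
    (h : ∀ i j, B (x i) (x j) ∈ S) (y z : L) : B y z ∈ S := by
  obtain ⟨s, d, hd, rfl⟩ := hb.span y
  obtain ⟨t, e, he, rfl⟩ := hb.span z
  rw [map_add, (hR _ e he).1, add_zero, map_add, AddMonoidHom.add_apply, (hR _ d hd).2, add_zero,
    map_sum, map_sum]
  refine S.sum_mem fun i _ => ?_
  rw [AddMonoidHom.finsetSum_apply]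
  refine S.sum_mem fun j _ => ?_
  rw [map_zsmul, map_zsmul]
  exact S.zsmul_mem (S.zsmul_mem (h _ _) _) _

end RelBasis

/-- An independent family of the right total order spans. -/
theorem exists_eq_sum_of_card [Finite L] {N E : AddSubgroup L} (hNE : N ≤ E) {x : ι → L}
    {q : ι → ℕ} (hx : ∀ i, x i ∈ E)
    (dvd : ∀ s : ι → ℤ, ∑ i, s i • x i ∈ N → ∀ i, (q i : ℤ) ∣ s i)
    (hcard : Nat.card E ≤ (∏ i, q i) * Nat.card N) {y : L} (hy : y ∈ E) :
    ∃ s : ι → ℤ, ∃ d ∈ N, y = ∑ i, s i • x i + d := by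
  let F : (∀ i, Fin (q i)) × N → E := fun s => ⟨∑ i, ((s.1 i : ℕ) : ℤ) • x i + s.2,
    E.add_mem (E.sum_mem fun i _ => E.zsmul_mem (hx i) _) (hNE s.2.2)⟩
  have hinj : Function.Injective F := by
    rintro ⟨s, d⟩ ⟨t, e⟩ h
    have h' : ∑ i, ((s i : ℕ) : ℤ) • x i + (d : L) = ∑ i, ((t i : ℕ) : ℤ) • x i + (e : L) :=
      congrArg Subtype.val h
    have h1 : ∑ i, (((s i : ℕ) : ℤ) - ((t i : ℕ) : ℤ)) • x i ∈ N := by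
      simp only [sub_smul, Finset.sum_sub_distrib]
      rw [show ∑ i, ((s i : ℕ) : ℤ) • x i - ∑ i, ((t i : ℕ) : ℤ) • x i = e - d by
        rw [sub_eq_sub_iff_add_eq_add, h', add_comm]]
      exact N.sub_mem e.2 d.2
    have hst : s = t := by
      funext i
      have h2 := dvd _ h1 i
      have h3 := (s i).2
      have h4 := (t i).2
      apply Fin.ext
      have h5 : ((s i : ℕ) : ℤ) - ((t i : ℕ) : ℤ) = 0 :=
        Int.eq_zero_of_abs_lt_dvd h2 (by rw [abs_lt]; constructor <;> omega)
      omega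
    subst hst
    simp only [add_right_inj] at h'
    rw [Subtype.ext h']
  have hc : Nat.card ((∀ i, Fin (q i)) × N) = (∏ i, q i) * Nat.card N := by
    rw [Nat.card_prod, Nat.card_pi]; simp
  have hbij : Function.Bijective F := hinj.bijective_of_nat_card_le (hc ▸ hcard)
  obtain ⟨⟨s, d⟩, h⟩ := hbij.2 ⟨y, hy⟩
  exact ⟨fun i => ((s i : ℕ) : ℤ), d, d.2, (congrArg Subtype.val h).symm⟩

theorem RelBasis.of_dvd_of_card [Finite L] {N : AddSubgroup L} {x : ι → L} {q : ι → ℕ}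
    (mem : ∀ i, q i • x i ∈ N) (dvd : ∀ s : ι → ℤ, ∑ i, s i • x i ∈ N → ∀ i, (q i : ℤ) ∣ s i)
    (hcard : Nat.card L ≤ (∏ i, q i) * Nat.card N) : RelBasis N x q :=
  ⟨mem, dvd, fun _ => exists_eq_sum_of_card le_top (fun _ => AddSubgroup.mem_top _) dvd
    (by rwa [AddSubgroup.card_top]) (AddSubgroup.mem_top _)⟩

namespace Rigid

variable {p : ℕ} {B : L →+ L →+ L} (hR : Rigid p B)
include hR

theorem br_mem {N : AddSubgroup L} {x : ι → L} {q : ι → ℕ} (hb : RelBasis N x q)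
    (hN : N ≤ center B) {S : AddSubgroup L} (h : ∀ i j, B (x i) (x j) ∈ S) (y z : L) :
    B y z ∈ S :=
  hb.br_mem (fun _ _ hd => ⟨hR.br_right_eq_zero (hN hd), hN hd _⟩) h y z

theorem br_left_mem {N : AddSubgroup L} {x : ι → L} {q : ι → ℕ} (hb : RelBasis N x q)
    (hN : N ≤ center B) {S : AddSubgroup L} {y : L} (h : ∀ i, B y (x i) ∈ S) (z : L) :
    B y z ∈ S := by
  obtain ⟨t, e, he, rfl⟩ := hb.span z
  rw [map_add, hR.br_right_eq_zero (hN he), add_zero, map_sum]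
  refine S.sum_mem fun i _ => ?_
  rw [map_zsmul]
  exact S.zsmul_mem (h _) _

theorem mem_center_of_basis {N : AddSubgroup L} {x : ι → L} {q : ι → ℕ} (hb : RelBasis N x q)
    (hN : N ≤ center B) {y : L} (h : ∀ i, B y (x i) = 0) : y ∈ center B := fun z =>
  hR.br_left_mem (S := ⊥) hb hN h z

/-- A transvection along `Y` is central. -/
theorem transvection_mem_center [Finite L] {x : ι → L} {q : ι → ℕ}
    (hb : RelBasis (derived B) x q) {Y w : L} {s : ι → ℤ} (h : ∀ i, B Y (x i) = s i • w)
    (hs : ∀ i, q i • s i • Y = 0) (i : ι) : s i • Y ∈ center B := by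
  by_cases hw : w = 0
  · refine AddSubgroup.zsmul_mem _ (hR.mem_center_of_basis hb hR.derived_le_center ?_) _
    intro j; rw [h, hw, smul_zero]
  obtain ⟨f, hf, hfD⟩ := hb.exists_hom (fun i => s i • Y) hs
  have key : ∀ z, ∃ c : ℤ, f z = c • Y ∧ B Y z = c • w := by
    intro z
    obtain ⟨c, d, hd, rfl⟩ := hb.span z
    refine ⟨∑ i, c i * s i, ?_, ?_⟩
    · rw [map_add, hfD d hd, add_zero, map_sum, Finset.sum_smul]
      refine Finset.sum_congr rfl fun i _ => ?_
      rw [map_zsmul, hf, mul_smul]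
    · rw [map_add, hR.br_right_eq_zero (hR.derived_le_center hd), add_zero, map_sum,
        Finset.sum_smul]
      refine Finset.sum_congr rfl fun i _ => ?_
      rw [map_zsmul, h, mul_smul]
  have hmain := hR.perturbation_mem_center (f := f) (fun y z => hfD _ (br_mem_derived B y z))
    (by
      intro y z
      obtain ⟨c, hc, hc'⟩ := key y
      obtain ⟨e, he, he'⟩ := key z
      rw [hc, he, hR.skew y]
      simp only [map_zsmul, AddMonoidHom.zsmul_apply, hc', he', hR.alt, smul_zero, add_zero]
      rw [smul_comm, add_neg_cancel])
    (by
      intro z hz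
      obtain ⟨k, hk, hk'⟩ := key Y
      rw [hR.alt] at hk'
      have hpk : (p : ℤ) ∣ k := by
        by_contra hn
        exact hw (hR.zsmul_eq_zero_of_coprime hk'.symm hn)
      obtain ⟨c, hc, -⟩ := key z
      have hz' : z = -(c • Y) := by rw [← hc]; exact eq_neg_of_add_eq_zero_left hz
      have h2 : f z = -(c • k • Y) := by
        conv_lhs => rw [hz']
        rw [map_neg, map_zsmul, hk]
      have h3 : (1 + k) • c • Y = 0 := by
        have h4 : c • Y + c • k • Y = 0 := by rw [← hc, h2, neg_add_cancel]
        rw [← h4]; module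
      have h4 := hR.zsmul_eq_zero_of_coprime h3 (by
        rintro ⟨m, hm⟩
        obtain ⟨n, rfl⟩ := hpk
        have : (p : ℤ) ∣ 1 := ⟨m - n, by linarith⟩
        have := Int.eq_one_of_dvd_one (by positivity) this
        exact hR.prime.one_lt.ne' (by exact_mod_cast this))
      rw [hz', h4, neg_zero]) (x i)
  rwa [hf] at hmain

/-- Sign grading along a basis. -/
theorem sign_grading [Finite L] {x : ι → L} {q : ι → ℕ} (hb : RelBasis (derived B) x q)
    (s : ι → Bool) (E : Bool → AddSubgroup L) (hE : ∀ b, E b ≤ derived B)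
    (hd : Disjoint (E true) (E false)) (hx : ∀ i, q i • x i ∈ E (s i))
    (hB : ∀ i j, B (x i) (x j) ∈ E (s i == s j)) {i : ι} (hi : s i = false) (hq : q i ≠ 1) :
    False := by
  classical
  let T : Bool → AddSubgroup L := fun b =>
    { carrier := {y | ∃ c : ι → ℤ, ∃ d ∈ E b, (∀ i, s i ≠ b → c i = 0) ∧ y = ∑ i, c i • x i + d}
      zero_mem' := ⟨0, 0, (E b).zero_mem, by simp⟩
      add_mem' := by
        rintro _ _ ⟨c, d, hd, hc, rfl⟩ ⟨c', d', hd', hc', rfl⟩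
        refine ⟨c + c', d + d', (E b).add_mem hd hd', fun i hi => by simp [hc i hi, hc' i hi], ?_⟩
        simp only [Pi.add_apply, add_smul, Finset.sum_add_distrib]; abel
      neg_mem' := by
        rintro _ ⟨c, d, hd, hc, rfl⟩
        refine ⟨-c, -d, (E b).neg_mem hd, fun i hi => by simp [hc i hi], ?_⟩
        simp only [Pi.neg_apply, neg_smul, Finset.sum_neg_distrib]; abel }
  have hET : ∀ b, E b ≤ T b := fun b d hd => ⟨0, d, hd, by simp, by simp⟩
  have hxT : ∀ i, x i ∈ T (s i) := fun i => ⟨Pi.single i 1, 0, (E _).zero_mem, by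
    intro j hj
    rw [Pi.single_eq_of_ne]
    rintro rfl; exact hj rfl, by
    rw [Finset.sum_eq_single i] <;> simp +contextual⟩
  have hTB : ∀ b b', ∀ y ∈ T b, ∀ z ∈ T b', B y z ∈ E (b == b') := by
    rintro b b' _ ⟨c, d, hd, hc, rfl⟩ _ ⟨c', d', hd', hc', rfl⟩
    rw [map_add, hR.br_right_eq_zero (hR.derived_le_center (hE _ hd')), add_zero, map_add,
      AddMonoidHom.add_apply, (hR.derived_le_center (hE _ hd)) _, add_zero, map_sum, map_sum]
    refine AddSubgroup.sum_mem _ fun i _ => ?_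
    rw [AddMonoidHom.finsetSum_apply]
    refine AddSubgroup.sum_mem _ fun j _ => ?_
    rw [map_zsmul, map_zsmul]
    by_cases h1 : s j = b
    · by_cases h2 : s i = b'
      · rw [← h1, ← h2]
        exact AddSubgroup.zsmul_mem _ (AddSubgroup.zsmul_mem _ (hB _ _) _) _
      · rw [hc' _ h2, zero_smul]; exact AddSubgroup.zero_mem _
    · rw [AddMonoidHom.zsmul_apply, hc _ h1, zero_smul, smul_zero]; exact AddSubgroup.zero_mem _
  have hDE : derived B ≤ E true ⊔ E false := by
    rw [derived, AddSubgroup.closure_le]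
    rintro _ ⟨y, z, rfl⟩
    refine hR.br_mem hb hR.derived_le_center (fun i j => ?_) y z
    have := hB i j
    cases h : (s i == s j) <;> rw [h] at this
    · exact AddSubgroup.mem_sup_right this
    · exact AddSubgroup.mem_sup_left this
  have hcod : T true ⊔ T false = ⊤ := by
    rw [eq_top_iff]
    intro y _
    obtain ⟨c, d, hd, rfl⟩ := hb.span y
    refine AddSubgroup.add_mem _ (AddSubgroup.sum_mem _ fun i _ => ?_)
      (sup_le_sup (hET _) (hET _) (hDE hd))
    refine AddSubgroup.zsmul_mem _ ?_ _
    have := hxT i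
    cases h : s i <;> rw [h] at this
    · exact AddSubgroup.mem_sup_right this
    · exact AddSubgroup.mem_sup_left this
  have hdis : Disjoint (T true) (T false) := by
    rw [AddSubgroup.disjoint_def]
    rintro y ⟨c, d, hdt, hc, rfl⟩ ⟨c', d', hdf, hc', he⟩
    have h1 : ∑ i, (c i - c' i) • x i ∈ derived B := by
      simp only [sub_smul, Finset.sum_sub_distrib]
      rw [show ∑ i, c i • x i - ∑ i, c' i • x i = d' - d by
        rw [sub_eq_sub_iff_add_eq_add, he, add_comm]]
      exact AddSubgroup.sub_mem _ (hE _ hdf) (hE _ hdt)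
    have h2 := hb.dvd _ h1
    have hsum : ∀ b, ∀ c : ι → ℤ, (∀ i, s i ≠ b → c i = 0) → (∀ i, s i = b → (q i : ℤ) ∣ c i) →
        ∑ i, c i • x i ∈ E b := by
      intro b c h3 h4
      refine AddSubgroup.sum_mem _ fun i _ => ?_
      by_cases h5 : s i = b
      · obtain ⟨k, hk⟩ := h4 i h5
        rw [hk, mul_comm, mul_smul, natCast_zsmul, ← h5]
        exact AddSubgroup.zsmul_mem _ (hx i) _
      · rw [h3 i h5, zero_smul]; exact AddSubgroup.zero_mem _
    refine AddSubgroup.disjoint_def.mp hd (x := ∑ i, c i • x i + d)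
      (AddSubgroup.add_mem _ (hsum _ c hc fun i hi => ?_) hdt)
      (he ▸ AddSubgroup.add_mem _ (hsum _ c' hc' fun i hi => ?_) hdf)
    · have := h2 i
      rwa [hc' i (by simp [hi]), sub_zero] at this
    · have := h2 i
      rwa [hc i (by simp [hi]), zero_sub, dvd_neg] at this
  have hbot := hR.odd_part_eq_bot ⟨hdis, codisjoint_iff.mpr hcod⟩
    (fun y hy z hz => hET _ (hTB true true y hy z hz))
    (fun y hy z hz => hET _ (hTB false false y hy z hz))
    (fun y hy z hz => hET _ (hTB true false y hy z hz))
  have h0 := hxT i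
  rw [hi, hbot, AddSubgroup.mem_bot] at h0
  exact hb.notMem i hq (h0 ▸ AddSubgroup.zero_mem _)

/-- A derivation-type perturbation supported on an abelian subgroup is central. -/
theorem mem_center_of_abelian [Finite L] {U : AddSubgroup L} (hD : derived B ≤ U)
    (hU : ∀ u ∈ U, ∀ v ∈ U, B u v = 0) {x y : L} (hb : RelBasis U ![x, y] ![p, p]) {u v : L}
    (hu : u ∈ U) (hv : v ∈ U) (hpu : p • u = 0) (hpv : p • v = 0) (h : B u y + B x v = 0) :
    u ∈ center B ∧ v ∈ center B := by
  obtain ⟨f, hf, hfU⟩ := hb.exists_hom ![u, v] (by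
    intro i; fin_cases i
    · exact hpu
    · exact hpv)
  have hfx : f x = u := hf 0
  have hfy : f y = v := hf 1
  have key : ∀ z, ∃ a b : ℤ, ∃ n ∈ U, z = a • x + b • y + n := by
    intro z
    obtain ⟨c, d, hd, rfl⟩ := hb.span z
    exact ⟨c 0, c 1, d, hd, by simp [Fin.sum_univ_two]⟩
  have hfz : ∀ a b : ℤ, ∀ n ∈ U, f (a • x + b • y + n) = a • u + b • v := by
    intro a b n hn
    rw [map_add, hfU n hn, map_add, map_zsmul, map_zsmul, hfx, hfy, add_zero]
  have hin : ∀ z, f z ∈ U := by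
    intro z
    obtain ⟨a, b, n, hn, rfl⟩ := key z
    rw [hfz a b n hn]
    exact U.add_mem (U.zsmul_mem hu _) (U.zsmul_mem hv _)
  have hxv : B x v = B y u := by
    rw [hR.skew y u]; exact eq_neg_of_add_eq_zero_right h
  have hmain := hR.perturbation_mem_center (f := f) (fun y z => hfU _ (hD (br_mem_derived B y z)))
    (by
      intro z z'
      rw [hU _ (hin z) _ (hin z'), add_zero]
      obtain ⟨a, b, n, hn, rfl⟩ := key z
      obtain ⟨a', b', n', hn', rfl⟩ := key z'
      rw [hfz a b n hn, hfz a' b' n' hn']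
      simp only [map_add, map_zsmul, AddMonoidHom.add_apply, AddMonoidHom.zsmul_apply,
        hU u hu n' hn', hU v hv n' hn', hU n hn u hu, hU n hn v hv]
      rw [hR.skew u x, hR.skew v x, hR.skew u y, hR.skew v y, hxv]
      module)
    (by
      intro z hz
      have : z = -f z := eq_neg_of_add_eq_zero_left hz
      have h0 : f z = 0 := hfU z (this ▸ U.neg_mem (hin z))
      rw [this, h0, neg_zero])
  exact ⟨hfx ▸ hmain x, hfy ▸ hmain y⟩

end Rigid

/-- Central elements killed by `q`. -/
def centralTorsion (B : L →+ L →+ L) (q : ℕ) : AddSubgroup L where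
  carrier := {z | z ∈ center B ∧ q • z = 0}
  zero_mem' := ⟨AddSubgroup.zero_mem _, smul_zero _⟩
  add_mem' := fun ha hb => ⟨AddSubgroup.add_mem _ ha.1 hb.1, by rw [smul_add, ha.2, hb.2, add_zero]⟩
  neg_mem' := fun ha => ⟨AddSubgroup.neg_mem _ ha.1, by rw [smul_neg, ha.2, neg_zero]⟩

theorem mem_centralTorsion {B : L →+ L →+ L} {q : ℕ} {z : L} :
    z ∈ centralTorsion B q ↔ z ∈ center B ∧ q • z = 0 := Iff.rfl

theorem Rigid.prod_card_le [Finite L] {p : ℕ} {B : L →+ L →+ L} (hR : Rigid p B)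
    {x : ι → L} {q : ι → ℕ} (hb : RelBasis (derived B) x q) :
    ∏ i, Nat.card (centralTorsion B (q i)) ≤ Nat.card {φ : L ≃+ L // IsLieAut B φ} := by
  rw [← Nat.card_pi]
  have key : ∀ t : ∀ i, centralTorsion B (q i), ∃ φ : {φ : L ≃+ L // IsLieAut B φ},
      ∀ i, φ.1 (x i) = x i + t i := by
    intro t
    obtain ⟨f, hf, hfD⟩ := hb.exists_hom (fun i => (t i : L)) (fun i => (t i).2.2)
    have hZ : ∀ z, f z ∈ center B := by
      intro z
      obtain ⟨c, d, hd, rfl⟩ := hb.span z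
      rw [map_add, hfD d hd, add_zero, map_sum]
      refine AddSubgroup.sum_mem _ fun i _ => ?_
      rw [map_zsmul, hf]
      exact AddSubgroup.zsmul_mem _ (t i).2.1 _
    obtain ⟨φ, hφ, h⟩ := hR.exists_central_lieAut hZ fun y z => hfD _ (br_mem_derived B y z)
    exact ⟨⟨φ, hφ⟩, fun i => by rw [h, hf]⟩
  choose F hF using key
  have : Finite (L ≃+ L) := Finite.of_injective (fun φ => (φ : L → L)) DFunLike.coe_injective
  refine Nat.card_le_card_of_injective F fun t t' h => ?_
  funext i
  have := hF t i
  rw [h, hF t' i] at this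
  exact (Subtype.ext (add_left_cancel this)).symm

end

section

variable {L : Type*} [AddCommGroup L]

theorem RelBasis.reindex {ι κ : Type*} [Fintype ι] [Fintype κ] {N : AddSubgroup L} {x : ι → L}
    {q : ι → ℕ} (hb : RelBasis N x q) (e : κ ≃ ι) : RelBasis N (x ∘ e) (q ∘ e) where
  mem i := hb.mem _
  dvd s hs i := by
    have := hb.dvd (s ∘ e.symm) (by
      rw [← e.sum_comp]; simpa using hs) (e i)
    simpa using this
  span y := by
    obtain ⟨s, d, hd, h⟩ := hb.span y
    exact ⟨s ∘ e, d, hd, by rw [h, ← e.sum_comp]; simp⟩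

theorem RelBasis.card_eq {ι : Type*} [Fintype ι] {N : AddSubgroup L} {x : ι → L}
    {q : ι → ℕ} (hb : RelBasis N x q) (hq : ∀ i, 0 < q i) :
    Nat.card L = (∏ i, q i) * Nat.card N := by
  let F : (∀ i, Fin (q i)) × N → L := fun s => ∑ i, ((s.1 i : ℕ) : ℤ) • x i + s.2
  have hinj : Function.Injective F := by
    rintro ⟨s, d⟩ ⟨t, e⟩ h
    have h' : ∑ i, ((s i : ℕ) : ℤ) • x i + (d : L) = ∑ i, ((t i : ℕ) : ℤ) • x i + (e : L) := h
    have h1 : ∑ i, (((s i : ℕ) : ℤ) - ((t i : ℕ) : ℤ)) • x i ∈ N := by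
      simp only [sub_smul, Finset.sum_sub_distrib]
      rw [show ∑ i, ((s i : ℕ) : ℤ) • x i - ∑ i, ((t i : ℕ) : ℤ) • x i = e - d by
        rw [sub_eq_sub_iff_add_eq_add, h', add_comm]]
      exact N.sub_mem e.2 d.2
    have hst : s = t := by
      funext i
      have h2 := hb.dvd _ h1 i
      have h3 := (s i).2
      have h4 := (t i).2
      apply Fin.ext
      have h5 : ((s i : ℕ) : ℤ) - ((t i : ℕ) : ℤ) = 0 :=
        Int.eq_zero_of_abs_lt_dvd h2 (by rw [abs_lt]; constructor <;> omega)
      omega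
    subst hst
    simp only [add_right_inj] at h'
    rw [Subtype.ext h']
  have hsurj : Function.Surjective F := by
    intro y
    obtain ⟨s, d, hd, rfl⟩ := hb.span y
    have hr : ∀ i, (s i % q i).toNat < q i := fun i => by
      have h1 := Int.emod_nonneg (s i) (b := q i) (by have := hq i; omega)
      have h2 := Int.emod_lt_of_pos (s i) (b := q i) (by have := hq i; omega)
      omega
    have hm : ∑ i, (s i - s i % q i) • x i ∈ N := hb.sum_mem_of_dvd fun i =>
      ⟨s i / q i, by have := Int.mul_ediv_add_emod (s i) (q i); linarith⟩
    refine ⟨(fun i => ⟨(s i % q i).toNat, hr i⟩, ⟨_, N.add_mem hm hd⟩), ?_⟩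
    change ∑ i, (((s i % q i).toNat : ℕ) : ℤ) • x i + (∑ i, (s i - s i % q i) • x i + d) = _
    rw [← add_assoc, ← Finset.sum_add_distrib]
    congr 1
    refine Finset.sum_congr rfl fun i _ => ?_
    rw [Int.toNat_of_nonneg (Int.emod_nonneg _ (by have := hq i; omega)), ← add_smul,
      add_sub_cancel]
  rw [← Nat.card_eq_of_bijective F ⟨hinj, hsurj⟩, Nat.card_prod, Nat.card_pi]; simp

theorem exists_relBasis [Finite L] {p : ℕ} (hp : p.Prime) (ht : ∀ x : L, ∃ k : ℕ, p ^ k • x = 0)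
    (N : AddSubgroup L) : ∃ (n : ℕ) (a : Fin n → ℕ) (x : Fin n → L), Antitone a ∧ (∀ i, 1 ≤ a i) ∧
      RelBasis N x (fun i => p ^ a i) := by
  classical
  obtain ⟨ι, _, q, hq, ⟨e⟩⟩ := AddCommGroup.equiv_directSum_zmod_of_finite' (L ⧸ N)
  let g : ι → L ⧸ N := fun i => e.symm (DirectSum.of (fun i => ZMod (q i)) i 1)
  have hg : ∀ i, ∃ x : L, (x : L ⧸ N) = g i := fun i => QuotientAddGroup.mk_surjective (g i)
  choose x hx using hg
  have hsum : ∀ s : ι → ℤ, e ((∑ i, s i • x i : L) : L ⧸ N) =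
      ∑ i, DirectSum.of (fun i => ZMod (q i)) i (s i : ZMod (q i)) := by
    intro s
    have : ((∑ i, s i • x i : L) : L ⧸ N) = ∑ i, s i • g i := by
      rw [← QuotientAddGroup.mk'_apply, map_sum]
      refine Finset.sum_congr rfl fun i _ => ?_
      rw [map_zsmul, QuotientAddGroup.mk'_apply, hx]
    rw [this, map_sum]
    refine Finset.sum_congr rfl fun i _ => ?_
    rw [map_zsmul, AddEquiv.apply_symm_apply, ← map_zsmul]; simp
  have hco : ∀ s : ι → ℤ, ∀ i,
      (∑ i, DirectSum.of (fun i => ZMod (q i)) i (s i : ZMod (q i))) i = (s i : ZMod (q i)) := by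
    intro s i
    rw [DFinsupp.finsetSum_apply]
    rw [Finset.sum_eq_single i]
    · exact DirectSum.of_eq_same _ _
    · intro j _ hj; exact DirectSum.of_eq_of_ne _ _ _ hj.symm
    · simp
  have hb : RelBasis N x q := by
    refine ⟨fun i => ?_, fun s hs i => ?_, fun y => ?_⟩
    · rw [← QuotientAddGroup.eq_zero_iff, ← QuotientAddGroup.mk'_apply, map_nsmul,
        QuotientAddGroup.mk'_apply, hx, ← map_nsmul, ← map_nsmul]; simp
    · rw [← QuotientAddGroup.eq_zero_iff] at hs
      have h1 := hsum s
      rw [hs, map_zero] at h1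
      have h2 := hco s i
      rw [← h1] at h2
      exact (ZMod.intCast_zmod_eq_zero_iff_dvd _ _).mp h2.symm
    · have : ∀ i, ∃ c : ℤ, (c : ZMod (q i)) = e (y : L ⧸ N) i := fun i => ZMod.intCast_surjective _
      choose s hs using this
      refine ⟨s, y - ∑ i, s i • x i, ?_, by abel⟩
      rw [← QuotientAddGroup.eq_zero_iff, ← e.map_eq_zero_iff, QuotientAddGroup.mk_sub, map_sub,
        hsum, sub_eq_zero]
      refine DFinsupp.ext fun i => ?_
      rw [hco, hs]
  have hqa : ∀ i, ∃ a : ℕ, 1 ≤ a ∧ q i = p ^ a := by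
    intro i
    obtain ⟨k, hk⟩ := ht (x i)
    have h1 := (hb.zsmul_mem_iff i ((p ^ k : ℕ) : ℤ)).mp (by
      rw [natCast_zsmul, hk]; exact N.zero_mem)
    obtain ⟨a, -, ha⟩ := (Nat.dvd_prime_pow hp).mp (Int.natCast_dvd_natCast.mp h1)
    refine ⟨a, ?_, ha⟩
    by_contra h0
    have := hq i
    rw [ha, show a = 0 by omega] at this
    simp at this
  choose a ha1 ha using hqa
  let ε := (Fintype.equivFin ι).symm
  let σ : Equiv.Perm (Fin (Fintype.card ι)) := Tuple.sort (fun i => OrderDual.toDual (a (ε i)))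
  have hbs := hb.reindex (σ.trans ε)
  refine ⟨Fintype.card ι, fun i => a (ε (σ i)), x ∘ (σ.trans ε), ?_, fun i => ha1 _, ?_⟩
  · intro i j hij
    exact Tuple.monotone_sort (fun i => OrderDual.toDual (a (ε i))) hij
  · have : q ∘ (σ.trans ε) = fun i => p ^ a (ε (σ i)) := by
      funext i; simp [ha]
    rwa [this] at hbs

/-- Too many elements in a small quotient satisfy a relation. -/
theorem exists_relation [Finite L] {κ : Type*} [Fintype κ] (p : ℕ) {D E : AddSubgroup L}
    (hDE : D ≤ E) {e : κ → L} (he : ∀ i, e i ∈ E)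
    (hc : Nat.card E < p ^ Fintype.card κ * Nat.card D) :
    ∃ s : κ → ℤ, (∃ i, ¬ (p : ℤ) ∣ s i) ∧ ∑ i, s i • e i ∈ D := by
  let F : (κ → Fin p) × D → E := fun s => ⟨∑ i, ((s.1 i : ℕ) : ℤ) • e i + s.2,
    E.add_mem (E.sum_mem fun i _ => E.zsmul_mem (he i) _) (hDE s.2.2)⟩
  have hninj : ¬ Function.Injective F := by
    intro h
    have := Nat.card_le_card_of_injective F h
    rw [Nat.card_prod, Nat.card_fun] at this
    simp at this
    omega
  rw [Function.not_injective_iff] at hninj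
  obtain ⟨⟨s, d⟩, ⟨t, d'⟩, h, hne⟩ := hninj
  have h' : ∑ i, ((s i : ℕ) : ℤ) • e i + (d : L) = ∑ i, ((t i : ℕ) : ℤ) • e i + (d' : L) :=
    congrArg Subtype.val h
  refine ⟨fun i => ((s i : ℕ) : ℤ) - ((t i : ℕ) : ℤ), ?_, ?_⟩
  · by_contra! hall
    have hst : s = t := by
      funext i
      have h2 := hall i
      have h3 := (s i).2
      have h4 := (t i).2
      apply Fin.ext
      have h5 : ((s i : ℕ) : ℤ) - ((t i : ℕ) : ℤ) = 0 :=
        Int.eq_zero_of_abs_lt_dvd h2 (by rw [abs_lt]; constructor <;> omega)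
      omega
    subst hst
    simp only [add_right_inj] at h'
    exact hne (by rw [Subtype.ext h'])
  · simp only [sub_smul, Finset.sum_sub_distrib]
    rw [show ∑ i, ((s i : ℕ) : ℤ) • e i - ∑ i, ((t i : ℕ) : ℤ) • e i = d' - d by
      rw [sub_eq_sub_iff_add_eq_add, h', add_comm]]
    exact D.sub_mem d'.2 d.2

/-- A large elementary quotient contains independent elements. -/
theorem exists_independent [Finite L] {p : ℕ} (hp : p.Prime)
    (ht : ∀ x : L, ∃ k : ℕ, p ^ k • x = 0) {D E : AddSubgroup L} (hDE : D ≤ E)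
    (hpE : ∀ x ∈ E, p • x ∈ D) {k : ℕ} (hc : p ^ k * Nat.card D ≤ Nat.card E) :
    ∃ e : Fin k → L, (∀ i, e i ∈ E) ∧
      ∀ s : Fin k → ℤ, ∑ i, s i • e i ∈ D → ∀ i, (p : ℤ) ∣ s i := by
  obtain ⟨n, a, x, -, ha, hb⟩ := exists_relBasis (L := E) hp
    (fun x => (ht x).imp fun k hk => Subtype.ext hk) (D.addSubgroupOf E)
  have ha1 : ∀ i, a i = 1 := by
    intro i
    have h1 := (hb.zsmul_mem_iff i (p : ℤ)).mp (by
      rw [AddSubgroup.mem_addSubgroupOf, natCast_zsmul]; exact hpE _ (x i).2)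
    have h2 : p ^ a i ∣ p ^ 1 := by rw [pow_one]; exact_mod_cast h1
    have := (Nat.pow_dvd_pow_iff_le_right hp.one_lt).mp h2
    have := ha i
    omega
  have hcard := hb.card_eq (fun i => by have := hp.pos; positivity)
  have hDc : Nat.card (D.addSubgroupOf E) = Nat.card D :=
    Nat.card_congr (AddSubgroup.addSubgroupOfEquivOfLe hDE).toEquiv
  have hkn : k ≤ n := by
    rw [hcard, hDc] at hc
    simp only [ha1, pow_one, Finset.prod_const, Finset.card_univ, Fintype.card_fin] at hc
    exact (Nat.pow_le_pow_iff_right hp.one_lt).mp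
      (Nat.le_of_mul_le_mul_right hc Nat.card_pos)
  refine ⟨fun i => x (Fin.castLE hkn i), fun i => (x _).2, fun s hs i => ?_⟩
  classical
  let f : Fin k ↪ Fin n := Fin.castLEEmb hkn
  let s' : Fin n → ℤ := Function.extend f s 0
  have h1 := hb.dvd s' (by
    rw [AddSubgroup.mem_addSubgroupOf]
    convert hs
    rw [AddSubgroup.val_finsetSum]
    rw [← Finset.sum_subset (Finset.subset_univ (Finset.univ.map f))]
    · rw [Finset.sum_map]
      refine Finset.sum_congr rfl fun j _ => ?_
      rw [AddSubgroup.coe_zsmul]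
      simp only [s', f.injective.extend_apply]; rfl
    · intro j _ hj
      rw [AddSubgroup.coe_zsmul]
      have : s' j = 0 := by
        apply Function.extend_apply'
        rintro ⟨i, hi⟩
        exact hj (by simp [← hi])
      rw [this, zero_smul]) (f i)
  simp only [s', f.injective.extend_apply, ha1, pow_one] at h1
  exact h1

end

section

variable {L : Type*} [AddCommGroup L]

theorem card_eq_card_inf_ker_mul_card_map {M : Type*} [AddCommGroup M] (K : AddSubgroup L)
    (f : L →+ M) :
    Nat.card K = Nat.card (K ⊓ f.ker : AddSubgroup L) * Nat.card (K.map f) := by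
  let g := f.comp K.subtype
  have h1 := AddSubgroup.card_eq_card_quotient_mul_card_addSubgroup g.ker
  rw [Nat.card_congr (QuotientAddGroup.quotientKerEquivRange g).toEquiv, mul_comm] at h1
  have h2 : g.range = K.map f := by
    rw [AddMonoidHom.range_comp, AddSubgroup.range_subtype]
  have h3 : g.ker.map K.subtype = K ⊓ f.ker := by
    ext y
    simp only [AddSubgroup.mem_map, AddMonoidHom.mem_ker, AddSubgroup.mem_inf]
    constructor
    · rintro ⟨z, hz, rfl⟩; exact ⟨z.2, hz⟩
    · rintro ⟨hy, hz⟩; exact ⟨⟨y, hy⟩, hz, rfl⟩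
  rw [h1, h2, ← h3, AddSubgroup.card_map_of_injective K.subtype_injective]

theorem card_le_of_le [Finite L] {K M : AddSubgroup L} (h : K ≤ M) : Nat.card K ≤ Nat.card M :=
  Nat.card_le_card_of_injective _ (AddSubgroup.inclusion_injective h)

/-- The central elements of order dividing `p` that are `p ^ c`-th multiples of central elements. -/
def centralSocle (p : ℕ) (B : L →+ L →+ L) (c : ℕ) : AddSubgroup L :=
  (centralTorsion B (p ^ (c + 1))).map (nsmulAddMonoidHom (p ^ c))

theorem mem_centralSocle {p : ℕ} {B : L →+ L →+ L} {c : ℕ} {w : L} :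
    w ∈ centralSocle p B c ↔ ∃ z ∈ center B, p ^ (c + 1) • z = 0 ∧ p ^ c • z = w := by
  simp [centralSocle, AddSubgroup.mem_map, mem_centralTorsion, and_assoc]

theorem smul_eq_zero_of_mem_centralSocle {p : ℕ} {B : L →+ L →+ L} {c : ℕ} {w : L}
    (h : w ∈ centralSocle p B c) : p • w = 0 := by
  obtain ⟨z, -, hz, rfl⟩ := mem_centralSocle.mp h
  rw [← mul_smul, ← pow_succ', hz]

theorem centralTorsion_mono {B : L →+ L →+ L} {p k l : ℕ} (h : k ≤ l) :
    centralTorsion B (p ^ k) ≤ centralTorsion B (p ^ l) := by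
  rintro z ⟨hz, h0⟩
  refine ⟨hz, ?_⟩
  rw [← Nat.sub_add_cancel h, pow_add, mul_smul, h0, smul_zero]

theorem card_centralTorsion_succ {B : L →+ L →+ L} {p c : ℕ} :
    Nat.card (centralTorsion B (p ^ (c + 1))) =
      Nat.card (centralTorsion B (p ^ c)) * Nat.card (centralSocle p B c) := by
  rw [card_eq_card_inf_ker_mul_card_map _ (nsmulAddMonoidHom (p ^ c)), centralSocle]
  congr 2
  have : centralTorsion B (p ^ (c + 1)) ⊓ (nsmulAddMonoidHom (p ^ c) : L →+ L).ker =
      centralTorsion B (p ^ c) := by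
    ext z
    simp only [AddSubgroup.mem_inf, AddMonoidHom.mem_ker, nsmulAddMonoidHom_apply]
    constructor
    · rintro ⟨h1, h2⟩; exact ⟨h1.1, h2⟩
    · intro h; exact ⟨centralTorsion_mono (Nat.le_succ c) h, h.2⟩
  rw [this]

namespace Rigid

variable {p : ℕ} {B : L →+ L →+ L} (hR : Rigid p B)
include hR

theorem exists_card_eq_pow [Finite L] (S : AddSubgroup L) : ∃ k : ℕ, Nat.card S = p ^ k := by
  have := Fact.mk hR.prime
  have h : IsPGroup p (Multiplicative S) := by
    intro x
    obtain ⟨k, hk⟩ := hR.torsion (x.toAdd : L)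
    exact ⟨k, Multiplicative.toAdd.injective (Subtype.ext hk)⟩
  obtain ⟨k, hk⟩ := IsPGroup.iff_card.mp h
  exact ⟨k, hk⟩

omit hR in
theorem nsmul_mem_center {k : ℕ} (h : ∀ y z, k • B y z = 0) (x : L) : k • x ∈ center B := by
  intro y; rw [map_nsmul, AddMonoidHom.nsmul_apply, h]

/-- A subgroup of order less than `p ^ 2` killed by `p` is generated by any nonzero element. -/
theorem exists_eq_zsmul_of_card_lt [Finite L] {S : AddSubgroup L} (hS : Nat.card S < p ^ 2)
    {w v : L} (hw : w ∈ S) (hv : v ∈ S) (hpv : p • v = 0) (hw0 : w ≠ 0) :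
    ∃ k : ℤ, v = k • w := by
  obtain ⟨s, ⟨i, hi⟩, hs⟩ := exists_relation (κ := Fin 2) p (bot_le : ⊥ ≤ S) (e := ![w, v])
    (by intro i; fin_cases i; exacts [hw, hv]) (by simpa using hS)
  simp only [Fin.sum_univ_two, Matrix.cons_val_zero, Matrix.cons_val_one, AddSubgroup.mem_bot]
    at hs
  by_cases h1 : (p : ℤ) ∣ s 1
  · have h0 : ¬ (p : ℤ) ∣ s 0 := by
      intro h0; fin_cases i
      exacts [hi h0, hi h1]
    exfalso
    obtain ⟨c, hc⟩ := h1
    rw [hc, mul_comm, mul_smul, natCast_zsmul, hpv, smul_zero, add_zero] at hs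
    exact hw0 (hR.zsmul_eq_zero_of_coprime hs h0)
  · have := hR.mem_of_zsmul_mem (S := AddSubgroup.zmultiples w) (x := v) (s := s 1) (by
      rw [eq_neg_of_add_eq_zero_right hs]
      exact AddSubgroup.neg_mem _ (AddSubgroup.zsmul_mem _ (AddSubgroup.mem_zmultiples w) _)) h1
    obtain ⟨k, hk⟩ := this
    exact ⟨k, hk.symm⟩

/-- If `p ^ c` times the bracket is not zero then the central socle is not cyclic. -/
theorem le_card_centralSocle [Finite L] {ι : Type*} [Fintype ι] {x : ι → L} {a : ι → ℕ}
    (hb : RelBasis (derived B) x (fun i => p ^ a i)) {c : ℕ}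
    (hex : ∀ y z, p ^ (c + 1) • B y z = 0) {y₀ z₀ : L} (hne : p ^ c • B y₀ z₀ ≠ 0) :
    p ^ 2 ≤ Nat.card (centralSocle p B c) := by
  by_contra! hlt
  have hbr : ∀ y z, p ^ c • B y z ∈ centralSocle p B c := fun y z =>
    mem_centralSocle.mpr ⟨_, hR.derived_le_center (br_mem_derived B y z), hex y z, rfl⟩
  let P : AddSubgroup L := (⊤ : AddSubgroup L).map (nsmulAddMonoidHom (p ^ c)) ⊔ center B
  by_cases hP : ∀ y ∈ P, p ^ (c + 1) • y = 0 → y ∈ center B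
  · have h1 : Nat.card P ≤ Nat.card (centralSocle p B c) * Nat.card (center B) := by
      rw [card_eq_card_inf_ker_mul_card_map P (nsmulAddMonoidHom (p ^ (c + 1))),
        card_eq_card_inf_ker_mul_card_map (center B) (nsmulAddMonoidHom (p ^ c)), ← mul_assoc]
      have h2 : (center B ⊓ (nsmulAddMonoidHom (p ^ c) : L →+ L).ker : AddSubgroup L) =
          centralTorsion B (p ^ c) := rfl
      rw [h2, mul_comm (Nat.card (centralSocle p B c)), ← card_centralTorsion_succ]
      refine Nat.mul_le_mul (card_le_of_le fun y hy => ⟨hP y hy.1 hy.2, hy.2⟩) (card_le_of_le ?_)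
      rintro _ ⟨y, hy, rfl⟩
      refine ⟨p • y, ?_, ?_⟩
      · obtain ⟨u, ⟨v, -, rfl⟩, z, hz, rfl⟩ := AddSubgroup.mem_sup.mp hy
        simp only [nsmulAddMonoidHom_apply, smul_add]
        refine AddSubgroup.add_mem _ ?_ (AddSubgroup.nsmul_mem _ hz _)
        rw [← mul_smul, ← pow_succ']
        exact nsmul_mem_center hex v
      · simp only [nsmulAddMonoidHom_apply]
        rw [← mul_smul, ← pow_succ]
    have hmem : ∀ y, p ^ c • y ∈ P := fun y => AddSubgroup.mem_sup_left ⟨y, trivial, rfl⟩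
    obtain ⟨s, ⟨i, hi⟩, hs⟩ := exists_relation (κ := Fin 2) p (le_sup_right : center B ≤ P)
      (e := ![p ^ c • y₀, p ^ c • z₀]) (by intro i; fin_cases i; exacts [hmem _, hmem _]) (by
        refine lt_of_le_of_lt h1 ?_
        rw [Fintype.card_fin]
        exact Nat.mul_lt_mul_of_pos_right hlt Nat.card_pos)
    simp only [Fin.sum_univ_two, Matrix.cons_val_zero, Matrix.cons_val_one] at hs
    have h0 := hs z₀
    have h1 := hs y₀
    simp only [map_add, map_zsmul, map_nsmul, AddMonoidHom.add_apply, AddMonoidHom.zsmul_apply,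
      AddMonoidHom.nsmul_apply, hR.alt, smul_zero, add_zero, zero_add] at h0 h1
    rw [hR.skew, smul_neg, smul_neg, neg_eq_zero] at h1
    fin_cases i
    · exact hne (hR.zsmul_eq_zero_of_coprime h0 hi)
    · exact hne (hR.zsmul_eq_zero_of_coprime h1 hi)
  · push Not at hP
    obtain ⟨y, hy, hpy, hyZ⟩ := hP
    obtain ⟨u, ⟨v, -, rfl⟩, z, hz, rfl⟩ := AddSubgroup.mem_sup.mp hy
    simp only [nsmulAddMonoidHom_apply] at hpy hyZ
    set w := p ^ c • B y₀ z₀ with hw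
    have hpw : p • w = 0 := smul_eq_zero_of_mem_centralSocle (hbr _ _)
    have hBy : ∀ t, B (p ^ c • v + z) t = p ^ c • B v t := by
      intro t
      rw [map_add, AddMonoidHom.add_apply, hz t, add_zero, map_nsmul, AddMonoidHom.nsmul_apply]
    have key : ∀ i, ∃ s : ℤ, B (p ^ c • v + z) (x i) = s • w ∧
        p ^ a i • s • (p ^ c • v + z) = 0 := by
      intro i
      by_cases hac : a i ≤ c
      · refine ⟨0, ?_, by simp⟩
        rw [hBy, zero_smul, ← Nat.sub_add_cancel hac, pow_add, mul_smul, ← map_nsmul,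
          hR.br_right_eq_zero (hR.derived_le_center (hb.mem i)), smul_zero]
      · obtain ⟨s, hs⟩ := hR.exists_eq_zsmul_of_card_lt hlt (hbr y₀ z₀) (hbr v (x i))
          (smul_eq_zero_of_mem_centralSocle (hbr _ _)) hne
        refine ⟨s, by rw [hBy, hs], ?_⟩
        rw [smul_comm, ← Nat.sub_add_cancel (show c + 1 ≤ a i by omega), pow_add, mul_smul, hpy,
          smul_zero, smul_zero]
    choose s hs hs' using key
    have hT := hR.transvection_mem_center hb hs hs'
    refine hyZ (hR.mem_center_of_basis hb hR.derived_le_center fun i => ?_)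
    have hpi : (p : ℤ) ∣ s i := by
      by_contra h
      exact hyZ (hR.mem_of_zsmul_mem (hT i) h)
    obtain ⟨k, hk⟩ := hpi
    rw [hs, hk, mul_comm, mul_smul, natCast_zsmul, hpw, smul_zero]

/-- Duality between two homomorphisms into the centre supported on different basis elements. -/
theorem coord_smul_eq_zero [Finite L] {ι : Type*} [Fintype ι] {x : ι → L} {q : ι → ℕ}
    (hb : RelBasis (derived B) x q) {i j : ι} (hij : i ≠ j) {z w : L}
    (hz : z ∈ centralTorsion B (q i)) (hw : w ∈ centralTorsion B (q j)) {s : ι → ℤ} {d : L}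
    (hd : d ∈ derived B) (hzs : z = ∑ k, s k • x k + d) : s j • w = 0 := by
  classical
  have key : ∀ i, ∀ t ∈ centralTorsion B (q i), ∃ f : L →+ L,
      (∀ k, f (x k) = (Pi.single i t : ι → L) k) ∧
      (∀ d ∈ derived B, f d = 0) ∧ ∀ y, f y ∈ center B := by
    intro i t ht
    obtain ⟨f, hf, hfd⟩ := hb.exists_hom (Pi.single i t : ι → L) (by
      intro k
      by_cases h : k = i
      · subst h; simpa using ht.2
      · simp [h])
    refine ⟨f, hf, hfd, fun y => ?_⟩
    obtain ⟨c, d, hd, rfl⟩ := hb.span y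
    rw [map_add, hfd d hd, add_zero, map_sum]
    refine AddSubgroup.sum_mem _ fun k _ => ?_
    rw [map_zsmul, hf]
    by_cases h : k = i
    · subst h; simpa using AddSubgroup.zsmul_mem _ ht.1 _
    · simp [h]
  obtain ⟨f, hf, hfd, hfZ⟩ := key i z hz
  obtain ⟨g, hg, hgd, hgZ⟩ := key j w hw
  have h := hR.central_comm_central hfZ (fun y z => hfd _ (br_mem_derived B y z)) hgZ
    (fun y z => hgd _ (br_mem_derived B y z)) (x i)
  rw [hf, hg, Pi.single_eq_same, Pi.single_eq_of_ne hij, map_zero, hzs, map_add, hgd d hd,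
    add_zero, map_sum, Finset.sum_eq_single j] at h
  · rw [map_zsmul, hg, Pi.single_eq_same] at h; exact h
  · intro k _ hk; rw [map_zsmul, hg, Pi.single_eq_of_ne hk, smul_zero]
  · simp

end Rigid

end

section

variable {L : Type*} [AddCommGroup L]
namespace Rigid

variable {p : ℕ} {B : L →+ L →+ L} (hR : Rigid p B)
include hR

/-- If `p ^ e` kills the centre and `x i` has order `p ^ (e + 1)` modulo the derived subring, then
`x i` is detected by the other basis elements. -/
theorem nsmul_mem_center_of_exponent [Finite L] {ι : Type*} [Fintype ι] {x : ι → L} {q : ι → ℕ}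
    (hb : RelBasis (derived B) x q) {c e : ℕ} (hex : ∀ y z, p ^ (c + 1) • B y z = 0)
    (hZ : ∀ z ∈ center B, p ^ e • z = 0) {i : ι} (hi : q i = p ^ (e + 1)) {v : L}
    (hv : ∀ j, j ≠ i → p ^ c • B v (x j) = 0) : p ^ c • v ∈ center B := by
  classical
  have := hR.transvection_mem_center hb (Y := p ^ c • v) (w := B (p ^ c • v) (x i))
    (s := Pi.single i 1) (by
      intro j
      by_cases h : j = i
      · subst h; simp
      · rw [map_nsmul, AddMonoidHom.nsmul_apply, hv j h, Pi.single_eq_of_ne h, zero_smul])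
    (by
      intro j
      by_cases h : j = i
      · subst h
        rw [hi, Pi.single_eq_same, one_smul, ← mul_smul, ← pow_add,
          show e + 1 + c = e + (c + 1) by ring, pow_add, mul_smul]
        exact hZ _ (nsmul_mem_center hex v)
      · rw [Pi.single_eq_of_ne h, zero_smul, smul_zero]) i
  simpa using this

theorem exists_of_nsmul_ne_zero {z : L} (hz : z ∈ center B) {e : ℕ} (h : p ^ e • z ≠ 0) :
    ∃ z' ∈ center B, p ^ (e + 1) • z' = 0 ∧ p ^ e • z' ≠ 0 := by
  classical
  have hex := hR.torsion z
  set k := Nat.find hex with hk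
  have h1 : p ^ k • z = 0 := Nat.find_spec hex
  have h2 : ∀ j, p ^ j • z = 0 → k ≤ j := fun j hj => Nat.find_min' hex hj
  have h3 : e < k := by
    by_contra hle
    apply h
    rw [← Nat.sub_add_cancel (not_lt.mp hle), pow_add, mul_smul, h1, smul_zero]
  refine ⟨p ^ (k - (e + 1)) • z, AddSubgroup.nsmul_mem _ hz _, ?_, fun h4 => ?_⟩
  · rw [← mul_smul, ← pow_add, show e + 1 + (k - (e + 1)) = k by omega, h1]
  · rw [← mul_smul, ← pow_add] at h4
    have := h2 _ h4
    omega

/-- If the centre has exponent at least that of the first basis element then the centre is small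
in exponent. -/
theorem mem_derived_of_exponent [Finite L] {k : ℕ} {x : Fin (k + 2) → L} {a : Fin (k + 2) → ℕ}
    (hb : RelBasis (derived B) x (fun i => p ^ a i)) (ha : Antitone a) {e : ℕ} (he : a 0 = e + 1)
    {z : L} (hz : z ∈ center B) (hze : p ^ e • z ≠ 0) {w : L} (hw : w ∈ center B)
    (hw1 : p ^ a 1 • w = 0) : w ∈ derived B := by
  obtain ⟨z, hz, hz0, hze⟩ := hR.exists_of_nsmul_ne_zero hz hze
  have hdvd : ∀ j : Fin (k + 2), ∀ s : ℤ, s • p ^ (e + 1 - a j) • z = 0 → (p : ℤ) ^ a j ∣ s := by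
    intro j s hs
    have haj : a j ≤ e + 1 := he ▸ ha (Fin.zero_le j)
    by_contra hn
    have h1 : ∃ i < a j, ∃ u : ℤ, ¬ (p : ℤ) ∣ u ∧ s = u * p ^ i := by
      have hs0 : s ≠ 0 := by rintro rfl; exact hn (dvd_zero _)
      have hpp := Nat.prime_iff_prime_int.mp hR.prime
      obtain ⟨u, hsu, hu⟩ := (FiniteMultiplicity.of_not_isUnit hpp.not_isUnit
        hs0).exists_eq_pow_mul_and_not_dvd
      set i := multiplicity (p : ℤ) s
      refine ⟨i, ?_, u, hu, by rw [hsu, mul_comm]⟩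
      by_contra hi
      exact hn (hsu ▸ (pow_dvd_pow _ (not_lt.mp hi)).mul_right _)
    obtain ⟨i, hi, u, hu, rfl⟩ := h1
    rw [mul_smul] at hs
    have h2 := hR.zsmul_eq_zero_of_coprime hs hu
    apply hze
    have h3 : (p : ℤ) ^ i • p ^ (e + 1 - a j) • z = p ^ (i + (e + 1 - a j)) • z := by
      rw [pow_add, mul_smul, ← natCast_zsmul _ (p ^ i), Nat.cast_pow]
    rw [h3] at h2
    rw [show e = (e - (i + (e + 1 - a j))) + (i + (e + 1 - a j)) by omega, pow_add, mul_smul, h2,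
      smul_zero]
  have hmem : ∀ j, p ^ (e + 1 - a j) • z ∈ centralTorsion B (p ^ a j) := fun j =>
    ⟨AddSubgroup.nsmul_mem _ hz _, by
      rw [← mul_smul, ← pow_add, show a j + (e + 1 - a j) = e + 1 by
        have := ha (Fin.zero_le j); omega, hz0]⟩
  obtain ⟨s, d, hd, hs⟩ := hb.span w
  have hw1' : w ∈ centralTorsion B (p ^ a 1) := ⟨hw, hw1⟩
  have hw0' : w ∈ centralTorsion B (p ^ a 0) := centralTorsion_mono (ha (Fin.zero_le 1)) hw1'
  rw [hs]
  refine AddSubgroup.add_mem _ (hb.sum_mem_of_dvd fun j => ?_) hd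
  push_cast
  apply hdvd
  by_cases hj : j = 0
  · subst hj
    exact hR.coord_smul_eq_zero hb (i := 1) (j := 0) (by simp) hw1' (hmem 0) hd hs
  · exact hR.coord_smul_eq_zero hb (i := 0) (j := j) (Ne.symm hj) hw0' (hmem j) hd hs

theorem nsmul_br_eq_zero [Finite L] {k : ℕ} {x : Fin (k + 2) → L} {a : Fin (k + 2) → ℕ}
    (hb : RelBasis (derived B) x (fun i => p ^ a i)) (ha : Antitone a) (y z : L) :
    p ^ a 1 • B y z = 0 := by
  have : ∀ i j, B (x i) (x j) ∈ (nsmulAddMonoidHom (p ^ a 1) : L →+ L).ker := by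
    have key : ∀ i, i ≠ 0 → p ^ a 1 • x i ∈ center B := by
      intro i hi
      have h1 : a i ≤ a 1 := ha (by
        rw [Fin.le_def]
        have : i.val ≠ 0 := fun h => hi (Fin.ext h)
        simp; omega)
      rw [← Nat.sub_add_cancel h1, pow_add, mul_smul]
      exact AddSubgroup.nsmul_mem _ (hR.derived_le_center (hb.mem i)) _
    intro i j
    rw [AddMonoidHom.mem_ker, nsmulAddMonoidHom_apply]
    by_cases hi : i = 0
    · by_cases hj : j = 0
      · rw [hi, hj, hR.alt, smul_zero]
      · rw [← map_nsmul, hR.br_right_eq_zero (key j hj)]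
    · rw [← AddMonoidHom.nsmul_apply, ← map_nsmul, key i hi]
  exact hR.br_mem hb hR.derived_le_center this y z

theorem exponent_eq [Finite L] {k : ℕ} {x : Fin (k + 2) → L} {a : Fin (k + 2) → ℕ}
    (hb : RelBasis (derived B) x (fun i => p ^ a i)) (ha : Antitone a) {e : ℕ} (he : a 0 = e + 1)
    {z : L} (hz : z ∈ center B) (hze : p ^ e • z ≠ 0) {c : ℕ}
    (hex : ∀ y z, p ^ (c + 1) • B y z = 0) {y₀ z₀ : L} (hne : p ^ c • B y₀ z₀ ≠ 0) :
    a 1 = c + 1 := by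
  apply le_antisymm
  · obtain ⟨z', hz', hz0, hze'⟩ := hR.exists_of_nsmul_ne_zero hz hze
    have ha01 : a 1 ≤ e + 1 := he ▸ ha (Fin.zero_le 1)
    have h1 : p ^ (e + 1 - a 1) • z' ∈ derived B :=
      hR.mem_derived_of_exponent hb ha he hz hze (AddSubgroup.nsmul_mem _ hz' _) (by
        rw [← mul_smul, ← pow_add, show a 1 + (e + 1 - a 1) = e + 1 by omega, hz0])
    have h2 : derived B ≤ (nsmulAddMonoidHom (p ^ (c + 1)) : L →+ L).ker := by
      rw [derived, AddSubgroup.closure_le]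
      rintro _ ⟨y, z, rfl⟩; exact hex y z
    have h3 : p ^ (c + 1) • p ^ (e + 1 - a 1) • z' = 0 := h2 h1
    by_contra hlt
    apply hze'
    rw [← mul_smul, ← pow_add] at h3
    rw [show e = (e - (c + 1 + (e + 1 - a 1))) + (c + 1 + (e + 1 - a 1)) by omega, pow_add,
      mul_smul, h3, smul_zero]
  · by_contra hlt
    apply hne
    rw [show c = (c - a 1) + a 1 by omega, pow_add, mul_smul, hR.nsmul_br_eq_zero hb ha, smul_zero]

theorem centralSocle_le [Finite L] {k : ℕ} {x : Fin (k + 2) → L} {a : Fin (k + 2) → ℕ}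
    (hb : RelBasis (derived B) x (fun i => p ^ a i)) (ha : Antitone a) {e : ℕ} (he : a 0 = e + 1)
    {z : L} (hz : z ∈ center B) (hze : p ^ e • z ≠ 0) {c : ℕ} (hc : a 1 = c + 1)
    {S : AddSubgroup L} (hS : ∀ i j, p ^ c • B (x i) (x j) ∈ S) : centralSocle p B c ≤ S := by
  intro w hw
  obtain ⟨z', hz', hz0, rfl⟩ := mem_centralSocle.mp hw
  have h1 := hR.mem_derived_of_exponent hb ha he hz hze hz' (hc ▸ hz0)
  have h2 : derived B ≤ S.comap (nsmulAddMonoidHom (p ^ c)) := by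
    rw [derived, AddSubgroup.closure_le]
    rintro _ ⟨y, z, rfl⟩
    exact hR.br_mem hb hR.derived_le_center hS y z
  exact h2 h1

theorem card_zmultiples_le {w : L} (hw : p • w = 0) : Nat.card (AddSubgroup.zmultiples w) ≤ p := by
  rw [Nat.card_zmultiples]
  exact Nat.le_of_dvd hR.prime.pos (addOrderOf_dvd_of_nsmul_eq_zero hw)

end Rigid

end

section

variable {L : Type*} [AddCommGroup L]

/-- The subgroup generated by `N` and the family `e`. -/
def adjoin {κ : Type*} [Fintype κ] (N : AddSubgroup L) (e : κ → L) : AddSubgroup L where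
  carrier := {y | ∃ s : κ → ℤ, ∃ d ∈ N, y = ∑ i, s i • e i + d}
  zero_mem' := ⟨0, 0, N.zero_mem, by simp⟩
  add_mem' := by
    rintro _ _ ⟨c, d, hd, rfl⟩ ⟨c', d', hd', rfl⟩
    refine ⟨c + c', d + d', N.add_mem hd hd', ?_⟩
    simp only [Pi.add_apply, add_smul, Finset.sum_add_distrib]; abel
  neg_mem' := by
    rintro _ ⟨c, d, hd, rfl⟩
    refine ⟨-c, -d, N.neg_mem hd, ?_⟩
    simp only [Pi.neg_apply, neg_smul, Finset.sum_neg_distrib]; abel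

section adjoin

variable {κ : Type*} [Fintype κ] {N : AddSubgroup L} {e : κ → L}

theorem le_adjoin : N ≤ adjoin N e := fun d hd => ⟨0, d, hd, by simp⟩

theorem self_mem_adjoin (i : κ) : e i ∈ adjoin N e := by
  classical
  refine ⟨Pi.single i 1, 0, N.zero_mem, ?_⟩
  rw [Finset.sum_eq_single i] <;> simp +contextual

theorem adjoin_le {S : AddSubgroup L} (hN : N ≤ S) (he : ∀ i, e i ∈ S) : adjoin N e ≤ S := by
  rintro _ ⟨c, d, hd, rfl⟩
  exact S.add_mem (S.sum_mem fun i _ => S.zsmul_mem (he i) _) (hN hd)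

theorem card_adjoin {p : ℕ} (hp : 0 < p) (hpe : ∀ i, p • e i ∈ N)
    (hi : ∀ s : κ → ℤ, ∑ i, s i • e i ∈ N → ∀ i, (p : ℤ) ∣ s i) :
    Nat.card (adjoin N e) = p ^ Fintype.card κ * Nat.card N := by
  have hb : RelBasis (N.addSubgroupOf (adjoin N e))
      (fun i => (⟨e i, self_mem_adjoin i⟩ : adjoin N e)) (fun _ => p) := by
    refine ⟨fun i => hpe i, fun s hs => hi s ?_, ?_⟩
    · rw [AddSubgroup.mem_addSubgroupOf, AddSubgroup.val_finsetSum] at hs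
      exact hs
    · rintro ⟨_, c, d, hd, rfl⟩
      refine ⟨c, ⟨d, le_adjoin hd⟩, hd, Subtype.ext ?_⟩
      rw [AddSubgroup.coe_add, AddSubgroup.val_finsetSum]; rfl
  rw [hb.card_eq fun _ => hp,
    Nat.card_congr (AddSubgroup.addSubgroupOfEquivOfLe (le_adjoin (N := N) (e := e))).toEquiv]
  simp

end adjoin

namespace Rigid

variable {p : ℕ} {B : L →+ L →+ L} (hR : Rigid p B)
include hR

theorem exists_basis_of_card [Finite L] {U : AddSubgroup L} (hU : ∀ y : L, p • y ∈ U) {k : ℕ}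
    (hc : Nat.card L = p ^ k * Nat.card U) : ∃ e : Fin k → L, RelBasis U e (fun _ => p) := by
  obtain ⟨e, -, he⟩ := exists_independent hR.prime hR.torsion (le_top : U ≤ ⊤)
    (fun y _ => hU y) (k := k) (by rw [AddSubgroup.card_top, hc])
  exact ⟨e, RelBasis.of_dvd_of_card (fun i => hU _) he (by simp [hc])⟩

/-- An abelian subgroup containing the brackets has no abelian complement. -/
theorem false_of_isCompl {P U : AddSubgroup L} (h : IsCompl P U) (hD : derived B ≤ U)
    (hU : ∀ u ∈ U, ∀ v ∈ U, B u v = 0) (hP : ∀ u ∈ P, ∀ v ∈ P, B u v = 0) {u : L} (hu : u ∈ U)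
    (hu0 : u ≠ 0) : False := by
  have := hR.odd_part_eq_bot h (fun y hy z hz => hP y hy z hz ▸ P.zero_mem)
    (fun y hy z hz => hU y hy z hz ▸ P.zero_mem) (fun y _ z _ => hD (br_mem_derived B y z))
  rw [this] at hu
  exact hu0 hu

theorem exists_mul_eq_one_add {s : ℤ} (h : ¬ (p : ℤ) ∣ s) : ∃ t k : ℤ, t * s = 1 + k * p := by
  obtain ⟨u, v, huv⟩ := (Nat.prime_iff_prime_int.mp hR.prime).coprime_iff_not_dvd.mpr h
  exact ⟨v, -u, by linarith⟩

/-- Three elements with few brackets have two commuting independent combinations. -/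
theorem exists_commuting_pair [Finite L] (hD : Nat.card (derived B) < p ^ 3) (e : Fin 3 → L) :
    ∃ c d : Fin 3 → ℤ, B (∑ i, c i • e i) (∑ i, d i • e i) = 0 ∧
      ∀ r t : ℤ, (∀ i, (p : ℤ) ∣ r * c i + t * d i) → (p : ℤ) ∣ r ∧ (p : ℤ) ∣ t := by
  obtain ⟨s, ⟨i, hi⟩, hs⟩ := exists_relation (κ := Fin 3) p (bot_le : ⊥ ≤ derived B)
    (e := ![B (e 1) (e 2), B (e 2) (e 0), B (e 0) (e 1)]) (by
      intro i; fin_cases i <;> exact br_mem_derived B _ _) (by simpa using hD)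
  simp only [Fin.sum_univ_three, AddSubgroup.mem_bot, Matrix.cons_val_zero, Matrix.cons_val_one,
    Matrix.cons_val] at hs
  have hpp := Nat.prime_iff_prime_int.mp hR.prime
  have h10 := hR.skew (e 1) (e 0)
  have h21 := hR.skew (e 2) (e 1)
  have h02 := hR.skew (e 0) (e 2)
  fin_cases i
  · change ¬ (p : ℤ) ∣ s 0 at hi
    refine ⟨![-s 1, s 0, 0], ![-s 2, 0, s 0], ?_, fun r t h => ⟨?_, ?_⟩⟩
    · refine Eq.trans ?_ ((congrArg (s 0 • ·) hs).trans (smul_zero _))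
      simp only [Fin.sum_univ_three, Matrix.cons_val_zero, Matrix.cons_val_one, Matrix.cons_val,
        map_add, map_zsmul, AddMonoidHom.add_apply, AddMonoidHom.zsmul_apply, hR.alt, h10, h21, h02]
      module
    · have := h 1
      simpa [hpp.dvd_mul, hi] using this
    · have := h 2
      simpa [hpp.dvd_mul, hi] using this
  · change ¬ (p : ℤ) ∣ s 1 at hi
    refine ⟨![0, -s 2, s 1], ![s 1, -s 0, 0], ?_, fun r t h => ⟨?_, ?_⟩⟩
    · refine Eq.trans ?_ ((congrArg (s 1 • ·) hs).trans (smul_zero _))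
      simp only [Fin.sum_univ_three, Matrix.cons_val_zero, Matrix.cons_val_one, Matrix.cons_val,
        map_add, map_zsmul, AddMonoidHom.add_apply, AddMonoidHom.zsmul_apply, hR.alt, h10, h21, h02]
      module
    · have := h 2
      simpa [hpp.dvd_mul, hi] using this
    · have := h 0
      simpa [hpp.dvd_mul, hi] using this
  · change ¬ (p : ℤ) ∣ s 2 at hi
    refine ⟨![s 2, 0, -s 0], ![0, s 2, -s 1], ?_, fun r t h => ⟨?_, ?_⟩⟩
    · refine Eq.trans ?_ ((congrArg (s 2 • ·) hs).trans (smul_zero _))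
      simp only [Fin.sum_univ_three, Matrix.cons_val_zero, Matrix.cons_val_one, Matrix.cons_val,
        map_add, map_zsmul, AddMonoidHom.add_apply, AddMonoidHom.zsmul_apply, hR.alt, h10, h21, h02]
      module
    · have := h 0
      simpa [hpp.dvd_mul, hi] using this
    · have := h 1
      simpa [hpp.dvd_mul, hi] using this

/-- Noncentral elements of order `p` have noncyclic sets of brackets. -/
theorem exists_br_notMem [Finite L] {ι : Type*} [Fintype ι] {x : ι → L} {a : ι → ℕ}
    (hb : RelBasis (derived B) x (fun i => p ^ a i)) (ha : ∀ i, 1 ≤ a i) {Y : L} (hpY : p • Y = 0)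
    (hY : Y ∉ center B) {w : L} (hw : p • w = 0) : ∃ i, B Y (x i) ∉ AddSubgroup.zmultiples w := by
  by_contra! h
  choose s hs using fun i => AddSubgroup.mem_zmultiples_iff.mp (h i)
  have hT := hR.transvection_mem_center hb (Y := Y) (w := w) (s := s) (fun i => (hs i).symm)
    (fun i => by
      rw [smul_comm, ← Nat.sub_add_cancel (ha i), pow_succ, mul_smul, hpY, smul_zero, smul_zero])
  refine hY (hR.mem_center_of_basis hb hR.derived_le_center fun i => ?_)
  have hpi : (p : ℤ) ∣ s i := by
    by_contra h
    exact hY (hR.mem_of_zsmul_mem (hT i) h)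
  obtain ⟨k, hk⟩ := hpi
  rw [← hs, hk, mul_comm, mul_smul, natCast_zsmul, hw, smul_zero]

end Rigid

/-- The shape of the Lie ring when the centre has large exponent and the derived subring is
elementary. -/
structure Thin (p : ℕ) (B : L →+ L →+ L) {k : ℕ} (x : Fin (k + 1) → L) (a : Fin (k + 1) → ℕ) :
    Prop where
  rigid : Rigid p B
  basis : RelBasis (derived B) x (fun i => p ^ a i)
  one_le : 1 ≤ a 0
  eq_one : ∀ i, i ≠ 0 → a i = 1
  br : ∀ y z, p • B y z = 0
  soc : ∀ z ∈ center B, p • z = 0 → z ∈ derived B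

/-- The subgroup generated by brackets and `p`-multiples. -/
def frattini (p : ℕ) (B : L →+ L →+ L) : AddSubgroup L :=
  derived B ⊔ (nsmulAddMonoidHom p : L →+ L).range

theorem nsmul_derived {p : ℕ} {B : L →+ L →+ L} (h : ∀ y z, p • B y z = 0) {d : L}
    (hd : d ∈ derived B) : p • d = 0 := by
  have : derived B ≤ (nsmulAddMonoidHom p : L →+ L).ker := by
    rw [derived, AddSubgroup.closure_le]
    rintro _ ⟨y, z, rfl⟩
    exact h y z
  exact this hd

theorem nsmul_mem_frattini {p : ℕ} {B : L →+ L →+ L} (y : L) : p • y ∈ frattini p B :=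
  AddSubgroup.mem_sup_right ⟨y, rfl⟩

theorem RelBasis.frattini {p : ℕ} {B : L →+ L →+ L} {ι : Type*} [Fintype ι] {x : ι → L} {a : ι → ℕ}
    (hb : RelBasis (derived B) x (fun i => p ^ a i)) (ha : ∀ i, 1 ≤ a i) :
    RelBasis (frattini p B) x (fun _ => p) := by
  refine ⟨fun i => nsmul_mem_frattini _, fun s hs i => ?_, fun y => ?_⟩
  · obtain ⟨d, hd, _, ⟨y, rfl⟩, h⟩ := AddSubgroup.mem_sup.mp hs
    obtain ⟨t, d', hd', rfl⟩ := hb.span y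
    have h1 := hb.dvd (fun i => s i - p * t i) (by
      have : ∑ i, (s i - p * t i) • x i = d + p • d' := by
        simp only [sub_smul, Finset.sum_sub_distrib, ← h, nsmulAddMonoidHom_apply, smul_add,
          Finset.smul_sum, mul_smul, natCast_zsmul]
        abel
      rw [this]
      exact AddSubgroup.add_mem _ hd (AddSubgroup.nsmul_mem _ hd' _)) i
    have h2 : (p : ℤ) ∣ s i - p * t i := dvd_trans (by
      push_cast
      exact dvd_pow_self _ (by have := ha i; omega)) h1
    exact (dvd_sub_left (Dvd.intro _ rfl)).mp h2
  · obtain ⟨t, d', hd', rfl⟩ := hb.span y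
    exact ⟨t, d', AddSubgroup.mem_sup_left hd', rfl⟩

theorem card_eq_torsion_mul {p : ℕ} : Nat.card L =
    Nat.card (nsmulAddMonoidHom p : L →+ L).ker * Nat.card (nsmulAddMonoidHom p : L →+ L).range := by
  have := card_eq_card_inf_ker_mul_card_map (⊤ : AddSubgroup L) (nsmulAddMonoidHom p)
  rwa [AddSubgroup.card_top, top_inf_eq, ← AddMonoidHom.range_eq_map] at this

theorem RelBasis.le_card_torsion [Finite L] {p : ℕ} (hp : 0 < p) {B : L →+ L →+ L} {ι : Type*}
    [Fintype ι] {x : ι → L} {a : ι → ℕ} (hb : RelBasis (derived B) x (fun i => p ^ a i))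
    (ha : ∀ i, 1 ≤ a i) : p ^ Fintype.card ι ≤ Nat.card (nsmulAddMonoidHom p : L →+ L).ker := by
  have h1 := (hb.frattini ha).card_eq fun _ => hp
  rw [card_eq_torsion_mul (p := p), Finset.prod_const, Finset.card_univ] at h1
  have h2 : Nat.card (nsmulAddMonoidHom p : L →+ L).range ≤
      Nat.card (AbelianAut.frattini p B) := card_le_of_le le_sup_right
  have h3 : 0 < Nat.card (nsmulAddMonoidHom p : L →+ L).range := Nat.card_pos
  refine Nat.le_of_mul_le_mul_right ?_ h3
  rw [h1]
  exact Nat.mul_le_mul_left _ h2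

namespace Thin

variable {p : ℕ} {B : L →+ L →+ L} {k : ℕ} {x : Fin (k + 1) → L} {a : Fin (k + 1) → ℕ}
  (hT : Thin p B x a)
include hT

theorem le_a (i) : 1 ≤ a i := by
  by_cases h : i = 0
  · exact h ▸ hT.one_le
  · exact (hT.eq_one i h).ge

theorem nsmul_mem_center (y : L) : p • y ∈ center B := Rigid.nsmul_mem_center hT.br y

theorem frattini_le_center : frattini p B ≤ center B := by
  refine sup_le hT.rigid.derived_le_center ?_
  rintro _ ⟨y, rfl⟩
  exact hT.nsmul_mem_center y

theorem basis_frattini : RelBasis (frattini p B) x (fun _ => p) := hT.basis.frattini hT.le_a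

theorem card_eq [Finite L] : Nat.card L = p ^ (k + 1) * Nat.card (frattini p B) := by
  rw [hT.basis_frattini.card_eq fun _ => hT.rigid.prime.pos]; simp

theorem le_card_torsion [Finite L] :
    p ^ (k + 1) ≤ Nat.card (nsmulAddMonoidHom p : L →+ L).ker := by
  simpa using hT.basis.le_card_torsion hT.rigid.prime.pos hT.le_a

theorem mem_derived_iff {Y : L} (hY : p • Y = 0) : Y ∈ center B ↔ Y ∈ derived B :=
  ⟨fun h => hT.soc _ h hY, fun h => hT.rigid.derived_le_center h⟩

theorem derived_le_torsion : derived B ≤ (nsmulAddMonoidHom p : L →+ L).ker :=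
  fun _ hd => nsmul_derived hT.br hd

/-- A noncentral element of order `p` has two independent brackets. -/
theorem exists_independent_br [Finite L] {Y : L} (hpY : p • Y = 0) (hY : Y ∉ center B) :
    ∃ i j, ∀ s t : ℤ, s • B Y (x i) + t • B Y (x j) = 0 → (p : ℤ) ∣ s ∧ (p : ℤ) ∣ t := by
  have hR := hT.rigid
  obtain ⟨i, hi⟩ := hR.exists_br_notMem hT.basis hT.le_a hpY hY (w := 0) (smul_zero _)
  obtain ⟨j, hj⟩ := hR.exists_br_notMem hT.basis hT.le_a hpY hY (hT.br Y (x i))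
  refine ⟨i, j, fun s t h => ?_⟩
  have ht : (p : ℤ) ∣ t := by
    by_contra ht
    refine hj (hR.mem_of_zsmul_mem ?_ ht)
    rw [eq_neg_of_add_eq_zero_right h]
    exact AddSubgroup.neg_mem _ (AddSubgroup.zsmul_mem _ (AddSubgroup.mem_zmultiples _) _)
  refine ⟨?_, ht⟩
  by_contra hs
  obtain ⟨c, rfl⟩ := ht
  rw [mul_comm, mul_smul, natCast_zsmul, hT.br, smul_zero, add_zero] at h
  exact hi (by rw [hR.zsmul_eq_zero_of_coprime h hs]; exact AddSubgroup.zero_mem _)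

end Thin

end

section

variable {L : Type*} [AddCommGroup L] {p : ℕ} {B : L →+ L →+ L} {k : ℕ}
  {x : Fin (k + 1) → L} {a : Fin (k + 1) → ℕ}

/-- Two independent elements span an elementary group of order at most `p ^ 2`. -/
theorem exists_eq_of_card_le_sq [Finite L] {E : AddSubgroup L} (hE : Nat.card E ≤ p ^ 2)
    {u v : L} (hu : u ∈ E) (hv : v ∈ E)
    (h : ∀ s t : ℤ, s • u + t • v = 0 → (p : ℤ) ∣ s ∧ (p : ℤ) ∣ t) {w : L} (hw : w ∈ E) :
    ∃ s t : ℤ, w = s • u + t • v := by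
  obtain ⟨s, d, hd, rfl⟩ := exists_eq_sum_of_card (bot_le : ⊥ ≤ E) (x := ![u, v])
    (q := fun _ => p) (by intro i; fin_cases i; exacts [hu, hv]) (by
      intro s hs
      simp only [Fin.sum_univ_two, Matrix.cons_val_zero, Matrix.cons_val_one,
        AddSubgroup.mem_bot] at hs
      intro i; fin_cases i
      exacts [(h _ _ hs).1, (h _ _ hs).2]) (by simpa using hE) hw
  rw [AddSubgroup.mem_bot] at hd
  exact ⟨s 0, s 1, by simp [hd, Fin.sum_univ_two]⟩

theorem exists_mem_notMem_of_card_lt [Finite L] {E F : AddSubgroup L}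
    (h : Nat.card F < Nat.card E) : ∃ y ∈ E, y ∉ F := by
  by_contra! hle
  exact absurd (card_le_of_le hle) (not_le.mpr h)

namespace Thin

theorem false_of_three [Finite L] {x : Fin 3 → L} {a : Fin 3 → ℕ} (hT : Thin p B x a)
    (hc : Nat.card (derived B) = p ^ 2) : False := by
  have hR := hT.rigid
  obtain ⟨Y, hY, hYD⟩ := exists_mem_notMem_of_card_lt (E := (nsmulAddMonoidHom p : L →+ L).ker)
    (F := derived B) (lt_of_lt_of_le (by
      rw [hc]; exact Nat.pow_lt_pow_right hR.prime.one_lt (by norm_num)) hT.le_card_torsion)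
  have hpY : p • Y = 0 := hY
  have hYZ : Y ∉ center B := fun h => hYD ((hT.mem_derived_iff hpY).mp h)
  obtain ⟨i, j, hij⟩ := hT.exists_independent_br hpY hYZ
  set e := x i
  set f := x j
  obtain ⟨s, t, hst⟩ := exists_eq_of_card_le_sq hc.le (br_mem_derived B Y e)
    (br_mem_derived B Y f) hij (br_mem_derived B e f)
  set e' := e - t • Y with he'
  set f' := f + s • Y with hf'
  have hYe : B Y e' = B Y e := by
    rw [he', map_sub, map_zsmul, hR.alt, smul_zero, sub_zero]
  have hYf : B Y f' = B Y f := by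
    rw [hf', map_add, map_zsmul, hR.alt, smul_zero, add_zero]
  have hef : B e' f' = 0 := by
    rw [he', hf']
    simp only [map_add, map_sub, map_zsmul, AddMonoidHom.sub_apply,
      AddMonoidHom.zsmul_apply, hR.alt, hst, hR.skew e Y]
    module
  have hfe : B f' e' = 0 := by rw [hR.skew, hef, neg_zero]
  have hind : ∀ c : Fin 3 → ℤ, ∑ i, c i • ![Y, e', f'] i ∈ center B → ∀ i, (p : ℤ) ∣ c i := by
    intro c hcZ
    simp only [Fin.sum_univ_three, Matrix.cons_val_zero, Matrix.cons_val_one,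
      Matrix.cons_val] at hcZ
    have h1 := hR.br_right_eq_zero (x := Y) hcZ
    simp only [map_add, map_zsmul, hR.alt, hYe, hYf, smul_zero, zero_add] at h1
    obtain ⟨h2, h3⟩ := hij _ _ h1
    have h4 : c 0 • Y ∈ center B := by
      have : ∀ m : ℤ, (p : ℤ) ∣ m → ∀ y, m • y ∈ center B := by
        rintro _ ⟨m, rfl⟩ y
        rw [mul_comm, mul_smul, natCast_zsmul]
        exact AddSubgroup.zsmul_mem _ (hT.nsmul_mem_center y) _
      have := AddSubgroup.sub_mem _ (AddSubgroup.sub_mem _ hcZ (this _ h3 f')) (this _ h2 e')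
      convert this using 1; abel
    have h5 : (p : ℤ) ∣ c 0 := by
      by_contra h
      exact hYZ (hR.mem_of_zsmul_mem h4 h)
    intro i; fin_cases i
    exacts [h5, h2, h3]
  have hb : RelBasis (center B) ![Y, e', f'] (fun _ => p) := by
    refine RelBasis.of_dvd_of_card (fun i => hT.nsmul_mem_center _) hind ?_
    rw [hT.card_eq]
    simp only [Finset.prod_const, Finset.card_univ, Fintype.card_fin]
    exact Nat.mul_le_mul_left _ (card_le_of_le hT.frattini_le_center)
  have hcen : ∀ {u v : L}, v ∈ center B → B u v = 0 := fun h => hR.br_right_eq_zero h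
  refine hR.false_of_isCompl (P := AddSubgroup.zmultiples Y) (U := adjoin (center B) ![e', f'])
    ⟨?_, ?_⟩ (hR.derived_le_center.trans le_adjoin) ?_ ?_ (self_mem_adjoin 0) ?_
  · rw [AddSubgroup.disjoint_def]
    rintro _ ⟨m, rfl⟩ ⟨c, d, hd, h⟩
    simp only [Fin.sum_univ_two, Matrix.cons_val_zero, Matrix.cons_val_one] at h
    obtain ⟨n, hn⟩ := hind ![m, -c 0, -c 1] (by
      simp only [Fin.sum_univ_three, Matrix.cons_val_zero, Matrix.cons_val_one, Matrix.cons_val]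
      rw [h]; convert hd using 1; module) 0
    simp only [Matrix.cons_val_zero] at hn
    simp only [hn]
    rw [mul_comm, mul_smul, natCast_zsmul, hpY, smul_zero]
  · rw [codisjoint_iff, eq_top_iff]
    intro y _
    obtain ⟨c, d, hd, rfl⟩ := hb.span y
    simp only [Fin.sum_univ_three, Matrix.cons_val_zero, Matrix.cons_val_one, Matrix.cons_val]
    rw [add_assoc, add_assoc]
    refine AddSubgroup.add_mem _ (AddSubgroup.mem_sup_left ⟨c 0, rfl⟩)
      (AddSubgroup.mem_sup_right ⟨![c 1, c 2], d, hd, ?_⟩)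
    simp only [Fin.sum_univ_two, Matrix.cons_val_zero, Matrix.cons_val_one]
    abel
  · rintro _ ⟨c, d, hd, rfl⟩ _ ⟨c', d', hd', rfl⟩
    simp only [Fin.sum_univ_two, Matrix.cons_val_zero, Matrix.cons_val_one, map_add, map_zsmul,
      AddMonoidHom.add_apply, AddMonoidHom.zsmul_apply, hR.alt, hcen hd', hd _, hef, hfe, smul_zero,
      add_zero]
  · rintro _ ⟨c, rfl⟩ _ ⟨c', rfl⟩
    simp [hR.alt]
  · have := hb.notMem 1 hR.prime.one_lt.ne'
    intro h0
    exact this (by simp only [Matrix.cons_val_one, Matrix.cons_val_zero] at h0 ⊢; rw [h0]; exact AddSubgroup.zero_mem _)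

end Thin

end

section

variable {L : Type*} [AddCommGroup L] {p : ℕ} {B : L →+ L →+ L} {k : ℕ}
  {x : Fin (k + 1) → L} {a : Fin (k + 1) → ℕ}

theorem Rigid.br_eq_zero_of_mem_adjoin (hR : Rigid p B) {κ : Type*} [Fintype κ]
    {N : AddSubgroup L} (hN : N ≤ center B) {e : κ → L} (h : ∀ i j, B (e i) (e j) = 0) :
    ∀ u ∈ adjoin N e, ∀ v ∈ adjoin N e, B u v = 0 := by
  have hle : ∀ u, (∀ j, B u (e j) = 0) → ∀ v ∈ adjoin N e, B u v = 0 := fun u hu v hv =>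
    adjoin_le (S := (B u).ker) (fun d hd => hR.br_right_eq_zero (hN hd)) hu hv
  intro u hu v hv
  refine hle u (fun j => ?_) v hv
  rw [hR.skew, hle (e j) (h j) u hu, neg_zero]

theorem card_prod (S T : AddSubgroup L) : Nat.card (S.prod T) = Nat.card S * Nat.card T := by
  rw [Nat.card_congr (S.prodEquiv T).toEquiv, Nat.card_prod]

/-- Two elements generating the ring over a subgroup can be made to commute and have order `p`
if there is enough room for a correction. -/
theorem exists_correction [Finite L] {U P K D : AddSubgroup L} {y z : L}
    (hpy : p • y ∈ P) (hpz : p • z ∈ P) (hyz : B y z ∈ D) (hUP : ∀ u ∈ U, p • u ∈ P)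
    (hUD : ∀ u ∈ U, ∀ v ∈ U, B y v + B u z ∈ D) (hUU : ∀ u ∈ U, ∀ v ∈ U, B u v = 0)
    (hK : ∀ u ∈ U, ∀ v ∈ U, p • u = 0 → p • v = 0 → B y v + B u z = 0 → u ∈ K ∧ v ∈ K)
    (hc : (Nat.card K * Nat.card P) ^ 2 * Nat.card D ≤ Nat.card U ^ 2) :
    ∃ u ∈ U, ∃ v ∈ U, p • (y + u) = 0 ∧ p • (z + v) = 0 ∧ B (y + u) (z + v) = 0 := by
  let f : L × L →+ L × L × L :=
    (p • AddMonoidHom.fst L L).prod ((p • AddMonoidHom.snd L L).prod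
      ((B y).comp (AddMonoidHom.snd L L) + (B.flip z).comp (AddMonoidHom.fst L L)))
  have hf : ∀ u v, f (u, v) = (p • u, p • v, B y v + B u z) := fun u v => rfl
  have hle : (U.prod U).map f ≤ P.prod (P.prod D) := by
    rintro _ ⟨⟨u, v⟩, ⟨hu, hv⟩, rfl⟩
    exact ⟨hUP u hu, hUP v hv, hUD u hu v hv⟩
  have hker : (U.prod U) ⊓ f.ker ≤ K.prod K := by
    rintro ⟨u, v⟩ ⟨⟨hu, hv⟩, h⟩
    have h' : (p • u, p • v, B y v + B u z) = ((0, 0, 0) : L × L × L) := h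
    simp only [Prod.mk.injEq] at h'
    exact hK u hu v hv h'.1 h'.2.1 h'.2.2
  have hcard := card_eq_card_inf_ker_mul_card_map (U.prod U) f
  have h1 := card_le_of_le hker
  have h2 : P.prod (P.prod D) ≤ (U.prod U).map f := by
    rw [← AddSubgroup.eq_of_le_of_card_ge hle ?_]
    have h3 : Nat.card (P.prod (P.prod D)) = Nat.card P * (Nat.card P * Nat.card D) := by
      rw [Nat.card_congr (P.prodEquiv (P.prod D)).toEquiv, Nat.card_prod, card_prod]
    rw [card_prod] at hcard h1
    rw [h3]
    have h4 : 0 < Nat.card K := Nat.card_pos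
    refine le_of_mul_le_mul_left (a := Nat.card K * Nat.card K) ?_ (Nat.mul_pos h4 h4)
    calc _ = (Nat.card K * Nat.card P) ^ 2 * Nat.card D := by ring
      _ ≤ Nat.card U ^ 2 := hc
      _ = _ := by rw [pow_two, hcard]
      _ ≤ _ := Nat.mul_le_mul_right _ h1
  have h3 : ((-(p • y), -(p • z), -B y z) : L × L × L) ∈ (U.prod U).map f :=
    h2 ⟨P.neg_mem hpy, P.neg_mem hpz, D.neg_mem hyz⟩
  obtain ⟨⟨u, v⟩, ⟨hu, hv⟩, h⟩ := h3
  rw [hf] at h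
  simp only [Prod.mk.injEq] at h
  refine ⟨u, hu, v, hv, ?_, ?_, ?_⟩
  · rw [smul_add, h.1, add_neg_cancel]
  · rw [smul_add, h.2.1, add_neg_cancel]
  · rw [map_add, map_add, AddMonoidHom.add_apply, AddMonoidHom.add_apply, hUU u hu v hv, add_zero,
      add_assoc, add_comm (B u z), h.2.2, add_neg_cancel]

namespace Thin

/-- If the derived subring has order `p ^ 2` and the ring has odd rank, some basis-type element
has all its brackets in a cyclic group. -/
theorem exists_br_mem_zmultiples [Finite L] (hT : Thin p B x a) (hk : Odd (k + 1))
    (hc : Nat.card (derived B) = p ^ 2) :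
    ∃ v ∉ frattini p B, ∃ w ∈ derived B, ∀ y, B v y ∈ AddSubgroup.zmultiples w := by
  have hR := hT.rigid
  have : Fact p.Prime := ⟨hR.prime⟩
  obtain ⟨d, hd, hdi⟩ := exists_independent hR.prime hR.torsion (bot_le : ⊥ ≤ derived B)
    (fun y hy => by rw [AddSubgroup.mem_bot, nsmul_derived hT.br hy]) (k := 2) (by simp [hc])
  have hi : ∀ s t : ℤ, s • d 0 + t • d 1 = 0 → (p : ℤ) ∣ s ∧ (p : ℤ) ∣ t := by
    intro s t h
    have := hdi ![s, t] (by simpa [Fin.sum_univ_two] using h)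
    exact ⟨this 0, this 1⟩
  choose α β hαβ using fun i j => exists_eq_of_card_le_sq hc.le (hd 0) (hd 1) hi
    (br_mem_derived B (x i) (x j))
  let A : Matrix (Fin (k + 1)) (Fin (k + 1)) (ZMod p) := Matrix.of fun i j => (α i j : ZMod p)
  have hA : A.transpose = -A := by
    ext i j
    have h1 := hi (α j i + α i j) (β j i + β i j) (by
      have h2 := hR.skew (x i) (x j)
      rw [hαβ, hαβ, eq_neg_iff_add_eq_zero] at h2
      rw [← h2]; module)
    have h3 := (ZMod.intCast_zmod_eq_zero_iff_dvd _ p).mpr h1.1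
    push_cast at h3
    exact eq_neg_of_add_eq_zero_left h3
  have hdet : A.det = 0 := by
    have h1 := Matrix.det_transpose A
    rw [hA, Matrix.det_neg, Fintype.card_fin, hk.neg_one_pow, neg_one_mul] at h1
    have h2 : (2 : ZMod p) * A.det = 0 := by linear_combination (-1 : ZMod p) * h1
    refine (mul_eq_zero.mp h2).resolve_left fun h => ?_
    have h3 : ((2 : ℕ) : ZMod p) = 0 := by exact_mod_cast h
    have h4 := Nat.le_of_dvd two_pos ((ZMod.natCast_eq_zero_iff _ _).mp h3)
    have h5 := hR.prime.two_le
    have h6 := hR.odd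
    obtain rfl : p = 2 := by omega
    exact absurd h6 (by decide)
  obtain ⟨c, hc0, hAc⟩ := Matrix.exists_mulVec_eq_zero_iff.mpr hdet
  choose r hr using fun j => ZMod.intCast_surjective (c j)
  refine ⟨∑ j, r j • x j, fun h => hc0 (funext fun j => ?_), d 1, hd 1, fun y => ?_⟩
  · rw [Pi.zero_apply, ← hr, ZMod.intCast_zmod_eq_zero_iff_dvd]
    exact hT.basis_frattini.dvd r h j
  · refine hR.br_left_mem hT.basis hR.derived_le_center (fun i => ?_) y
    have h1 : (p : ℤ) ∣ ∑ j, α i j * r j := by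
      rw [← ZMod.intCast_zmod_eq_zero_iff_dvd]
      have := congrFun hAc i
      simp only [Matrix.mulVec, dotProduct, A, Matrix.of_apply, ← hr, Pi.zero_apply] at this
      push_cast; exact this
    obtain ⟨m, hm⟩ := h1
    rw [hR.skew, map_sum]
    refine AddSubgroup.neg_mem _ (AddSubgroup.mem_zmultiples_iff.mpr ⟨∑ j, β i j * r j, ?_⟩)
    have h2 : (∑ j, α i j * r j) • d 0 = 0 := by
      rw [hm, mul_comm, mul_smul, natCast_zsmul, nsmul_derived hT.br (hd 0), smul_zero]
    rw [← zero_add ((_ : ℤ) • d 1), ← h2, Finset.sum_smul, Finset.sum_smul,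
      ← Finset.sum_add_distrib]
    refine Finset.sum_congr rfl fun j _ => ?_
    rw [map_zsmul, hαβ i j]
    module

theorem false_of_five [Finite L] {x : Fin 5 → L} {a : Fin 5 → ℕ} (hT : Thin p B x a)
    (hc : Nat.card (derived B) = p ^ 2) : False := by
  have hR := hT.rigid
  have hp := hR.prime.pos
  obtain ⟨v, hv, w, hw, hvw⟩ := hT.exists_br_mem_zmultiples (by decide) hc
  set Φ := frattini p B with hΦ
  have hΦ0 : 0 < Nat.card Φ := Nat.card_pos
  have hL := hT.card_eq
  have hvΦ : ∀ s : ℤ, s • v ∈ Φ → (p : ℤ) ∣ s := fun s hs => by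
    by_contra h
    exact hv (hR.mem_of_zsmul_mem hs h)
  have hvi : ∀ s : Fin 1 → ℤ, ∑ i, s i • ![v] i ∈ Φ → ∀ i, (p : ℤ) ∣ s i := by
    intro s hs i
    rw [Fin.sum_univ_one] at hs
    rw [Fin.eq_zero i]
    exact hvΦ _ hs
  have hN1 := card_adjoin hp (fun i => nsmul_mem_frattini (![v] i)) hvi
  have hC : Nat.card L ≤ Nat.card (B v).ker * p := by
    have := card_eq_card_inf_ker_mul_card_map (⊤ : AddSubgroup L) (B v)
    rw [AddSubgroup.card_top, top_inf_eq] at this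
    rw [this]
    refine Nat.mul_le_mul_left _ ((card_le_of_le ?_).trans
      (hR.card_zmultiples_le (nsmul_derived hT.br hw)))
    rintro _ ⟨y, -, rfl⟩
    exact hvw y
  have hN1C : adjoin Φ ![v] ≤ (B v).ker := adjoin_le
    (fun d hd => hR.br_right_eq_zero (hT.frattini_le_center hd))
    (fun i => by rw [Fin.eq_zero i]; exact hR.alt v)
  obtain ⟨e, heC, hei⟩ := exists_independent hR.prime hR.torsion hN1C
    (fun y _ => le_adjoin (nsmul_mem_frattini y)) (k := 3) (by
      rw [hN1, Fintype.card_fin]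
      refine Nat.le_of_mul_le_mul_right (hL.symm.le.trans hC |>.trans' (le_of_eq ?_)) hp
      ring)
  obtain ⟨c, d, hcd, hcdi⟩ := hR.exists_commuting_pair
    (by rw [hc]; exact Nat.pow_lt_pow_right hR.prime.one_lt (by norm_num)) e
  set u₁ := ∑ i, c i • e i with hu₁
  set u₂ := ∑ i, d i • e i with hu₂
  have hvu₁ : B v u₁ = 0 := AddSubgroup.sum_mem (B v).ker fun i _ =>
    AddSubgroup.zsmul_mem _ (heC i) _
  have hvu₂ : B v u₂ = 0 := AddSubgroup.sum_mem (B v).ker fun i _ =>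
    AddSubgroup.zsmul_mem _ (heC i) _
  have hUi : ∀ s : Fin 3 → ℤ, ∑ i, s i • ![v, u₁, u₂] i ∈ Φ → ∀ i, (p : ℤ) ∣ s i := by
    intro s hs
    simp only [Fin.sum_univ_three, Matrix.cons_val_zero, Matrix.cons_val_one,
      Matrix.cons_val] at hs
    have h1 := hei (fun i => s 1 * c i + s 2 * d i) (by
      have h2 := AddSubgroup.sub_mem _ (le_adjoin (e := ![v]) hs)
        (AddSubgroup.zsmul_mem _ (self_mem_adjoin (N := Φ) (e := ![v]) 0) (s 0))
      convert h2 using 1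
      simp only [add_smul, mul_smul, Finset.sum_add_distrib, ← Finset.smul_sum, ← hu₁, ← hu₂,
        Matrix.cons_val_zero]
      abel)
    obtain ⟨h2, h3⟩ := hcdi _ _ h1
    have h4 : ∀ m : ℤ, (p : ℤ) ∣ m → ∀ y, m • y ∈ Φ := by
      rintro _ ⟨m, rfl⟩ y
      rw [mul_smul, natCast_zsmul]
      exact nsmul_mem_frattini _
    have h5 : s 0 • v ∈ Φ := by
      have := AddSubgroup.sub_mem _ (AddSubgroup.sub_mem _ hs (h4 _ h3 u₂)) (h4 _ h2 u₁)
      convert this using 1; abel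
    intro i; fin_cases i
    exacts [hvΦ _ h5, h2, h3]
  set U := adjoin Φ ![v, u₁, u₂] with hU
  have hUc : Nat.card U = p ^ 3 * Nat.card Φ := by
    rw [hU, card_adjoin hp (fun i => nsmul_mem_frattini _) hUi, Fintype.card_fin]
  have hUU : ∀ u ∈ U, ∀ v ∈ U, B u v = 0 := by
    refine hR.br_eq_zero_of_mem_adjoin hT.frattini_le_center fun i j => ?_
    have h21 : B u₂ u₁ = 0 := by rw [hR.skew, hcd, neg_zero]
    have h1v : B u₁ v = 0 := by rw [hR.skew, hvu₁, neg_zero]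
    have h2v : B u₂ v = 0 := by rw [hR.skew, hvu₂, neg_zero]
    fin_cases i <;> fin_cases j <;> simp [hR.alt, hvu₁, hvu₂, hcd, h21, h1v, h2v]
  have hDU : derived B ≤ U := le_sup_left.trans le_adjoin
  have hUL : Nat.card L = p ^ 2 * Nat.card U := by rw [hL, hUc]; ring
  obtain ⟨e, he⟩ := hR.exists_basis_of_card (fun y => le_adjoin (nsmul_mem_frattini y)) hUL
  have he' : e = ![e 0, e 1] := by ext i; fin_cases i <;> rfl
  have hq : (fun _ => p : Fin 2 → ℕ) = ![p, p] := by ext i; fin_cases i <;> rfl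
  rw [he', hq] at he
  have hLt := card_eq_torsion_mul (L := L) (p := p)
  have h5 := hT.le_card_torsion
  obtain ⟨u, hu, v', hv', hpu, hpv, huv⟩ := exists_correction (B := B) (p := p) (U := U)
    (P := (nsmulAddMonoidHom p : L →+ L).range) (K := derived B) (D := derived B)
    (y := e 0) (z := e 1) ⟨_, rfl⟩ ⟨_, rfl⟩ (br_mem_derived B _ _) (fun u _ => ⟨u, rfl⟩)
    (fun u _ v _ => AddSubgroup.add_mem _ (br_mem_derived B _ _) (br_mem_derived B _ _)) hUU
    (fun u hu v hv hpu hpv h => by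
      obtain ⟨h1, h2⟩ := hR.mem_center_of_abelian hDU hUU he hu hv hpu hpv
        (by rw [add_comm]; exact h)
      exact ⟨hT.soc u h1 hpu, hT.soc v h2 hpv⟩) (by
      rw [hc]
      refine le_of_mul_le_mul_left (a := p ^ 4) ?_ (pow_pos hp 4)
      calc _ = (p ^ 5 * Nat.card (nsmulAddMonoidHom p : L →+ L).range) ^ 2 := by ring
        _ ≤ (Nat.card L) ^ 2 := by
          rw [hLt]; exact Nat.pow_le_pow_left (Nat.mul_le_mul_right _ h5) 2
        _ = _ := by rw [hUL]; ring)
  set Y := e 0 + u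
  set Z := e 1 + v'
  have hPU : ∀ c : Fin 2 → ℤ, ∑ i, c i • ![Y, Z] i ∈ U → ∑ i, c i • ![Y, Z] i = 0 := by
    intro c hcU
    simp only [Fin.sum_univ_two, Matrix.cons_val_zero, Matrix.cons_val_one] at hcU ⊢
    have h1 := he.dvd c (by
      simp only [Fin.sum_univ_two, Matrix.cons_val_zero, Matrix.cons_val_one]
      have := U.sub_mem (U.sub_mem hcU (U.zsmul_mem hu (c 0))) (U.zsmul_mem hv' (c 1))
      convert this using 1
      simp only [Y, Z]; module)
    obtain ⟨m, hm⟩ := h1 0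
    obtain ⟨n, hn⟩ := h1 1
    simp only [Matrix.cons_val_zero, Matrix.cons_val_one] at hm hn
    rw [hm, hn, mul_comm, mul_smul, natCast_zsmul, hpu, mul_comm, mul_smul, natCast_zsmul, hpv,
      smul_zero, smul_zero, add_zero]
  refine hR.false_of_isCompl (P := adjoin ⊥ ![Y, Z]) (U := U) ⟨?_, ?_⟩ hDU hUU
    (hR.br_eq_zero_of_mem_adjoin bot_le fun i j => ?_)
    (u := v) (self_mem_adjoin (N := Φ) (e := ![v, u₁, u₂]) 0) fun h => hv (h ▸ Φ.zero_mem)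
  · rw [AddSubgroup.disjoint_def]
    rintro _ ⟨c, d, hd, rfl⟩ h
    rw [AddSubgroup.mem_bot] at hd
    rw [hd, add_zero] at h ⊢
    exact hPU c h
  · rw [codisjoint_iff, eq_top_iff]
    intro y _
    obtain ⟨c, d, hd, rfl⟩ := he.span y
    have : ∑ i, c i • ![e 0, e 1] i + d = ∑ i, c i • ![Y, Z] i + (d - c 0 • u - c 1 • v') := by
      simp only [Fin.sum_univ_two, Matrix.cons_val_zero, Matrix.cons_val_one, Y, Z]; module
    rw [this]
    exact AddSubgroup.add_mem _ (AddSubgroup.mem_sup_left ⟨c, 0, AddSubgroup.zero_mem _, by simp⟩)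
      (AddSubgroup.mem_sup_right
        (U.sub_mem (U.sub_mem hd (U.zsmul_mem hu _)) (U.zsmul_mem hv' _)))
  · have h10 : B Z Y = 0 := by rw [hR.skew, huv, neg_zero]
    fin_cases i <;> fin_cases j <;> simp [hR.alt, huv, h10]

end Thin

end

section

variable {L : Type*} [AddCommGroup L] {p : ℕ} {B : L →+ L →+ L}

namespace Rigid

variable (hR : Rigid p B)
include hR

/-- Images of basis elements under an automorphism given on a basis. -/
theorem sub_mem_center_of_extension [Finite L] {ι : Type*} [Fintype ι] [LinearOrder ι] {x : ι → L}
    {q : ι → ℕ} (hb : RelBasis (derived B) x q) {y : ι → L} (h : derived B →+ L)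
    (hy : ∀ i, q i • y i = h ⟨q i • x i, hb.mem i⟩)
    (hB : ∀ i j, i < j → h ⟨B (x i) (x j), br_mem_derived B _ _⟩ = B (y i) (y j))
    (hs : ∀ i, ∃ c : ι → ℤ, x i - ∑ j, c j • y j ∈ derived B) (i : ι) :
    y i - x i ∈ center B := by
  obtain ⟨f, hfx, hfD⟩ := hb.exists_extend h y hy
  have hB' : ∀ i j, f (B (x i) (x j)) = B (y i) (y j) := by
    intro i j
    rcases lt_trichotomy i j with hij | rfl | hij
    · rw [← hB i j hij]; exact hfD ⟨_, _⟩
    · rw [hR.alt, hR.alt, map_zero]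
    · rw [hR.skew, hR.skew (y i), map_neg, ← hB j i hij]
      exact congrArg _ (hfD ⟨_, _⟩)
  have hcen : ∀ d ∈ derived B, ∀ z, B z (f d) = 0 ∧ B (f d) z = 0 := by
    intro d hd
    have : derived B ≤ (center B).comap f := by
      have : ∀ y z, B y z ∈ (center B).comap f := by
        refine hR.br_mem hb hR.derived_le_center fun i j => ?_
        rw [AddSubgroup.mem_comap, hB']
        exact hR.derived_le_center (br_mem_derived B _ _)
      rw [derived, AddSubgroup.closure_le]
      rintro _ ⟨y, z, rfl⟩
      exact this y z
    exact fun z => ⟨hR.br_right_eq_zero (this hd), this hd z⟩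
  have hlie : ∀ u v, f (B u v) = B (f u) (f v) := by
    have h1 : ∀ i v, f (B (x i) v) = B (y i) (f v) := by
      intro i v
      obtain ⟨c, d, hd, rfl⟩ := hb.span v
      simp only [map_add, map_sum, map_zsmul, hB', hfx, (hcen d hd _).1,
        hR.br_right_eq_zero (hR.derived_le_center hd), map_zero]
    intro u v
    obtain ⟨c, d, hd, rfl⟩ := hb.span u
    have h2 : B d = 0 := AddMonoidHom.ext (hR.derived_le_center hd)
    have h3 : B (f d) = 0 := AddMonoidHom.ext fun z => (hcen d hd z).2
    simp only [map_add, map_sum, map_zsmul, h2, h3, add_zero, AddMonoidHom.finsetSum_apply,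
      AddMonoidHom.zsmul_apply, h1, hfx]
  have hrange : f.range = ⊤ := by
    have h1 : ∀ u, ∃ v ∈ f.range, ∃ d ∈ derived B, u = v + d := by
      intro u
      obtain ⟨c, d, hd, rfl⟩ := hb.span u
      choose c' hc' using hs
      refine ⟨∑ i, c i • ∑ j, c' i j • y j, AddSubgroup.sum_mem _ fun i _ =>
        AddSubgroup.zsmul_mem _ (AddSubgroup.sum_mem _ fun j _ =>
          AddSubgroup.zsmul_mem _ (AddMonoidHom.mem_range.mpr ⟨x j, hfx j⟩) _) _,
        ∑ i, c i • (x i - ∑ j, c' i j • y j) + d,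
        AddSubgroup.add_mem _ (AddSubgroup.sum_mem _ fun i _ =>
          AddSubgroup.zsmul_mem _ (hc' i) _) hd, ?_⟩
      simp only [smul_sub, Finset.sum_sub_distrib]
      abel
    have h2 : derived B ≤ f.range := by
      rw [derived, AddSubgroup.closure_le]
      rintro _ ⟨u, v, rfl⟩
      obtain ⟨_, ⟨u, rfl⟩, d, hd, rfl⟩ := h1 u
      obtain ⟨_, ⟨v, rfl⟩, e, he, rfl⟩ := h1 v
      have h3 : B d = 0 := AddMonoidHom.ext (hR.derived_le_center hd)
      refine ⟨B u v, ?_⟩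
      rw [hlie, map_add, map_add, h3, add_zero, hR.br_right_eq_zero (hR.derived_le_center he),
        add_zero]
    rw [eq_top_iff]
    intro u _
    obtain ⟨v, hv, d, hd, rfl⟩ := h1 u
    exact AddSubgroup.add_mem _ hv (h2 hd)
  have hbij : Function.Bijective f :=
    Finite.injective_iff_bijective.mp (Finite.injective_iff_surjective.mpr
      (AddMonoidHom.range_eq_top.mp hrange))
  have := hR.sub_mem_center (φ := AddEquiv.ofBijective f hbij) hlie (x i)
  rwa [AddEquiv.ofBijective_apply, hfx] at this

theorem sub_mem_center_of_br_eq [Finite L] {ι : Type*} [Fintype ι] [LinearOrder ι] {x : ι → L}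
    {q : ι → ℕ} (hb : RelBasis (derived B) x q) {y : ι → L} (hy : ∀ i, q i • y i = q i • x i)
    (hB : ∀ i j, i < j → B (x i) (x j) = B (y i) (y j))
    (hs : ∀ i, ∃ c : ι → ℤ, x i - ∑ j, c j • y j ∈ derived B) (i : ι) :
    y i - x i ∈ center B :=
  hR.sub_mem_center_of_extension hb (derived B).subtype hy hB hs i

end Rigid

/-- A basis over `D` built from two elements of order `p` and two elements whose multiples are
independent in `D`. -/
theorem relBasis_four [Finite L] {D : AddSubgroup L} (hD : ∀ d ∈ D, p • d = 0)
    {x y X u d₁ d₂ : L} {A : ℕ} (hx : p • x = 0) (hy : p • y = 0)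
    (hxy : ∀ s t : ℤ, s • x + t • y ∈ D → (p : ℤ) ∣ s ∧ (p : ℤ) ∣ t)
    (hu : p • u = d₁) (hX : p ^ A • X = d₂) (hd₁ : d₁ ∈ D) (hd₂ : d₂ ∈ D)
    (hd : ∀ s t : ℤ, s • d₁ + t • d₂ = 0 → (p : ℤ) ∣ s ∧ (p : ℤ) ∣ t)
    (hc : Nat.card L = p ^ (A + 3) * Nat.card D) :
    RelBasis D ![x, y, X, u] ![p, p, p ^ A, p] := by
  refine RelBasis.of_dvd_of_card ?_ ?_ ?_
  · intro i; fin_cases i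
    · change p • x ∈ D; rw [hx]; exact D.zero_mem
    · change p • y ∈ D; rw [hy]; exact D.zero_mem
    · change p ^ A • X ∈ D; rwa [hX]
    · change p • u ∈ D; rwa [hu]
  · intro s hs
    simp only [Fin.sum_univ_four, Matrix.cons_val_zero, Matrix.cons_val_one,
      Matrix.cons_val] at hs
    have h1 : (p : ℤ) • s 2 • X + s 3 • d₁ = 0 := by
      have := hD _ hs
      rw [smul_add, smul_add, smul_add, smul_comm p, hx, smul_comm p, hy, smul_comm p (s 3), hu,
        smul_zero, smul_zero, zero_add, zero_add] at this
      rw [← this, natCast_zsmul]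
    have h2 : ∀ j ≤ A, ∃ m, s 2 = m * (p : ℤ) ^ j := by
      intro j
      induction j with
      | zero => exact fun _ => ⟨s 2, by simp⟩
      | succ j ih =>
        intro hj
        obtain ⟨m, hm⟩ := ih (by omega)
        have h3 := congrArg (fun z => (p : ℤ) ^ (A - j - 1) • z) h1
        simp only [smul_add, smul_zero, hm, smul_smul] at h3
        have h4 : (p : ℤ) ^ (A - j - 1) * ((p : ℤ) * (m * (p : ℤ) ^ j)) = m * (p ^ A : ℕ) := by
          have : A = (A - j - 1) + 1 + j := by omega
          push_cast
          conv_rhs => rw [this]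
          ring
        rw [h4, mul_smul m, natCast_zsmul, hX, add_comm] at h3
        obtain ⟨n, rfl⟩ := (hd _ _ h3).2
        exact ⟨n, by rw [hm]; ring⟩
    obtain ⟨m, hm⟩ := h2 A le_rfl
    have h3 : s 3 • d₁ = 0 := by
      have h4 : (p : ℤ) • s 2 • X = 0 := by
        have h5 : s 2 • X = m • d₂ := by
          rw [hm, mul_smul, ← hX, ← natCast_zsmul]; push_cast; rfl
        rw [h5, smul_comm, natCast_zsmul, hD _ hd₂, smul_zero]
      rwa [h4, zero_add] at h1
    have h4 : (p : ℤ) ∣ s 3 := (hd (s 3) 0 (by rw [h3, zero_smul, add_zero])).1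
    obtain ⟨n, hn⟩ := h4
    have h5 := hxy (s 0) (s 1) (by
      have h6 : s 3 • u ∈ D := by
        rw [hn, mul_comm, mul_smul, natCast_zsmul, hu]; exact D.zsmul_mem hd₁ _
      have h7 : s 2 • X ∈ D := by
        have : s 2 • X = m • d₂ := by
          rw [hm, mul_smul, ← hX, ← natCast_zsmul]; push_cast; rfl
        rw [this]; exact D.zsmul_mem hd₂ _
      have := D.sub_mem (D.sub_mem hs h6) h7
      convert this using 1; abel)
    intro i; fin_cases i
    · exact h5.1
    · exact h5.2
    · exact ⟨m, by simp [hm, mul_comm]⟩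
    · exact ⟨n, hn⟩
  · rw [hc, Fin.prod_univ_four]
    simp only [Matrix.cons_val_zero, Matrix.cons_val_one, Matrix.cons_val]
    exact le_of_eq (by ring)

namespace Rigid

variable (hR : Rigid p B)
include hR

theorem dvd_of_zsmul_eq_zero {s : ℤ} {d : L} (h : s • d = 0) (hd : d ≠ 0) : (p : ℤ) ∣ s := by
  by_contra hs
  exact hd (hR.zsmul_eq_zero_of_coprime h hs)

theorem dvd_of_br {x y u v e : L} (he : e ≠ 0) (h1 : B x u = e) (h2 : B y v = e) (h3 : B x v = 0)
    (h4 : B y u = 0) : ∀ s t : ℤ, s • x + t • y ∈ derived B → (p : ℤ) ∣ s ∧ (p : ℤ) ∣ t := by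
  intro s t h
  have h' := hR.derived_le_center h
  constructor
  · have := h' u
    simp only [map_add, map_zsmul, AddMonoidHom.add_apply, AddMonoidHom.zsmul_apply, h1, h4,
      smul_zero, add_zero] at this
    exact hR.dvd_of_zsmul_eq_zero this he
  · have := h' v
    simp only [map_add, map_zsmul, AddMonoidHom.add_apply, AddMonoidHom.zsmul_apply, h2, h3,
      smul_zero, zero_add] at this
    exact hR.dvd_of_zsmul_eq_zero this he

theorem false_of_four_grading [Finite L] (hbr : ∀ y z, p • B y z = 0)
    (hc2 : Nat.card (derived B) = p ^ 2) {x y u v e : L} {A : ℕ} {κ : ℤ} (hA : 1 ≤ A)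
    (hc : Nat.card L = p ^ (A + 3) * Nat.card (derived B)) (hx : p • x = 0) (hy : p • y = 0)
    (h1 : B x u = e) (h2 : B y v = e) (h3 : B x v = 0) (h4 : B y u = 0)
    (hd : ∀ s t : ℤ, s • e + t • B x y = 0 → (p : ℤ) ∣ s ∧ (p : ℤ) ∣ t)
    (hu : p ^ A • u = κ • B x y) (hκ : ¬ (p : ℤ) ∣ κ) (hv : p • v = e) : False := by
  set w := B x y with hw
  have hpe : p • e = 0 := h1 ▸ hbr _ _
  have hpw : p • w = 0 := hbr _ _
  obtain ⟨c₁, c₂, hcc⟩ := exists_eq_of_card_le_sq hc2.le (h1 ▸ br_mem_derived B x u)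
    (br_mem_derived B x y) hd (br_mem_derived B u v)
  rw [← hw] at hcc
  obtain ⟨i₂, m₂, hi₂⟩ := hR.exists_mul_eq_one_add (s := 2) (by
    intro h
    have h5 := Nat.le_of_dvd two_pos (by exact_mod_cast h : p ∣ 2)
    have h6 := hR.prime.two_le
    have h7 := hR.odd
    obtain rfl : p = 2 := by omega
    exact absurd h7 (by decide))
  obtain ⟨κ', m, hκ'⟩ := hR.exists_mul_eq_one_add hκ
  set θ : ℤ := -i₂ * c₁
  set σ : ℤ := κ' * θ
  set ρ : ℤ := (p : ℤ) ^ (A - 1)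
  have hzp : ∀ n : ℤ, ∀ z : L, p • z = 0 → (n * p) • z = 0 := fun n z hz => by
    rw [mul_smul, natCast_zsmul, hz, smul_zero]
  have hpρ : ∀ z : L, p • ρ • z = p ^ A • z := fun z => by
    rw [← natCast_zsmul, smul_smul, ← natCast_zsmul (n := p ^ A)]
    congr 1
    push_cast
    rw [mul_comm, ← pow_succ, Nat.sub_add_cancel hA]
  have hyx : B y x = -w := hR.skew y x
  set x' := x - (σ * ρ) • y
  set u' := u + θ • y
  set v' := v + (σ * ρ) • u + (θ * σ * ρ) • y - θ • x
  set e' := e + θ • w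
  have huy : B u y = 0 := by rw [hR.skew, h4, neg_zero]
  have hux : B u x = -e := by rw [hR.skew, h1]
  have e1 : B x' u' = e' := by
    simp only [x', u', e', map_add, map_sub, map_zsmul, AddMonoidHom.sub_apply,
      AddMonoidHom.zsmul_apply, h1, h4, hR.alt, ← hw]
    module
  have e2 : B y v' = e' := by
    simp only [v', e', map_add, map_sub, map_zsmul, h2, h4, hR.alt, hyx]
    module
  have e3 : B x' v' = 0 := by
    simp only [x', v', map_add, map_sub, map_zsmul, AddMonoidHom.sub_apply,
      AddMonoidHom.zsmul_apply, h1, h2, h3, h4, hR.alt, ← hw, hyx]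
    module
  have e4 : B y u' = 0 := by
    simp only [u', map_add, map_zsmul, h4, hR.alt, smul_zero, add_zero]
  have e5 : B u' v' = (c₂ + θ * θ) • w := by
    have h5 : (2 * θ + c₁) • e = 0 := by
      have : 2 * θ + c₁ = (-c₁ * m₂) * p := by
        simp only [θ]; linear_combination (-c₁) * hi₂
      rw [this]; exact hzp _ _ hpe
    rw [← add_zero (_ • w), ← h5]
    simp only [u', v', map_add, map_sub, map_zsmul, AddMonoidHom.add_apply,
      AddMonoidHom.zsmul_apply, h2, h4, hR.alt, hyx, huy, hux, hcc]
    module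
  have e6 : B x' y = w := by
    simp only [x', map_sub, map_zsmul, AddMonoidHom.sub_apply, AddMonoidHom.zsmul_apply, hR.alt,
      ← hw]
    module
  have f1 : p • x' = 0 := by
    simp only [x', smul_sub, smul_comm p, hx, hy, smul_zero, sub_zero]
  have f2 : p ^ A • u' = κ • w := by
    obtain ⟨A', rfl⟩ := Nat.exists_eq_add_of_le' hA
    rw [smul_add, hu, pow_succ, mul_smul, smul_comm p, hy, smul_zero, smul_zero, add_zero]
  have f3 : p • v' = e' := by
    have h5 : p • (σ * ρ) • u = θ • w := by
      rw [mul_smul, smul_comm, hpρ, hu, smul_smul]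
      have : σ * κ = θ + (θ * m) * p := by simp only [σ]; linear_combination θ * hκ'
      rw [this, add_smul, hzp _ _ hpw, add_zero]
    simp only [v', e', smul_sub, smul_add, h5, hv, smul_comm p (_ : ℤ) y, smul_comm p (_ : ℤ) x,
      hx, hy, smul_zero, sub_zero, add_zero]
  have hd' : ∀ s t : ℤ, s • e' + t • w = 0 → (p : ℤ) ∣ s ∧ (p : ℤ) ∣ t := by
    intro s t h
    obtain ⟨h5, h6⟩ := hd s (s * θ + t) (by rw [← h]; simp only [e']; module)
    exact ⟨h5, (Int.dvd_add_right (h5.mul_right θ)).mp h6⟩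
  have he' : e' ≠ 0 := fun h => by
    have := (hd' 1 0 (by rw [h]; simp)).1
    exact (Nat.prime_iff_prime_int.mp hR.prime).not_dvd_one this
  have hb := relBasis_four (D := derived B) (fun d hd => nsmul_derived hbr hd) f1 hy
    (hR.dvd_of_br he' e1 e2 e3 e4) f3 f2 (e1 ▸ br_mem_derived B _ _)
    (AddSubgroup.zsmul_mem _ (br_mem_derived B _ _) _) (fun s t h => by
      rw [smul_smul] at h
      obtain ⟨h5, h6⟩ := hd' _ _ h
      exact ⟨h5, ((Nat.prime_iff_prime_int.mp hR.prime).dvd_mul.mp h6).resolve_right hκ⟩) hc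
  refine hR.sign_grading hb ![false, true, false, true]
    (fun b => if b then AddSubgroup.zmultiples e' else AddSubgroup.zmultiples w) ?_ ?_ ?_ ?_
    (i := 0) rfl hR.prime.one_lt.ne'
  · intro b; cases b
    · simpa using br_mem_derived B x y
    · simpa [← e1] using br_mem_derived B x' u'
  · simp only [if_true, Bool.false_eq_true, if_false]
    rw [AddSubgroup.disjoint_def]
    rintro _ ⟨s, rfl⟩ ⟨t, h⟩
    simp only at h
    obtain ⟨⟨n, hn⟩, -⟩ := hd' s (-t) (by rw [← h]; module)
    simp only [hn]
    rw [← e1, mul_comm, mul_smul, natCast_zsmul, hbr, smul_zero]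
  · intro i; fin_cases i
    · simp [f1]
    · simp [hy]
    · simp [f2]
    · simp [f3]
  · have g1 : B y x' = -w := by rw [hR.skew, e6]
    have g2 : B u' x' = -e' := by rw [hR.skew, e1]
    have g3 : B v' y = -e' := by rw [hR.skew, e2]
    have g4 : B v' x' = 0 := by rw [hR.skew, e3, neg_zero]
    have g5 : B u' y = 0 := by rw [hR.skew, e4, neg_zero]
    have g6 : B v' u' = -((c₂ + θ * θ) • w) := by rw [hR.skew, e5]
    intro i j; fin_cases i <;> fin_cases j <;>
      simp [hR.alt, e1, e2, e3, e4, e5, e6, g1, g2, g3, g4, g5, g6, -neg_smul,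
        AddSubgroup.zsmul_mem]

theorem false_of_four_perturbation [Finite L] (hbr : ∀ y z, p • B y z = 0) {x y u v e : L} {A : ℕ}
    {κ : ℤ} (hA : 2 ≤ A) (hc : Nat.card L = p ^ (A + 3) * Nat.card (derived B))
    (hx : p • x = 0) (hy : p • y = 0) (h1 : B x u = e) (h2 : B y v = e) (h3 : B x v = 0)
    (h4 : B y u = 0) (hd : ∀ s t : ℤ, s • e + t • B x y = 0 → (p : ℤ) ∣ s ∧ (p : ℤ) ∣ t)
    (hu : p • u = κ • B x y) (hκ : ¬ (p : ℤ) ∣ κ) (hv : p ^ A • v = e) : False := by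
  have he : e ≠ 0 := fun h => by
    have := (hd 1 0 (by rw [h]; simp)).1
    exact (Nat.prime_iff_prime_int.mp hR.prime).not_dvd_one this
  have hb := relBasis_four (D := derived B) (fun d hd => nsmul_derived hbr hd)
    hx hy (hR.dvd_of_br he h1 h2 h3 h4) hu hv
    (AddSubgroup.zsmul_mem _ (br_mem_derived B _ _) _) (h1 ▸ br_mem_derived B x u)
    (fun s t h => by
      rw [smul_smul, add_comm] at h
      obtain ⟨h5, h6⟩ := hd _ _ h
      exact ⟨((Nat.prime_iff_prime_int.mp hR.prime).dvd_mul.mp h6).resolve_right hκ, h5⟩) hc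
  have huy : B u y = 0 := by rw [hR.skew, h4, neg_zero]
  have huv : B u (v + u) = B u v := by rw [map_add, hR.alt, add_zero]
  have hpu : p ^ A • u = 0 := by
    obtain ⟨A', rfl⟩ := Nat.exists_eq_add_of_le' hA
    rw [pow_add, pow_two, ← mul_assoc, mul_smul, hu, smul_comm, mul_smul, hbr, smul_zero, smul_zero]
  have key := hR.sub_mem_center_of_br_eq hb (y := ![x - y, y, v + u, u]) (by
    intro i; fin_cases i
    · simp [smul_sub, hx, hy]
    · rfl
    · simp [smul_add, hpu]
    · rfl) (by
    intro i j hij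
    fin_cases i <;> fin_cases j <;> first
      | exact absurd hij (by decide)
      | simp [hR.alt, h1, h2, h3, h4, hR.skew v u]) (by
    intro i; fin_cases i
    · refine ⟨![1, 1, 0, 0], ?_⟩
      simp [Fin.sum_univ_four]
    · refine ⟨![0, 1, 0, 0], ?_⟩
      simp [Fin.sum_univ_four]
    · refine ⟨![0, 0, 1, -1], ?_⟩
      simp [Fin.sum_univ_four]
    · refine ⟨![0, 0, 0, 1], ?_⟩
      simp [Fin.sum_univ_four]) 2
  have : v + u - v ∈ center B := key
  rw [add_sub_cancel_left] at this
  exact he (by rw [← h1]; exact hR.br_right_eq_zero this)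

end Rigid

end

section

variable {L : Type*} [AddCommGroup L] {p : ℕ} {B : L →+ L →+ L}

namespace Rigid

variable (hR : Rigid p B)
include hR

theorem dvd_of_notMem_zmultiples {e w : L} (hpe : p • e = 0) (hw : w ≠ 0)
    (he : e ∉ AddSubgroup.zmultiples w) :
    ∀ s t : ℤ, s • e + t • w = 0 → (p : ℤ) ∣ s ∧ (p : ℤ) ∣ t := by
  intro s t h
  have hs : (p : ℤ) ∣ s := by
    by_contra hs
    refine he (hR.mem_of_zsmul_mem ?_ hs)
    rw [eq_neg_of_add_eq_zero_left h]
    exact AddSubgroup.neg_mem _ (AddSubgroup.zsmul_mem _ (AddSubgroup.mem_zmultiples _) _)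
  refine ⟨hs, ?_⟩
  obtain ⟨n, rfl⟩ := hs
  rw [mul_comm, mul_smul, natCast_zsmul, hpe, smul_zero, zero_add] at h
  exact hR.dvd_of_zsmul_eq_zero h hw

/-- Adapting a commuting frame to a nondegenerate pairing. -/
theorem exists_dual_frame [Finite L] (hbr : ∀ y z, p • B y z = 0)
    (hc2 : Nat.card (derived B) = p ^ 2) {x y u v e : L} (he : e ∈ derived B)
    (hx : p • x = 0) (hy : p • y = 0)
    (hd : ∀ s t : ℤ, s • e + t • B x y = 0 → (p : ℤ) ∣ s ∧ (p : ℤ) ∣ t)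
    (hns : ∀ s t : ℤ, B (s • x + t • y) u ∈ AddSubgroup.zmultiples (B x y) →
      B (s • x + t • y) v ∈ AddSubgroup.zmultiples (B x y) → (p : ℤ) ∣ s ∧ (p : ℤ) ∣ t) :
    ∃ x' y' u' v' : L, ∃ δ : ℤ, p • x' = 0 ∧ p • y' = 0 ∧ p • u' = p • u ∧ p • v' = p • v ∧
      B x' u' = e ∧ B y' v' = e ∧ B x' v' = 0 ∧ B y' u' = 0 ∧
      (∀ s t : ℤ, s • e + t • B x' y' = 0 → (p : ℤ) ∣ s ∧ (p : ℤ) ∣ t) ∧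
      B x y = δ • B x' y' ∧ ¬ (p : ℤ) ∣ δ := by
  have hpp := Nat.prime_iff_prime_int.mp hR.prime
  set w := B x y with hw
  have hex : ∀ y z, ∃ s t : ℤ, B y z = s • e + t • w := fun y z =>
    exists_eq_of_card_le_sq hc2.le he (hw ▸ br_mem_derived B x _) hd (br_mem_derived B y z)
  obtain ⟨a₁, b₁, h1⟩ := hex x u
  obtain ⟨a₂, b₂, h2⟩ := hex y u
  obtain ⟨c₁, d₁, h3⟩ := hex x v
  obtain ⟨c₂, d₂, h4⟩ := hex y v
  have hpe : p • e = 0 := nsmul_derived hbr he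
  have hpw : p • w = 0 := hbr _ _
  have hzp : ∀ n : ℤ, ∀ z : L, p • z = 0 → (n * p) • z = 0 := fun n z hz => by
    rw [mul_smul, natCast_zsmul, hz, smul_zero]
  have hu : ∀ s t : ℤ, B (s • x + t • y) u = (s * a₁ + t * a₂) • e + (s * b₁ + t * b₂) • w := by
    intro s t
    simp only [map_add, map_zsmul, AddMonoidHom.add_apply, AddMonoidHom.zsmul_apply, h1, h2]
    module
  have hv : ∀ s t : ℤ, B (s • x + t • y) v = (s * c₁ + t * c₂) • e + (s * d₁ + t * d₂) • w := by
    intro s t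
    simp only [map_add, map_zsmul, AddMonoidHom.add_apply, AddMonoidHom.zsmul_apply, h3, h4]
    module
  have hmem : ∀ m n : ℤ, (p : ℤ) ∣ m → m • e + n • w ∈ AddSubgroup.zmultiples w := by
    rintro _ n ⟨m, rfl⟩
    rw [mul_comm, hzp _ _ hpe, zero_add]
    exact AddSubgroup.zsmul_mem _ (AddSubgroup.mem_zmultiples _) _
  have hns' : ∀ s t : ℤ, (p : ℤ) ∣ s * a₁ + t * a₂ → (p : ℤ) ∣ s * c₁ + t * c₂ →
      (p : ℤ) ∣ s ∧ (p : ℤ) ∣ t := fun s t h h' =>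
    hns s t (by rw [hu]; exact hmem _ _ h) (by rw [hv]; exact hmem _ _ h')
  set Δ := a₁ * c₂ - a₂ * c₁ with hΔ
  have hpΔ : ¬ (p : ℤ) ∣ Δ := by
    intro h
    obtain ⟨k1, k2⟩ := hns' c₂ (-c₁) (by convert h using 1; rw [hΔ]; ring) ⟨0, by ring⟩
    obtain ⟨k3, k4⟩ := hns' a₂ (-a₁) ⟨0, by ring⟩ (by
      rw [← Int.dvd_neg]; convert h using 1; rw [hΔ]; ring)
    exact hpp.not_dvd_one (hns' 1 0 (by simpa using k4) (by simpa using k2)).1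
  obtain ⟨ε, m, hε⟩ := hR.exists_mul_eq_one_add hpΔ
  set x' := (ε * c₂) • x + (-(ε * c₁)) • y with hx'
  set y' := (-(ε * a₂)) • x + (ε * a₁) • y with hy'
  have e0 : B x' y' = ε • w := by
    have : B x' y' = (ε * (ε * Δ)) • w := by
      simp only [hx', hy', map_add, map_zsmul, AddMonoidHom.add_apply, AddMonoidHom.zsmul_apply,
        hR.alt, ← hw, hR.skew y x, hΔ]
      module
    rw [this, hε, show ε * (1 + m * p) = ε + (ε * m) * p by ring, add_smul, hzp _ _ hpw, add_zero]
  have e1 : w = Δ • B x' y' := by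
    rw [e0, smul_smul, mul_comm, hε, add_smul, one_smul, hzp _ _ hpw, add_zero]
  have f1 : ∃ n : ℤ, B x' u = e + n • B x' y' := by
    refine ⟨(ε * c₂ * b₁ + -(ε * c₁) * b₂) * Δ, ?_⟩
    rw [hu, mul_smul _ Δ, ← e1,
      show ε * c₂ * a₁ + -(ε * c₁) * a₂ = 1 + m * p by rw [← hε, hΔ]; ring,
      add_smul, hzp _ _ hpe, one_smul, add_zero]
  have f2 : ∃ n : ℤ, B y' u = n • B x' y' := by
    refine ⟨(-(ε * a₂) * b₁ + ε * a₁ * b₂) * Δ, ?_⟩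
    rw [hu, mul_smul _ Δ, ← e1, show -(ε * a₂) * a₁ + ε * a₁ * a₂ = 0 by ring, zero_smul, zero_add]
  have f3 : ∃ n : ℤ, B x' v = n • B x' y' := by
    refine ⟨(ε * c₂ * d₁ + -(ε * c₁) * d₂) * Δ, ?_⟩
    rw [hv, mul_smul _ Δ, ← e1, show ε * c₂ * c₁ + -(ε * c₁) * c₂ = 0 by ring, zero_smul, zero_add]
  have f4 : ∃ n : ℤ, B y' v = e + n • B x' y' := by
    refine ⟨(-(ε * a₂) * d₁ + ε * a₁ * d₂) * Δ, ?_⟩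
    rw [hv, mul_smul _ Δ, ← e1,
      show -(ε * a₂) * c₁ + ε * a₁ * c₂ = 1 + m * p by rw [← hε, hΔ]; ring,
      add_smul, hzp _ _ hpe, one_smul, add_zero]
  obtain ⟨n₁, f1⟩ := f1
  obtain ⟨n₂, f2⟩ := f2
  obtain ⟨n₃, f3⟩ := f3
  obtain ⟨n₄, f4⟩ := f4
  have g1 : p • x' = 0 := by
    rw [hx', smul_add, smul_comm, hx, smul_comm, hy, smul_zero, smul_zero, add_zero]
  have g2 : p • y' = 0 := by
    rw [hy', smul_add, smul_comm, hx, smul_comm, hy, smul_zero, smul_zero, add_zero]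
  clear_value x' y'
  have hyx : B y' x' = -B x' y' := hR.skew _ _
  refine ⟨x', y', u + n₂ • x' - n₁ • y', v + n₄ • x' - n₃ • y', Δ, g1, g2, ?_, ?_, ?_, ?_, ?_, ?_,
    fun s t h => ?_, e1, hpΔ⟩
  · rw [smul_sub, smul_add, smul_comm p n₂, smul_comm p n₁, g1, g2, smul_zero, smul_zero, add_zero,
      sub_zero]
  · rw [smul_sub, smul_add, smul_comm p n₄, smul_comm p n₃, g1, g2, smul_zero, smul_zero, add_zero,
      sub_zero]
  · simp only [map_add, map_sub, map_zsmul, hR.alt, f1]; module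
  · simp only [map_add, map_sub, map_zsmul, hR.alt, f4, hyx]; module
  · simp only [map_add, map_sub, map_zsmul, hR.alt, f3]; module
  · simp only [map_add, map_sub, map_zsmul, hR.alt, f2, hyx]; module
  · obtain ⟨k1, k2⟩ := hd (Δ * s) t (by
      have := congrArg (Δ • ·) h
      simp only [smul_zero, smul_add] at this
      rw [smul_comm Δ t, ← e1] at this
      rw [mul_smul, this])
    exact ⟨(hpp.dvd_mul.mp k1).resolve_left hpΔ, k2⟩

end Rigid

namespace Thin

variable {x : Fin 4 → L} {a : Fin 4 → ℕ}

/-- Elements of order `p` that are independent modulo the brackets do not commute. -/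
theorem br_ne_zero_of_four [Finite L] (hT : Thin p B x a) (hc : Nat.card (derived B) = p ^ 2)
    {y z : L} (hy : p • y = 0) (hz : p • z = 0)
    (hyz : ∀ s t : ℤ, s • y + t • z ∈ derived B → (p : ℤ) ∣ s ∧ (p : ℤ) ∣ t) : B y z ≠ 0 := by
  intro h0
  have hR := hT.rigid
  have hp := hR.prime.pos
  have hΦ : ∀ s t : ℤ, s • y + t • z ∈ center B → (p : ℤ) ∣ s ∧ (p : ℤ) ∣ t := fun s t h =>
    hyz s t (hT.soc _ h (by rw [smul_add, smul_comm p s, smul_comm p t, hy, hz, smul_zero,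
      smul_zero, add_zero]))
  set N := adjoin (frattini p B) ![y, z] with hN
  have hNc : Nat.card N = p ^ 2 * Nat.card (frattini p B) := by
    rw [hN, card_adjoin hp (fun i => nsmul_mem_frattini _) (by
      intro s hs
      simp only [Fin.sum_univ_two, Matrix.cons_val_zero, Matrix.cons_val_one] at hs
      have := hΦ _ _ (hT.frattini_le_center hs)
      intro i; fin_cases i
      exacts [this.1, this.2]), Fintype.card_fin]
  have hNN : ∀ u ∈ N, ∀ v ∈ N, B u v = 0 := by
    refine hR.br_eq_zero_of_mem_adjoin hT.frattini_le_center fun i j => ?_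
    have h1 : B z y = 0 := by rw [hR.skew, h0, neg_zero]
    fin_cases i <;> fin_cases j <;> simp [hR.alt, h0, h1]
  have hDN : derived B ≤ N := le_sup_left.trans le_adjoin
  obtain ⟨e, he⟩ := hR.exists_basis_of_card (U := N)
    (fun y => le_adjoin (nsmul_mem_frattini y)) (k := 2) (by rw [hT.card_eq, hNc]; ring)
  have he' : e = ![e 0, e 1] := by ext i; fin_cases i <;> rfl
  have hq : (fun _ => p : Fin 2 → ℕ) = ![p, p] := by ext i; fin_cases i <;> rfl
  rw [he', hq] at he
  have hyN : y ∈ N := self_mem_adjoin (N := frattini p B) (e := ![y, z]) 0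
  have hzN : z ∈ N := self_mem_adjoin (N := frattini p B) (e := ![y, z]) 1
  obtain ⟨s, ⟨i, hi⟩, hs⟩ := exists_relation (κ := Fin 4) p (bot_le : ⊥ ≤ derived B)
    (e := ![B y (e 1), B z (e 1), B (e 0) y, B (e 0) z]) (by
      intro i; fin_cases i <;> exact br_mem_derived B _ _) (by
      rw [hc, Fintype.card_fin, AddSubgroup.card_bot, mul_one]
      exact Nat.pow_lt_pow_right hR.prime.one_lt (by norm_num))
  simp only [Fin.sum_univ_four, AddSubgroup.mem_bot, Matrix.cons_val_zero, Matrix.cons_val_one,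
    Matrix.cons_val] at hs
  have hp0 : ∀ s t : ℤ, p • (s • y + t • z) = 0 := fun s t => by
    rw [smul_add, smul_comm p s, smul_comm p t, hy, hz, smul_zero, smul_zero, add_zero]
  obtain ⟨h1, h2⟩ := hR.mem_center_of_abelian hDN hNN he (u := s 0 • y + s 1 • z)
    (v := s 2 • y + s 3 • z) (N.add_mem (N.zsmul_mem hyN _) (N.zsmul_mem hzN _))
    (N.add_mem (N.zsmul_mem hyN _) (N.zsmul_mem hzN _)) (hp0 _ _) (hp0 _ _) (by
      rw [← hs]
      simp only [map_add, map_zsmul, AddMonoidHom.add_apply, AddMonoidHom.zsmul_apply]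
      abel)
  have h3 := hΦ _ _ h1
  have h4 := hΦ _ _ h2
  fin_cases i
  exacts [hi h3.1, hi h3.2, hi h4.1, hi h4.2]

theorem false_of_four [Finite L] (hT : Thin p B x a) (hc : Nat.card (derived B) = p ^ 2) :
    False := by
  have hR := hT.rigid
  have hp := hR.prime.pos
  have hpp := Nat.prime_iff_prime_int.mp hR.prime
  have hpD : ∀ d ∈ derived B, p • d = 0 := fun d hd => nsmul_derived hT.br hd
  have hnc : ∀ {y z : L}, p • y = 0 → p • z = 0 →
      (∀ s t : ℤ, s • y + t • z ∈ derived B → (p : ℤ) ∣ s ∧ (p : ℤ) ∣ t) → B y z ≠ 0 :=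
    fun h1 h2 h3 => hT.br_ne_zero_of_four hc h1 h2 h3
  set T := (nsmulAddMonoidHom p : L →+ L).ker with hTdef
  set R := (nsmulAddMonoidHom p : L →+ L).range with hRdef
  have hTle : Nat.card T ≤ p ^ 4 := by
    by_contra! hlt
    obtain ⟨m, hm⟩ := hR.exists_card_eq_pow T
    rw [hm] at hlt
    have hm5 : 5 ≤ m := (Nat.pow_lt_pow_iff_right hR.prime.one_lt).mp hlt
    obtain ⟨e, heT, hei⟩ := exists_independent hR.prime hR.torsion hT.derived_le_torsion
      (fun y hy => by
        have : p • y = 0 := hy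
        rw [this]; exact AddSubgroup.zero_mem _) (k := 3) (by
      rw [hc, hm, ← pow_add]
      exact Nat.pow_le_pow_right hp hm5)
    obtain ⟨c, d, hcd, hcdi⟩ := hR.exists_commuting_pair
      (by rw [hc]; exact Nat.pow_lt_pow_right hR.prime.one_lt (by norm_num)) e
    refine hnc (y := ∑ i, c i • e i) (z := ∑ i, d i • e i)
      (AddSubgroup.sum_mem T fun i _ => AddSubgroup.zsmul_mem _ (heT i) _)
      (AddSubgroup.sum_mem T fun i _ => AddSubgroup.zsmul_mem _ (heT i) _) (fun s t h => ?_) hcd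
    refine hcdi s t (hei (fun i => s * c i + t * d i) ?_)
    convert h using 1
    simp only [add_smul, mul_smul, Finset.sum_add_distrib, Finset.smul_sum]
  have hDR : derived B ≤ R := by
    have h1 : R = frattini p B := by
      refine AddSubgroup.eq_of_le_of_card_ge le_sup_right ?_
      have h2 := hT.card_eq
      rw [card_eq_torsion_mul (p := p)] at h2
      refine le_of_mul_le_mul_left (a := p ^ 4) ?_ (pow_pos hp 4)
      rw [← h2]
      exact Nat.mul_le_mul_right _ hTle
    rw [h1]; exact le_sup_left
  obtain ⟨f, hfT, hfi⟩ := exists_independent hR.prime hR.torsion hT.derived_le_torsion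
    (fun y hy => by
      have : p • y = 0 := hy
      rw [this]; exact AddSubgroup.zero_mem _) (k := 2) (by
    rw [hc, ← pow_add]; exact hT.le_card_torsion)
  have hx : p • f 0 = 0 := hfT 0
  have hy : p • f 1 = 0 := hfT 1
  have hxy : ∀ s t : ℤ, s • f 0 + t • f 1 ∈ derived B → (p : ℤ) ∣ s ∧ (p : ℤ) ∣ t := by
    intro s t h
    have := hfi ![s, t] (by simpa [Fin.sum_univ_two] using h)
    exact ⟨this 0, this 1⟩
  have hw0 := hnc hx hy hxy
  have hwD := br_mem_derived B (f 0) (f 1)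
  have hns : ∀ {X u d₁ d₂ : L}, p • u = d₁ → p ^ a 0 • X = d₂ → d₁ ∈ derived B → d₂ ∈ derived B →
      (∀ s t : ℤ, s • d₁ + t • d₂ = 0 → (p : ℤ) ∣ s ∧ (p : ℤ) ∣ t) → ∀ s t : ℤ,
      B (s • f 0 + t • f 1) X ∈ AddSubgroup.zmultiples (B (f 0) (f 1)) →
      B (s • f 0 + t • f 1) u ∈ AddSubgroup.zmultiples (B (f 0) (f 1)) →
      (p : ℤ) ∣ s ∧ (p : ℤ) ∣ t := by
    intro X u d₁ d₂ hu hX hd₁ hd₂ hd s t h1 h2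
    have hcard : Nat.card L = p ^ (a 0 + 3) * Nat.card (derived B) := by
      rw [hT.basis.card_eq fun i => pow_pos hp _, Fin.prod_univ_four, hT.eq_one 1 (by decide),
        hT.eq_one 2 (by decide), hT.eq_one 3 (by decide)]
      ring
    have hb := relBasis_four hpD hx hy hxy hu hX hd₁ hd₂ hd hcard
    by_contra hst
    have hpk : p • (s • f 0 + t • f 1) = 0 := by
      rw [smul_add, smul_comm p s, smul_comm p t, hx, hy, smul_zero, smul_zero, add_zero]
    obtain ⟨i, hi⟩ := hR.exists_br_notMem hT.basis hT.le_a hpk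
      (fun h => hst (hxy s t (hT.soc _ h hpk))) (hT.br (f 0) (f 1))
    refine hi (hR.br_left_mem hb hR.derived_le_center (fun j => ?_) _)
    fin_cases j
    · refine AddSubgroup.mem_zmultiples_iff.mpr ⟨-t, ?_⟩
      simp [hR.alt, hR.skew (f 1) (f 0)]
    · refine AddSubgroup.mem_zmultiples_iff.mpr ⟨s, ?_⟩
      simp [hR.alt]
    · exact h1
    · exact h2
  have hcard : Nat.card L = p ^ (a 0 + 3) * Nat.card (derived B) := by
    rw [hT.basis.card_eq fun i => pow_pos hp _, Fin.prod_univ_four, hT.eq_one 1 (by decide),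
      hT.eq_one 2 (by decide), hT.eq_one 3 (by decide)]
    ring
  have hpow : ∀ {u u' : L}, p • u' = p • u → p ^ a 0 • u' = p ^ a 0 • u := by
    intro u u' h
    obtain ⟨A', hA'⟩ := Nat.exists_eq_add_of_le' hT.one_le
    rw [hA', pow_succ, mul_smul, mul_smul, h]
  have main : ∀ (u : L) (κ : ℤ), p ^ a 0 • u = κ • B (f 0) (f 1) → ¬ (p : ℤ) ∣ κ → False := by
    intro u κ hu hκ
    obtain ⟨e, heD, hew⟩ := exists_mem_notMem_of_card_lt (E := derived B)
      (F := AddSubgroup.zmultiples (B (f 0) (f 1)))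
      (lt_of_le_of_lt (hR.card_zmultiples_le (hT.br _ _)) (by
        rw [hc]; exact lt_self_pow₀ hR.prime.one_lt (by norm_num)))
    obtain ⟨v, hv⟩ := hDR heD
    have hv : p • v = e := hv
    have hd := hR.dvd_of_notMem_zmultiples (hpD e heD) hw0 hew
    obtain ⟨x', y', u', v', δ, g1, g2, g3, g4, g5, g6, g7, g8, g9, g10, g11⟩ :=
      hR.exists_dual_frame hT.br hc heD hx hy hd (u := u) (v := v)
      (hns hv hu heD (AddSubgroup.zsmul_mem _ hwD _) fun s t h => by
        rw [smul_smul] at h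
        obtain ⟨k1, k2⟩ := hd _ _ h
        exact ⟨k1, (hpp.dvd_mul.mp k2).resolve_right hκ⟩)
    refine hR.false_of_four_grading hT.br hc hT.one_le hcard g1 g2 g5 g6 g7 g8 g9 (κ := κ * δ)
      (by rw [hpow g3, hu, g10, smul_smul]) (fun h => ?_) (g4.trans hv)
    rcases hpp.dvd_mul.mp h with h | h
    exacts [hκ h, g11 h]
  by_cases ha1 : a 0 = 1
  · obtain ⟨u, hu⟩ := hDR hwD
    have hu : p • u = _ := hu
    exact main u 1 (by rw [ha1, pow_one, one_smul, hu]) hpp.not_dvd_one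
  have ha2 : 2 ≤ a 0 := by have := hT.one_le; omega
  have hl : p ^ a 0 • x 0 ∈ derived B := hT.basis.mem 0
  have hl0 : p ^ a 0 • x 0 ≠ 0 := by
    intro h
    obtain ⟨A, hA⟩ := Nat.exists_eq_add_of_le' ha2
    have h1 : p ^ (A + 1) • x 0 ∈ derived B := by
      refine hT.soc _ ?_ ?_
      · rw [pow_succ, mul_smul]
        exact AddSubgroup.nsmul_mem _ (hT.nsmul_mem_center _) _
      · rw [← mul_smul, ← pow_succ', ← h, hA]
    have h2 := (hT.basis.zsmul_mem_iff 0 (p ^ (A + 1) : ℕ)).mp (by rwa [natCast_zsmul])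
    have h3 := (Nat.pow_dvd_pow_iff_le_right hR.prime.one_lt).mp (Int.natCast_dvd_natCast.mp h2)
    omega
  by_cases hlw : p ^ a 0 • x 0 ∈ AddSubgroup.zmultiples (B (f 0) (f 1))
  · obtain ⟨κ, hκ⟩ := AddSubgroup.mem_zmultiples_iff.mp hlw
    refine main (x 0) κ hκ.symm ?_
    rintro ⟨n, rfl⟩
    rw [mul_comm, mul_smul, natCast_zsmul, hT.br, smul_zero] at hκ
    exact hl0 hκ.symm
  · obtain ⟨u, hu⟩ := hDR hwD
    have hu : p • u = _ := hu
    have hd := hR.dvd_of_notMem_zmultiples (hpD _ hl) hw0 hlw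
    obtain ⟨x', y', u', v', δ, g1, g2, g3, g4, g5, g6, g7, g8, g9, g10, g11⟩ :=
      hR.exists_dual_frame hT.br hc hl hx hy hd (u := u) (v := x 0)
      (fun s t h1 h2 => hns hu rfl hwD hl (fun s t h => by
        rw [add_comm] at h; exact (hd _ _ h).symm) s t h2 h1)
    exact hR.false_of_four_perturbation hT.br ha2 hcard g1 g2 g5 g6 g7 g8 g9
      (by rw [g3, hu, ← g10]) g11 (hpow g4)

end Thin

end

section

variable {L : Type*} [AddCommGroup L] {p : ℕ} {B : L →+ L →+ L}

/-- The three brackets of a triple are independent modulo `p`. -/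
def Ind (p : ℕ) (B : L →+ L →+ L) (x y z : L) : Prop :=
  ∀ r s t : ℤ, r • B y z + s • B z x + t • B x y = 0 → (p : ℤ) ∣ r ∧ (p : ℤ) ∣ s ∧ (p : ℤ) ∣ t

/-- An adapted generating triple whose brackets are independent. -/
structure Frame (p : ℕ) (B : L →+ L →+ L) (A : ℕ) (x y z : L) : Prop where
  ind : Ind p B x y z
  mem : p ^ A • x ∈ derived B
  mem_y : p • y ∈ derived B
  mem_z : p • z ∈ derived B
  order : ∀ s : ℤ, s • x ∈ derived B → (p ^ A : ℤ) ∣ s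

theorem zsmul_eq_zsmul {s t : ℤ} (h : (p : ℤ) ∣ s - t) {z : L} (hz : p • z = 0) :
    s • z = t • z := by
  obtain ⟨m, hm⟩ := h
  rw [← sub_eq_zero, ← sub_smul, hm, mul_comm, mul_smul, natCast_zsmul, hz, smul_zero]

theorem pow_nsmul_eq_zero {A : ℕ} (hA : 2 ≤ A) {D : AddSubgroup L} (hD : ∀ d ∈ D, p • d = 0)
    {y : L} (hy : p • y ∈ D) : p ^ A • y = 0 := by
  obtain ⟨A', rfl⟩ := Nat.exists_eq_add_of_le' hA
  rw [pow_add, pow_two, mul_smul, mul_smul, hD _ hy, smul_zero]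

theorem Ind.exists_eq [Finite L] {x y z : L} (h : Ind p B x y z)
    (hc : Nat.card (derived B) = p ^ 3) {d : L} (hd : d ∈ derived B) :
    ∃ r s t : ℤ, d = r • B y z + s • B z x + t • B x y := by
  obtain ⟨s, d', hd', rfl⟩ := exists_eq_sum_of_card (bot_le : ⊥ ≤ derived B)
    (x := ![B y z, B z x, B x y]) (q := fun _ => p)
    (by intro i; fin_cases i <;> exact br_mem_derived B _ _) (by
      intro s hs
      simp only [Fin.sum_univ_three, Matrix.cons_val_zero, Matrix.cons_val_one, Matrix.cons_val,
        AddSubgroup.mem_bot] at hs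
      obtain ⟨h1, h2, h3⟩ := h _ _ _ hs
      intro i; fin_cases i
      exacts [h1, h2, h3]) (by simp [hc]) hd
  rw [AddSubgroup.mem_bot] at hd'
  exact ⟨s 0, s 1, s 2, by simp [hd', Fin.sum_univ_three]⟩

namespace Rigid

variable (hR : Rigid p B)
include hR

theorem Ind.dvd_of_mem_center {x y z : L} (h : Ind p B x y z) {r s t : ℤ}
    (hc : r • x + s • y + t • z ∈ center B) : (p : ℤ) ∣ r ∧ (p : ℤ) ∣ s ∧ (p : ℤ) ∣ t := by
  have h1 := h 0 t (-s) (by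
    have := hc x
    simp only [map_add, map_zsmul, AddMonoidHom.add_apply, AddMonoidHom.zsmul_apply, hR.alt] at this
    rw [← this, hR.skew y x]
    module)
  have h2 := h t 0 (-r) (by
    have := congrArg (fun z => -z) (hc y)
    simp only [map_add, map_zsmul, AddMonoidHom.add_apply, AddMonoidHom.zsmul_apply, hR.alt,
      neg_zero] at this
    rw [← this, hR.skew z y]
    module)
  exact ⟨Int.dvd_neg.mp h2.2.2, Int.dvd_neg.mp h1.2.2, h1.2.1⟩

theorem Frame.relBasis [Finite L] {A : ℕ} {x y z : L} (hf : Frame p B A x y z)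
    (hc : Nat.card L = p ^ (A + 2) * Nat.card (derived B)) :
    RelBasis (derived B) ![x, y, z] ![p ^ A, p, p] := by
  refine RelBasis.of_dvd_of_card ?_ ?_ ?_
  · intro i; fin_cases i
    exacts [hf.mem, hf.mem_y, hf.mem_z]
  · intro s hs
    simp only [Fin.sum_univ_three, Matrix.cons_val_zero, Matrix.cons_val_one,
      Matrix.cons_val] at hs
    obtain ⟨-, h1, h2⟩ := Ind.dvd_of_mem_center hR hf.ind (hR.derived_le_center hs)
    have h3 : s 0 • x ∈ derived B := by
      have h4 : ∀ {y : L} {s : ℤ}, p • y ∈ derived B → (p : ℤ) ∣ s → s • y ∈ derived B := by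
        rintro y _ hy ⟨m, rfl⟩
        rw [mul_comm, mul_smul, natCast_zsmul]
        exact AddSubgroup.zsmul_mem _ hy _
      have := AddSubgroup.sub_mem _ (AddSubgroup.sub_mem _ hs (h4 hf.mem_z h2)) (h4 hf.mem_y h1)
      convert this using 1; abel
    intro i; fin_cases i
    · have := hf.order _ h3
      simpa using this
    · exact h1
    · exact h2
  · rw [hc, Fin.prod_univ_three]
    simp only [Matrix.cons_val_zero, Matrix.cons_val_one, Matrix.cons_val]
    exact le_of_eq (by ring)

/-- Changing a frame. -/
theorem Frame.change {A : ℕ} {x y z x' y' z' h : L} (hf : Frame p B A x y z)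
    (hi : Ind p B x' y' z') (hx : x' = x + h) (hh : p • h ∈ derived B)
    (hh' : p ^ A • h ∈ derived B) (hy : p • y' ∈ derived B) (hz : p • z' ∈ derived B) :
    Frame p B A x' y' z' := by
  refine ⟨hi, ?_, hy, hz, fun s hs => ?_⟩
  · rw [hx, smul_add]
    exact AddSubgroup.add_mem _ hf.mem hh'
  · obtain ⟨⟨m, hm⟩, -⟩ := Ind.dvd_of_mem_center hR hi (r := s) (s := 0) (t := 0) (by
      rw [zero_smul, zero_smul, add_zero, add_zero]; exact hR.derived_le_center hs)
    refine hf.order s ?_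
    rw [hx, smul_add] at hs
    refine (AddSubgroup.add_mem_cancel_right _ ?_).mp hs
    rw [hm, mul_comm, mul_smul, natCast_zsmul]
    exact AddSubgroup.zsmul_mem _ hh _

theorem false_of_three_grading [Finite L] (hbr : ∀ y z, p • B y z = 0) {u v w : L} {q : Fin 3 → ℕ}
    (hb : RelBasis (derived B) ![u, v, w] q) (hq : q 1 ≠ 1) (hi : Ind p B u v w)
    (hu : ∃ a : ℤ, q 0 • u = a • B v w) (hv : ∃ a b : ℤ, q 1 • v = a • B u v + b • B u w)
    (hw : ∃ a b : ℤ, q 2 • w = a • B u v + b • B u w) : False := by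
  have hmem : ∀ a b : ℤ, a • B u v + b • B u w ∈ adjoin ⊥ ![B u v, B u w] := fun a b =>
    ⟨![a, b], 0, AddSubgroup.zero_mem _, by simp [Fin.sum_univ_two]⟩
  refine hR.sign_grading hb ![true, false, false] (fun b => if b then
    AddSubgroup.zmultiples (B v w) else adjoin ⊥ ![B u v, B u w]) ?_ ?_ ?_ ?_ (i := 1) rfl hq
  · intro b; cases b
    · refine adjoin_le bot_le fun i => ?_
      fin_cases i <;> exact br_mem_derived B _ _
    · simpa using br_mem_derived B v w
  · simp only [if_true, Bool.false_eq_true, if_false]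
    rw [AddSubgroup.disjoint_def]
    rintro _ ⟨s, rfl⟩ ⟨c, d, hd, h⟩
    rw [AddSubgroup.mem_bot] at hd
    simp only [Fin.sum_univ_two, Matrix.cons_val_zero, Matrix.cons_val_one, hd, add_zero] at h
    obtain ⟨⟨m, hm⟩, -⟩ := hi s (c 1) (-c 0) (by rw [h, hR.skew w u]; module)
    simp only [hm]
    rw [mul_comm, mul_smul, natCast_zsmul, hbr, smul_zero]
  · obtain ⟨a, hu⟩ := hu
    obtain ⟨b, c, hv⟩ := hv
    obtain ⟨d, e, hw⟩ := hw
    intro i; fin_cases i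
    · simp [hu, AddSubgroup.zsmul_mem]
    · simpa [hv] using hmem b c
    · simpa [hw] using hmem d e
  · have h1 : B u v ∈ adjoin ⊥ ![B u v, B u w] := by simpa using hmem 1 0
    have h2 : B u w ∈ adjoin ⊥ ![B u v, B u w] := by simpa using hmem 0 1
    intro i j; fin_cases i <;> fin_cases j <;>
      simp [hR.alt, h1, h2, hR.skew v u, hR.skew w u, hR.skew w v]

/-- A deformation of a triple with independent brackets that respects the power relations is
trivial modulo the centre. -/
theorem sub_mem_center_of_three [Finite L] (hbr : ∀ y z, p • B y z = 0) {x y z x' y' z' : L}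
    {q : Fin 3 → ℕ} (hb : RelBasis (derived B) ![x, y, z] q) (hi : Ind p B x y z)
    (b : Fin 3 → Fin 3 → ℤ)
    (h : ∀ i, q i • ![x, y, z] i = b i 0 • B y z + b i 1 • B z x + b i 2 • B x y)
    (h' : ∀ i, q i • ![x', y', z'] i = b i 0 • B y' z' + b i 1 • B z' x' + b i 2 • B x' y')
    (hs : ∀ i, ∃ c : Fin 3 → ℤ, ![x, y, z] i - ∑ j, c j • ![x', y', z'] j ∈ derived B) (i : Fin 3) :
    ![x', y', z'] i - ![x, y, z] i ∈ center B := by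
  have hbD : RelBasis (⊥ : AddSubgroup (derived B))
      ![⟨B y z, br_mem_derived B _ _⟩, ⟨B z x, br_mem_derived B _ _⟩,
        ⟨B x y, br_mem_derived B _ _⟩] (fun _ => p) := by
    refine ⟨?_, ?_, ?_⟩
    · intro i; fin_cases i <;>
      · simp only [AddSubgroup.mem_bot]
        exact Subtype.ext (hbr _ _)
    · intro s hs
      rw [AddSubgroup.mem_bot] at hs
      have hs := congrArg Subtype.val hs
      simp only [Fin.sum_univ_three, Matrix.cons_val_zero, Matrix.cons_val_one, Matrix.cons_val,
        AddSubgroup.coe_add, AddSubgroup.coe_zsmul, AddSubgroup.coe_zero] at hs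
      obtain ⟨h1, h2, h3⟩ := hi _ _ _ hs
      intro i; fin_cases i
      exacts [h1, h2, h3]
    · have hle : derived B ≤ adjoin ⊥ ![B y z, B z x, B x y] := by
        have h1 : B y z ∈ adjoin ⊥ ![B y z, B z x, B x y] := self_mem_adjoin 0
        have h2 : B z x ∈ adjoin ⊥ ![B y z, B z x, B x y] := self_mem_adjoin 1
        have h3 : B x y ∈ adjoin ⊥ ![B y z, B z x, B x y] := self_mem_adjoin 2
        rw [derived, AddSubgroup.closure_le]
        rintro _ ⟨u, v, rfl⟩
        refine hR.br_mem hb hR.derived_le_center (fun i j => ?_) u v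
        fin_cases i <;> fin_cases j <;>
          simp [hR.alt, h1, h2, h3, hR.skew y x, hR.skew x z, hR.skew z y]
      rintro ⟨d, hd⟩
      obtain ⟨c, d', hd', hdc⟩ := hle hd
      rw [AddSubgroup.mem_bot] at hd'
      refine ⟨c, 0, AddSubgroup.zero_mem _, Subtype.ext ?_⟩
      simp only [Fin.sum_univ_three, Matrix.cons_val_zero, Matrix.cons_val_one, Matrix.cons_val,
        hd', add_zero] at hdc
      simp only [Fin.sum_univ_three, Matrix.cons_val_zero, Matrix.cons_val_one, Matrix.cons_val,
        AddSubgroup.coe_add, AddSubgroup.coe_zsmul, add_zero, hdc]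
  obtain ⟨f, hf, -⟩ := hbD.exists_hom ![B y' z', B z' x', B x' y'] (by
    intro i; fin_cases i <;> exact hbr _ _)
  have f0 : f ⟨B y z, br_mem_derived B _ _⟩ = B y' z' := hf 0
  have f1 : f ⟨B z x, br_mem_derived B _ _⟩ = B z' x' := hf 1
  have f2 : f ⟨B x y, br_mem_derived B _ _⟩ = B x' y' := hf 2
  refine hR.sub_mem_center_of_extension hb f ?_ ?_ hs i
  · intro i
    rw [h', ← f0, ← f1, ← f2, ← map_zsmul, ← map_zsmul, ← map_zsmul, ← map_add, ← map_add]
    exact congrArg f (Subtype.ext (h i).symm)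
  · intro i j hij
    fin_cases i <;> fin_cases j <;> first
      | exact absurd hij (by decide)
      | exact f0
      | exact f2
      | skip
    have : (⟨B x z, br_mem_derived B _ _⟩ : derived B) = -⟨B z x, br_mem_derived B _ _⟩ :=
      Subtype.ext (hR.skew x z)
    change f ⟨B x z, _⟩ = B x' z'
    rw [this, map_neg, f1, hR.skew x' z']

end Rigid

end

section

variable {L : Type*} [AddCommGroup L] {p : ℕ} {B : L →+ L →+ L}

namespace Rigid

variable (hR : Rigid p B)
include hR

theorem exists_dvd_mul_sub {b : ℤ} (hb : ¬(p : ℤ) ∣ b) (c : ℤ) :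
    ∃ t : ℤ, (p : ℤ) ∣ b * t - c := by
  obtain ⟨t, k, h⟩ := hR.exists_mul_eq_one_add hb
  exact ⟨t * c, k * c, by linear_combination c * h⟩

theorem Ind.swap {x y z : L} (h : Ind p B x y z) : Ind p B x z (-y) := by
  intro r s t hrst
  simp only [map_neg, AddMonoidHom.neg_apply] at hrst
  obtain ⟨h1, h2, h3⟩ := h r (-t) s (by
    linear_combination (norm := module) hrst + r • hR.skew y z - t • hR.skew z x + s • hR.skew y x)
  exact ⟨h1, h3, Int.dvd_neg.mp h2⟩

omit hR in
theorem Ind.rotate {x y z : L} (h : Ind p B x y z) : Ind p B y z x := by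
  intro r s t hrst
  obtain ⟨h1, h2, h3⟩ := h t r s (by rw [← hrst]; abel)
  exact ⟨h2, h3, h1⟩

theorem Ind.shear {x y z : L} (h : Ind p B x y z) (a b : ℤ) :
    Ind p B (x + a • y + b • z) y z := by
  intro r s t hrst
  simp only [map_add, map_zsmul, AddMonoidHom.add_apply, AddMonoidHom.zsmul_apply, hR.alt] at hrst
  obtain ⟨h1, h2, h3⟩ := h (r - s * a - t * b) s t (by
    linear_combination (norm := module) hrst - (s * a + t * b) • hR.skew z y)
  refine ⟨?_, h2, h3⟩
  have := dvd_add (dvd_add h1 (h2.mul_right a)) (h3.mul_right b)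
  convert! this using 1
  ring

theorem not_dvd_two_mul {b : ℤ} (hb : ¬(p : ℤ) ∣ b) : ¬(p : ℤ) ∣ 2 * b := fun h => by
  rcases (Nat.prime_iff_prime_int.mp hR.prime).dvd_or_dvd h with h | h
  · have := Nat.le_of_dvd two_pos (Int.natCast_dvd_natCast.mp h)
    have h2 := hR.prime.two_le
    have h3 := hR.odd
    interval_cases p
    exact absurd h3 (by decide)
  · exact hb h

theorem false_of_cross_zero [Finite L] (hbr : ∀ y z, p • B y z = 0) {x y z : L}
    (hi : Ind p B x y z) (hb : RelBasis (derived B) ![x, y, z] ![p, p, p])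
    {b c₂ c₃ d₂ d₃ : ℤ} (hb₂ : ¬(p : ℤ) ∣ b) (hx : p • x = b • B z x)
    (hy : p • y = b • B y z + c₂ • B z x + c₃ • B x y)
    (hz : p • z = d₂ • B z x + d₃ • B x y) : False := by
  obtain ⟨ξ, hξ⟩ := hR.exists_dvd_mul_sub hb₂ (-d₃)
  obtain ⟨η, hη⟩ := hR.exists_dvd_mul_sub (hR.not_dvd_two_mul hb₂) (b * ξ - c₃ - d₂)
  have hξX := zsmul_eq_zsmul hξ (hbr z x)
  have hξZ := zsmul_eq_zsmul hξ (hbr x y)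
  have hηX := zsmul_eq_zsmul hη (hbr z x)
  have key := hR.sub_mem_center_of_three hbr hb hi (x' := x) (y' := y + z + η • x)
    (z' := z + ξ • x) ![![0, b, 0], ![b, c₂, c₃], ![0, d₂, d₃]] ?_ ?_ ?_ 1
  · simp only [Matrix.cons_val_one, Matrix.cons_val_zero] at key
    obtain ⟨-, -, h⟩ := Ind.dvd_of_mem_center hR hi (r := η) (s := 0) (t := 1) (by
      convert key using 1; module)
    exact hR.prime.one_lt.ne' (by simpa [Int.natCast_dvd_ofNat] using h)
  · intro i
    fin_cases i
    · simpa using hx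
    · simpa using hy
    · simpa using hz
  · intro i
    fin_cases i
    · simp [hR.alt]
      exact hx
    · simp [hR.alt, hR.skew y x, hR.skew x z]
      linear_combination (norm := module) hy + hz + η • hx + hηX + hξZ
    · simp [hR.alt, hR.skew y x, hR.skew x z]
      linear_combination (norm := module) hz + ξ • hx + hξX
  · intro i
    fin_cases i
    · exact ⟨![1, 0, 0], by simp [Fin.sum_univ_three]⟩
    · exact ⟨![ξ - η, 1, -1], by
        convert AddSubgroup.zero_mem (derived B) using 1; simp [Fin.sum_univ_three]; module⟩
    · exact ⟨![-ξ, 0, 1], by simp [Fin.sum_univ_three]⟩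

theorem Ind.relBasis [Finite L] (hpD : ∀ y : L, p • y ∈ derived B)
    (hL : Nat.card L = p ^ 3 * Nat.card (derived B)) {x y z : L} (hi : Ind p B x y z) :
    RelBasis (derived B) ![x, y, z] ![p, p, p] := by
  have hf : Frame p B 1 x y z := ⟨hi, by simpa using hpD x, hpD y, hpD z, fun s hs => by
    simpa using (Ind.dvd_of_mem_center hR hi (r := s) (s := 0) (t := 0)
      (by simpa using hR.derived_le_center hs)).1⟩
  simpa using Frame.relBasis hR hf hL

theorem false_of_cross [Finite L] (hbr : ∀ y z, p • B y z = 0) (hpD : ∀ y : L, p • y ∈ derived B)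
    (hL : Nat.card L = p ^ 3 * Nat.card (derived B)) {x y z : L}
    (hi : Ind p B x y z) {b₂ b₃ c₂ c₃ d₂ d₃ : ℤ} (hb₂ : ¬(p : ℤ) ∣ b₂)
    (hx : p • x = b₂ • B z x + b₃ • B x y)
    (hy : p • y = b₂ • B y z + c₂ • B z x + c₃ • B x y)
    (hz : p • z = b₃ • B y z + d₂ • B z x + d₃ • B x y) : False := by
  obtain ⟨c, hc⟩ := hR.exists_dvd_mul_sub hb₂ b₃
  have hcX := zsmul_eq_zsmul hc (hbr y z)
  have hcZ := zsmul_eq_zsmul hc (hbr x y)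
  have hi' : Ind p B x y (z - c • y) := by
    intro r s t h
    simp only [map_sub, map_zsmul, AddMonoidHom.sub_apply, AddMonoidHom.zsmul_apply, hR.alt] at h
    obtain ⟨h1, h2, h3⟩ := hi r s (t + c * s) (by
      linear_combination (norm := module) h + (s * c) • hR.skew y x)
    refine ⟨h1, h2, (dvd_add_left (h2.mul_left c)).mp h3⟩
  refine hR.false_of_cross_zero hbr hi' (Ind.relBasis hR hpD hL hi') (b := b₂) (c₂ := c₂)
    (c₃ := c₃ - c * c₂) (d₂ := d₂ - c * c₂) (d₃ := d₃ - c * c₃ - c * (d₂ - c * c₂)) hb₂ ?_ ?_ ?_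
  · simp [hR.skew y x]
    linear_combination (norm := module) hx - hcZ
  · simp [hR.alt, hR.skew y x]
    linear_combination (norm := module) hy
  · simp [hR.skew y x]
    linear_combination (norm := module) hz - c • hy - hcX

theorem false_of_symmetric [Finite L] (hbr : ∀ y z, p • B y z = 0)
    (hpD : ∀ y : L, p • y ∈ derived B) (hL : Nat.card L = p ^ 3 * Nat.card (derived B)) {x y z : L}
    (hi : Ind p B x y z) {b₁ b₂ b₃ c₂ c₃ d₂ d₃ : ℤ}
    (hx : p • x = b₁ • B y z + b₂ • B z x + b₃ • B x y)
    (hy : p • y = b₂ • B y z + c₂ • B z x + c₃ • B x y)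
    (hz : p • z = b₃ • B y z + d₂ • B z x + d₃ • B x y) : False := by
  by_cases hb₁ : (p : ℤ) ∣ b₁
  · have hbX : b₁ • B y z = (0 : ℤ) • B y z := zsmul_eq_zsmul (by simpa using hb₁) (hbr y z)
    rw [hbX, zero_smul, zero_add] at hx
    by_cases hb₂ : (p : ℤ) ∣ b₂
    · by_cases hb₃ : (p : ℤ) ∣ b₃
      · have e : ∀ u v : L, b₂ • B u v = 0 ∧ b₃ • B u v = 0 := fun u v => by
          constructor
          · simpa using zsmul_eq_zsmul (t := 0) (by simpa using hb₂) (hbr u v)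
          · simpa using zsmul_eq_zsmul (t := 0) (by simpa using hb₃) (hbr u v)
        simp only [e, zero_add] at hx hy hz
        have key := hR.sub_mem_center_of_three hbr (Ind.relBasis hR hpD hL hi) hi (x' := x)
          (y' := y + x) (z' := z) ![![0, 0, 0], ![0, c₂, c₃], ![0, d₂, d₃]] ?_ ?_ ?_ 1
        · obtain ⟨h, -⟩ := Ind.dvd_of_mem_center hR hi (r := 1) (s := 0) (t := 0) (by
            convert key using 1; simp)
          exact hR.prime.one_lt.ne' (by simpa [Int.natCast_dvd_ofNat] using h)
        · intro i
          fin_cases i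
          · simpa using hx
          · simpa using hy
          · simpa using hz
        · intro i
          fin_cases i
          · simpa using hx
          · simpa [hR.alt, hx] using hy
          · simpa [hR.alt] using hz
        · intro i
          fin_cases i
          · exact ⟨![1, 0, 0], by simp [Fin.sum_univ_three]⟩
          · exact ⟨![-1, 1, 0], by simp [Fin.sum_univ_three]⟩
          · exact ⟨![0, 0, 1], by simp [Fin.sum_univ_three]⟩
      · refine hR.false_of_cross hbr hpD hL (Ind.swap hR hi) (b₂ := b₃) (b₃ := -b₂) (c₂ := d₃)
          (c₃ := -d₂) (d₂ := -c₃) (d₃ := c₂) hb₃ ?_ ?_ ?_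
        · simp [hR.skew y x, hR.skew x z]
          linear_combination (norm := module) hx
        · simp [hR.skew y x, hR.skew x z, hR.skew z y]
          linear_combination (norm := module) hz
        · simp [hR.skew y x, hR.skew x z, hR.skew z y]
          linear_combination (norm := module) -hy
    · exact hR.false_of_cross hbr hpD hL hi hb₂ hx hy hz
  · obtain ⟨c, hc⟩ := hR.exists_dvd_mul_sub hb₁ b₂
    obtain ⟨d, hd⟩ := hR.exists_dvd_mul_sub hb₁ b₃
    have hi' : Ind p B x (y - c • x) (z - d • x) := by
      intro r s t h
      simp [hR.alt, hR.skew y x, hR.skew x z] at h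
      obtain ⟨h1, h2, h3⟩ := hi r (s + r * c) (t + r * d) (by
        linear_combination (norm := module) h)
      exact ⟨h1, (dvd_add_left (h1.mul_right c)).mp h2, (dvd_add_left (h1.mul_right d)).mp h3⟩
    refine hR.false_of_three_grading hbr (Ind.relBasis hR hpD hL hi') hR.prime.one_lt.ne' hi'
      ⟨b₁, ?_⟩ ⟨c₃ - c * b₃, -(c₂ - c * b₂), ?_⟩ ⟨d₃ - d * b₃, -(d₂ - d * b₂), ?_⟩
    · simp [hR.alt, hR.skew y x, hR.skew x z]
      linear_combination (norm := module) hx - zsmul_eq_zsmul hc (hbr z x)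
        - zsmul_eq_zsmul hd (hbr x y)
    · simp [hR.alt, hR.skew x z]
      linear_combination (norm := module) hy - c • hx - zsmul_eq_zsmul hc (hbr y z)
    · simp [hR.alt, hR.skew x z]
      linear_combination (norm := module) hz - d • hx - zsmul_eq_zsmul hd (hbr y z)

theorem false_of_antisymmetric_ne [Finite L] (hbr : ∀ y z, p • B y z = 0)
    (hpD : ∀ y : L, p • y ∈ derived B) (hL : Nat.card L = p ^ 3 * Nat.card (derived B)) {x y z : L}
    (hi : Ind p B x y z) {b₁ b₂ b₃ c₁ c₂ c₃ d₁ d₂ d₃ : ℤ} (h : ¬(p : ℤ) ∣ c₃ - d₂)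
    (hx : p • x = b₁ • B y z + b₂ • B z x + b₃ • B x y)
    (hy : p • y = c₁ • B y z + c₂ • B z x + c₃ • B x y)
    (hz : p • z = d₁ • B y z + d₂ • B z x + d₃ • B x y) : False := by
  obtain ⟨f, hf⟩ := hR.exists_dvd_mul_sub h (b₂ - c₁)
  obtain ⟨e, he⟩ := hR.exists_dvd_mul_sub h (d₁ - b₃)
  refine hR.false_of_symmetric hbr hpD hL (Ind.shear hR hi e f)
    (b₁ := b₁ + e * c₁ + f * d₁ + e * (b₂ + e * c₂ + f * d₂) + f * (b₃ + e * c₃ + f * d₃))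
    (b₂ := b₂ + e * c₂ + f * d₂) (b₃ := b₃ + e * c₃ + f * d₃) (c₂ := c₂) (c₃ := c₃) (d₂ := d₂)
    (d₃ := d₃) ?_ ?_ ?_
  · simp [hR.alt, hR.skew z y]
    linear_combination (norm := module) hx + e • hy + f • hz
  · simp [hR.alt, hR.skew z y]
    linear_combination (norm := module) hy + zsmul_eq_zsmul hf (hbr y z)
  · simp [hR.alt, hR.skew z y]
    linear_combination (norm := module) hz - zsmul_eq_zsmul he (hbr y z)

theorem false_of_card_eq_cube [Finite L] (hbr : ∀ y z, p • B y z = 0)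
    (hpD : ∀ y : L, p • y ∈ derived B) (hL : Nat.card L = p ^ 3 * Nat.card (derived B))
    (hD : Nat.card (derived B) = p ^ 3) {x y z : L} (hi : Ind p B x y z) : False := by
  obtain ⟨b₁, b₂, b₃, hx⟩ := hi.exists_eq hD (hpD x)
  obtain ⟨c₁, c₂, c₃, hy⟩ := hi.exists_eq hD (hpD y)
  obtain ⟨d₁, d₂, d₃, hz⟩ := hi.exists_eq hD (hpD z)
  by_cases h1 : (p : ℤ) ∣ c₃ - d₂
  · by_cases h2 : (p : ℤ) ∣ d₁ - b₃
    · by_cases h3 : (p : ℤ) ∣ b₂ - c₁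
      · rw [← zsmul_eq_zsmul h3 (hbr y z)] at hy
        rw [zsmul_eq_zsmul h2 (hbr y z)] at hz
        exact hR.false_of_symmetric hbr hpD hL hi hx hy hz
      · exact hR.false_of_antisymmetric_ne hbr hpD hL (Ind.rotate (Ind.rotate hi)) (b₁ := d₃)
          (b₂ := d₁) (b₃ := d₂) (c₁ := b₃) (c₂ := b₁) (c₃ := b₂) (d₁ := c₃) (d₂ := c₁) (d₃ := c₂) h3
          (by rw [hz]; abel) (by rw [hx]; abel) (by rw [hy]; abel)
    · exact hR.false_of_antisymmetric_ne hbr hpD hL (Ind.rotate hi) (b₁ := c₂)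
        (b₂ := c₃) (b₃ := c₁) (c₁ := d₂) (c₂ := d₃) (c₃ := d₁) (d₁ := b₂) (d₂ := b₃) (d₃ := b₁) h2
        (by rw [hy]; abel) (by rw [hz]; abel) (by rw [hx]; abel)
  · exact hR.false_of_antisymmetric_ne hbr hpD hL hi h1 hx hy hz

end Rigid

end

section

variable {L : Type*} [AddCommGroup L] {p : ℕ} {B : L →+ L →+ L}

theorem dvd_of_card_eq [Finite L] (hp : 0 < p) {κ : Type*} [Fintype κ] {S : AddSubgroup L}
    (hpS : ∀ y ∈ S, p • y = 0) {e : κ → L} (he : ∀ i, e i ∈ S) (hS : S ≤ adjoin ⊥ e)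
    (hc : Nat.card S = p ^ Fintype.card κ) {s : κ → ℤ} (hs : ∑ i, s i • e i = 0) (i : κ) :
    (p : ℤ) ∣ s i := by
  let F : (κ → Fin p) → S := fun s => ⟨∑ i, ((s i : ℕ) : ℤ) • e i,
    S.sum_mem fun i _ => S.zsmul_mem (he i) _⟩
  have hp' : (0 : ℤ) < p := by exact_mod_cast hp
  let red : (κ → ℤ) → κ → Fin p := fun s i => ⟨(s i % p).toNat, by
    have := Int.emod_lt_of_pos (s i) hp'
    have := Int.emod_nonneg (s i) hp'.ne'
    omega⟩
  have hred : ∀ s i, (((red s i : Fin p) : ℕ) : ℤ) = s i % p := fun s i =>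
    Int.toNat_of_nonneg (Int.emod_nonneg (s i) hp'.ne')
  have hF : ∀ s, (F (red s) : L) = ∑ i, s i • e i := fun s => by
    refine Finset.sum_congr rfl fun i _ => ?_
    rw [hred]
    refine zsmul_eq_zsmul ?_ (hpS _ (he i))
    exact ⟨-(s i / p), by rw [Int.emod_def]; ring⟩
  have hsurj : Function.Surjective F := by
    rintro ⟨y, hy⟩
    obtain ⟨c, d, hd, rfl⟩ := hS hy
    rw [AddSubgroup.mem_bot] at hd
    exact ⟨red c, Subtype.ext (by rw [hF]; simp [hd])⟩
  have hinj : Function.Injective F :=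
    ((Nat.bijective_iff_surjective_and_card F).mpr ⟨hsurj, by
      rw [hc, Nat.card_fun, Nat.card_eq_fintype_card, Nat.card_eq_fintype_card, Fintype.card_fin]⟩).1
  have h := congrFun (hinj (show F (red s) = F (red 0) from
    Subtype.ext (by rw [hF, hF, hs]; simp))) i
  have h2 := congrArg (fun k : Fin p => ((k : ℕ) : ℤ)) h
  simp only [hred, Pi.zero_apply, Int.zero_emod] at h2
  exact Int.dvd_of_emod_eq_zero h2

namespace Rigid

variable (hR : Rigid p B)
include hR

theorem false_of_frame_reduced [Finite L] (hbr : ∀ y z, p • B y z = 0) {A : ℕ} (hA : 2 ≤ A)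
    (hL : Nat.card L = p ^ (A + 2) * Nat.card (derived B)) {x y z : L} (hf : Frame p B A x y z)
    {α β γ δ : ℤ} (hx : p ^ A • x = B x y) (hy : p • y = α • B y z + β • B z x)
    (hz : p • z = γ • B y z + δ • B z x) : False := by
  have hpp : ∀ u : L, p • u ∈ center B := fun u => nsmul_mem_center hbr u
  have hdp : ∀ d ∈ derived B, p • d = 0 := fun d hd => nsmul_derived hbr hd
  have hpy : p ^ A • y = 0 := pow_nsmul_eq_zero hA hdp hf.mem_y
  obtain ⟨A, rfl⟩ := Nat.exists_eq_add_of_le' hA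
  obtain ⟨w, hw⟩ : ∃ w, p ^ (A + 1) • x = w := ⟨_, rfl⟩
  have hwZ : w ∈ center B := by
    rw [← hw, pow_succ', mul_smul]
    exact hpp _
  have hwB : ∀ u, B u w = 0 := fun u => hR.br_right_eq_zero hwZ
  have hwB' : ∀ u, B w u = 0 := hwZ
  have hpw : p • w = B x y := by rw [← hw, ← mul_smul, ← pow_succ', hx]
  by_cases hβ : (p : ℤ) ∣ β
  · have hβY := zsmul_eq_zsmul (t := 0) (by simpa using hβ) (hbr z x)
    have hb := Frame.relBasis hR hf hL
    have key : ∀ θ μ : ℤ, (p : ℤ) ∣ μ * α + δ * θ → (p : ℤ) ∣ θ ∧ (p : ℤ) ∣ μ := by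
      intro θ μ h
      have h1 := zsmul_eq_zsmul (t := 0) (by simpa using h) (hbr y z)
      have key := hR.sub_mem_center_of_three hbr hb hf.ind (x' := x + θ • y)
        (y' := y) (z' := z + μ • y - (δ * μ) • w) ![![0, 0, 1], ![α, 0, 0], ![γ, δ, 0]] ?_ ?_ ?_
      · have h2 := key 0
        have h3 := key 2
        simp only [Matrix.cons_val] at h2 h3
        constructor
        · obtain ⟨-, h, -⟩ := Ind.dvd_of_mem_center hR hf.ind (r := 0) (s := θ) (t := 0) (by
            convert h2 using 1; module)
          exact h
        · obtain ⟨-, h, -⟩ := Ind.dvd_of_mem_center hR hf.ind (r := 0) (s := μ) (t := 0) (by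
            convert AddSubgroup.add_mem _ h3 (AddSubgroup.zsmul_mem _ hwZ (δ * μ)) using 1; module)
          exact h
      · intro i
        fin_cases i
        · simpa using hx
        · simp
          linear_combination (norm := module) hy + hβY
        · simpa using hz
      · intro i
        fin_cases i
        · simp [hR.alt, hpy, smul_comm _ θ y]
          linear_combination (norm := module) hx
        · simp [hR.alt, hR.skew y x, hR.skew z y, hwB, hwB']
          linear_combination (norm := module) hy + hβY
        · simp [hR.alt, hR.skew y x, hR.skew z y, hwB, hwB']
          linear_combination (norm := module) hz + μ • hy + μ • hβY - (δ * μ) • hpw + h1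
      · intro i
        fin_cases i
        · exact ⟨![1, -θ, 0], by simp [Fin.sum_univ_three]⟩
        · exact ⟨![0, 1, 0], by simp [Fin.sum_univ_three]⟩
        · refine ⟨![δ * μ * p ^ (A + 1), -μ - δ * μ * p ^ (A + 1) * θ, 1], ?_⟩
          convert AddSubgroup.zero_mem (derived B) using 1
          simp [Fin.sum_univ_three]
          linear_combination (norm := (push_cast; module)) -(δ * μ) • hw
    obtain ⟨h1, h2⟩ := key α (-δ) ⟨0, by ring⟩
    obtain ⟨h3, -⟩ := key 1 0 (by simpa using h2)
    exact hR.prime.one_lt.ne' (by simpa [Int.natCast_dvd_ofNat] using h3)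
  · obtain ⟨θ, hθ⟩ := hR.exists_dvd_mul_sub hβ (-α)
    obtain ⟨μ, hμ⟩ := hR.exists_dvd_mul_sub hβ (-δ)
    have hX := zsmul_eq_zsmul hθ (hbr y z)
    have hY := zsmul_eq_zsmul hμ (hbr z x)
    have hi : Ind p B (x + θ • y) (y - (β * μ) • w) (z + μ • y) := by
      intro r s t h
      simp [hR.alt, hR.skew y x, hR.skew z y, hwB, hwB'] at h
      obtain ⟨h1, h2, h3⟩ := hf.ind (r - s * θ) s (t - s * μ) (by
        linear_combination (norm := module) h)
      exact ⟨(dvd_sub_left (h2.mul_right θ)).mp h1, h2, (dvd_sub_left (h2.mul_right μ)).mp h3⟩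
    have hf' := Frame.change hR hf hi rfl
      (by rw [smul_comm]; exact AddSubgroup.zsmul_mem _ hf.mem_y _)
      (by rw [smul_comm, hpy, smul_zero]; exact AddSubgroup.zero_mem _)
      (by rw [smul_sub, smul_comm p, hpw]
          exact AddSubgroup.sub_mem _ hf.mem_y (AddSubgroup.zsmul_mem _ (br_mem_derived B _ _) _))
      (by rw [smul_add, smul_comm]
          exact AddSubgroup.add_mem _ hf.mem_z (AddSubgroup.zsmul_mem _ hf.mem_y _))
    have hb := (Frame.relBasis hR hf' hL).reindex (Equiv.swap 0 1)
    have hb' : RelBasis (derived B) ![y - (β * μ) • w, x + θ • y, z + μ • y]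
        ![p, p ^ (A + 2), p] := by
      convert hb using 1 <;>
      · funext i; fin_cases i <;> rfl
    refine hR.false_of_three_grading hbr hb' (by
      exact (Nat.one_lt_pow (by omega) hR.prime.one_lt).ne') ?_ ⟨-β, ?_⟩
      ⟨-1, 0, ?_⟩ ⟨0, γ + μ * α, ?_⟩
    · intro r s t h
      obtain ⟨h1, h2, h3⟩ := hi (-s) (-r) (-t) (by
        rw [hR.skew (x + θ • y) (z + μ • y), hR.skew (z + μ • y) (y - _),
          hR.skew (y - _) (x + θ • y)] at h
        linear_combination (norm := module) h)
      exact ⟨Int.dvd_neg.mp h2, Int.dvd_neg.mp h1, Int.dvd_neg.mp h3⟩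
    · simp [hR.alt, hR.skew x z]
      linear_combination (norm := module) hy - (β * μ) • hpw + hX
    · simp [hR.alt, hR.skew y x, hwB']
      linear_combination (norm := module) hx + θ • hpy
    · simp [hR.alt, hR.skew y x, hwB']
      linear_combination (norm := module) hz + μ • hy + hY

theorem Ind.congr {x y z y' z' : L} (hi : Ind p B x y z) (hy : y' - y ∈ center B)
    (hz : z' - z ∈ center B) : Ind p B x y' z' := by
  obtain ⟨u, hu, rfl⟩ : ∃ u ∈ center B, y' = y + u := ⟨_, hy, by abel⟩
  obtain ⟨v, hv, rfl⟩ : ∃ v ∈ center B, z' = z + v := ⟨_, hz, by abel⟩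
  intro r s t h
  simp only [map_add, AddMonoidHom.add_apply, hR.br_right_eq_zero hu, hR.br_right_eq_zero hv,
    show ∀ a, B u a = 0 from hu, show ∀ a, B v a = 0 from hv, add_zero] at h
  exact hi r s t h

theorem false_of_frame_normal [Finite L] (hbr : ∀ y z, p • B y z = 0) {A : ℕ} (hA : 2 ≤ A)
    (hL : Nat.card L = p ^ (A + 2) * Nat.card (derived B)) (hD : Nat.card (derived B) = p ^ 3)
    {x y z : L} (hf : Frame p B A x y z) (hx : p ^ A • x = B x y) : False := by
  obtain ⟨c₁, c₂, c₃, hy⟩ := hf.ind.exists_eq hD hf.mem_y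
  obtain ⟨d₁, d₂, d₃, hz⟩ := hf.ind.exists_eq hD hf.mem_z
  obtain ⟨A', rfl⟩ := Nat.exists_eq_add_of_le' hA
  obtain ⟨w, hw⟩ : ∃ w, p ^ (A' + 1) • x = w := ⟨_, rfl⟩
  have hwZ : w ∈ center B := by
    rw [← hw, pow_succ', mul_smul]
    exact nsmul_mem_center hbr _
  have hwB : ∀ u, B u w = 0 := fun u => hR.br_right_eq_zero hwZ
  have hwB' : ∀ u, B w u = 0 := hwZ
  have hpw : p • w = B x y := by rw [← hw, ← mul_smul, ← pow_succ', hx]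
  have hcZ : ∀ c : ℤ, c • w ∈ center B := fun c => AddSubgroup.zsmul_mem _ hwZ c
  have hpD : ∀ c : ℤ, p • c • w ∈ derived B := fun c => by
    rw [smul_comm, hpw]; exact AddSubgroup.zsmul_mem _ (br_mem_derived B _ _) _
  have hi : Ind p B x (y - c₃ • w) (z - d₃ • w) :=
    Ind.congr hR hf.ind (by simpa using hcZ c₃) (by simpa using hcZ d₃)
  have hf' : Frame p B (A' + 2) x (y - c₃ • w) (z - d₃ • w) :=
    ⟨hi, hf.mem, by rw [smul_sub]; exact AddSubgroup.sub_mem _ hf.mem_y (hpD _),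
      by rw [smul_sub]; exact AddSubgroup.sub_mem _ hf.mem_z (hpD _), hf.order⟩
  refine hR.false_of_frame_reduced hbr hA hL hf' (α := c₁) (β := c₂) (γ := d₁) (δ := d₂) ?_ ?_ ?_
  · simpa [hwB] using hx
  · simp [hwB, hwB']
    linear_combination (norm := module) hy - c₃ • hpw
  · simp [hwB, hwB']
    linear_combination (norm := module) hz - d₃ • hpw

theorem false_of_frame_cross [Finite L] (hbr : ∀ y z, p • B y z = 0) {A : ℕ} (hA : 2 ≤ A)
    (hL : Nat.card L = p ^ (A + 2) * Nat.card (derived B)) (hD : Nat.card (derived B) = p ^ 3)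
    {x y z : L} (hf : Frame p B A x y z) {b₁ b₂ b₃ : ℤ} (hb₃ : ¬(p : ℤ) ∣ b₃)
    (hx : p ^ A • x = b₁ • B y z + b₂ • B z x + b₃ • B x y) : False := by
  obtain ⟨e, he⟩ := hR.exists_dvd_mul_sub hb₃ b₁
  have hX := zsmul_eq_zsmul he (hbr y z)
  have hpz : p ^ A • z = 0 := pow_nsmul_eq_zero hA (fun d hd => nsmul_derived hbr hd) hf.mem_z
  have hP := Nat.prime_iff_prime_int.mp hR.prime
  have hi : Ind p B (x + -e • z) (b₃ • y - b₂ • z) z := by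
    intro r s t h
    simp [hR.alt, hR.skew z y, hR.skew x z] at h
    obtain ⟨h1, h2, h3⟩ := hf.ind (r * b₃ + t * (e * b₃)) (s + t * b₂) (t * b₃) (by
      linear_combination (norm := module) h)
    have h4 := (hP.dvd_or_dvd h3).resolve_right hb₃
    exact ⟨(hP.dvd_or_dvd ((dvd_add_left (h4.mul_right _)).mp h1)).resolve_right hb₃,
      (dvd_add_left (h4.mul_right _)).mp h2, h4⟩
  refine hR.false_of_frame_normal hbr hA hL hD (Frame.change hR hf hi rfl ?_ ?_ ?_ hf.mem_z) ?_
  · rw [smul_comm]; exact AddSubgroup.zsmul_mem _ hf.mem_z _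
  · rw [smul_comm, hpz, smul_zero]; exact AddSubgroup.zero_mem _
  · rw [smul_sub, smul_comm, smul_comm p]
    exact AddSubgroup.sub_mem _ (AddSubgroup.zsmul_mem _ hf.mem_y _)
      (AddSubgroup.zsmul_mem _ hf.mem_z _)
  · simp [hR.alt, hR.skew z y, hR.skew x z]
    linear_combination (norm := module) hx - e • hpz - hX

theorem false_of_frame [Finite L] (hbr : ∀ y z, p • B y z = 0)
    (hsoc : ∀ z ∈ center B, p • z = 0 → z ∈ derived B) {A : ℕ} (hA : 2 ≤ A)
    (hL : Nat.card L = p ^ (A + 2) * Nat.card (derived B)) (hD : Nat.card (derived B) = p ^ 3)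
    {x y z : L} (hf : Frame p B A x y z) : False := by
  obtain ⟨b₁, b₂, b₃, hx⟩ := hf.ind.exists_eq hD hf.mem
  by_cases hb₃ : (p : ℤ) ∣ b₃
  · by_cases hb₂ : (p : ℤ) ∣ b₂
    · obtain ⟨A', rfl⟩ := Nat.exists_eq_add_of_le' hA
      obtain ⟨w, hw⟩ : ∃ w, p ^ (A' + 1) • x = w := ⟨_, rfl⟩
      have hwZ : w ∈ center B := by
        rw [← hw, pow_succ', mul_smul]
        exact nsmul_mem_center hbr _
      have hpw : p • w = p ^ (A' + 2) • x := by rw [← hw, ← mul_smul, ← pow_succ']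
      have hx' : p ^ (A' + 2) • x = b₁ • B y z := by
        rw [hx, zsmul_eq_zsmul (t := 0) (by simpa using hb₂) (hbr z x),
          zsmul_eq_zsmul (t := 0) (by simpa using hb₃) (hbr x y)]
        simp
      have hb₁ : ¬(p : ℤ) ∣ b₁ := fun h => by
        rw [zsmul_eq_zsmul (t := 0) (by simpa using h) (hbr y z), zero_smul, ← hpw] at hx'
        have h1 := hf.order (p ^ (A' + 1) : ℤ) (by
          convert hsoc w hwZ hx' using 1
          rw [← hw, ← natCast_zsmul]; push_cast; rfl)
        have h2 := Nat.le_of_dvd (pow_pos hR.prime.pos _)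
          (show p ^ (A' + 2) ∣ p ^ (A' + 1) by exact_mod_cast h1)
        exact absurd h2 (not_le.mpr (Nat.pow_lt_pow_right hR.prime.one_lt (by omega)))
      obtain ⟨c₁, c₂, c₃, hy⟩ := hf.ind.exists_eq hD hf.mem_y
      obtain ⟨d₁, d₂, d₃, hz⟩ := hf.ind.exists_eq hD hf.mem_z
      obtain ⟨s, hs⟩ := hR.exists_dvd_mul_sub hb₁ c₁
      obtain ⟨t, ht⟩ := hR.exists_dvd_mul_sub hb₁ d₁
      have hwB : ∀ u, B u w = 0 := fun u => hR.br_right_eq_zero hwZ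
      have hwB' : ∀ u, B w u = 0 := hwZ
      have hcZ : ∀ c : ℤ, c • w ∈ center B := fun c => AddSubgroup.zsmul_mem _ hwZ c
      have hpD : ∀ c : ℤ, p • c • w ∈ derived B := fun c => by
        rw [smul_comm, hpw]; exact AddSubgroup.zsmul_mem _ hf.mem _
      have hi : Ind p B x (y - s • w) (z - t • w) :=
        Ind.congr hR hf.ind (by simpa using hcZ s) (by simpa using hcZ t)
      have hf' : Frame p B (A' + 2) x (y - s • w) (z - t • w) :=
        ⟨hi, hf.mem, by rw [smul_sub]; exact AddSubgroup.sub_mem _ hf.mem_y (hpD _),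
          by rw [smul_sub]; exact AddSubgroup.sub_mem _ hf.mem_z (hpD _), hf.order⟩
      refine hR.false_of_three_grading hbr (Frame.relBasis hR hf' hL) hR.prime.one_lt.ne' hi
        ⟨b₁, ?_⟩ ⟨c₃, -c₂, ?_⟩ ⟨d₃, -d₂, ?_⟩
      · simpa [hwB, hwB'] using hx'
      · simp [hwB, hR.skew x z]
        linear_combination (norm := module) hy - s • hpw - s • hx' - zsmul_eq_zsmul hs (hbr y z)
      · simp [hwB, hR.skew x z]
        linear_combination (norm := module) hz - t • hpw - t • hx' - zsmul_eq_zsmul ht (hbr y z)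
    · have hf' : Frame p B A x z (-y) := ⟨Ind.swap hR hf.ind, hf.mem, hf.mem_z,
        by rw [smul_neg]; exact AddSubgroup.neg_mem _ hf.mem_y, hf.order⟩
      refine hR.false_of_frame_cross hbr hA hL hD hf' (b₁ := b₁) (b₂ := b₃) (b₃ := -b₂)
        (fun h => hb₂ (Int.dvd_neg.mp h)) ?_
      simp [hR.skew y x, hR.skew x z, hR.skew z y]
      linear_combination (norm := module) hx
  · exact hR.false_of_frame_cross hbr hA hL hD hf hb₃ hx

end Rigid

theorem Thin.false_of_three_free [Finite L] {x : Fin 3 → L} {a : Fin 3 → ℕ} (hT : Thin p B x a)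
    (hD : Nat.card (derived B) = p ^ 3) : False := by
  have hR := hT.rigid
  have hL := hT.basis.card_eq fun _ => pow_pos hR.prime.pos _
  rw [Fin.prod_univ_three, hT.eq_one 1 (by decide), hT.eq_one 2 (by decide)] at hL
  have hL : Nat.card L = p ^ (a 0 + 2) * Nat.card (derived B) := by rw [hL]; ring
  have hi : Ind p B (x 0) (x 1) (x 2) := by
    have hbr : ∀ y z, B y z ∈ adjoin ⊥ ![B (x 1) (x 2), B (x 2) (x 0), B (x 0) (x 1)] := by
      refine hR.br_mem hT.basis hR.derived_le_center fun i j => ?_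
      have h1 : B (x 1) (x 2) ∈ adjoin ⊥ ![B (x 1) (x 2), B (x 2) (x 0), B (x 0) (x 1)] :=
        self_mem_adjoin 0
      have h2 : B (x 2) (x 0) ∈ adjoin ⊥ ![B (x 1) (x 2), B (x 2) (x 0), B (x 0) (x 1)] :=
        self_mem_adjoin 1
      have h3 : B (x 0) (x 1) ∈ adjoin ⊥ ![B (x 1) (x 2), B (x 2) (x 0), B (x 0) (x 1)] :=
        self_mem_adjoin 2
      fin_cases i <;> fin_cases j <;> simp [hR.alt, h1, h2, h3, hR.skew (x 1) (x 0),
        hR.skew (x 0) (x 2), hR.skew (x 2) (x 1)]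
    intro r s t h
    have key := dvd_of_card_eq hR.prime.pos (fun d hd => nsmul_derived hT.br hd)
      (e := ![B (x 1) (x 2), B (x 2) (x 0), B (x 0) (x 1)]) (s := ![r, s, t])
      (by intro i; fin_cases i <;> exact br_mem_derived B _ _)
      (by rw [derived, AddSubgroup.closure_le]; rintro _ ⟨y, z, rfl⟩; exact hbr y z) hD
      (by simpa [Fin.sum_univ_three] using h)
    exact ⟨key 0, key 1, key 2⟩
  have hf : Frame p B (a 0) (x 0) (x 1) (x 2) := by
    refine ⟨hi, hT.basis.mem 0, ?_, ?_, fun s hs => ?_⟩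
    · simpa [hT.eq_one 1 (by decide)] using hT.basis.mem 1
    · simpa [hT.eq_one 2 (by decide)] using hT.basis.mem 2
    · exact_mod_cast (hT.basis.zsmul_mem_iff 0 s).mp hs
  rcases hT.one_le.eq_or_lt with h | h
  · refine hR.false_of_card_eq_cube hT.br (fun y => ?_) (by rw [hL, ← h]) hD hi
    obtain ⟨s, d, hd, rfl⟩ := hT.basis.span y
    rw [smul_add, Finset.smul_sum]
    refine AddSubgroup.add_mem _ (AddSubgroup.sum_mem _ fun i _ => ?_) (AddSubgroup.nsmul_mem _ hd _)
    rw [smul_comm]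
    have hi : a i = 1 := by
      by_cases hi : i = 0
      · rw [hi, ← h]
      · exact hT.eq_one i hi
    exact AddSubgroup.zsmul_mem _ (by simpa [hi] using hT.basis.mem i) _
  · exact hR.false_of_frame hT.br hT.soc h hL hD hf

end

section

variable {L : Type*} [AddCommGroup L] {p : ℕ} {B : L →+ L →+ L}

theorem derived_le {S : AddSubgroup L} (h : ∀ y z, B y z ∈ S) : derived B ≤ S := by
  rw [derived, AddSubgroup.closure_le]
  rintro _ ⟨y, z, rfl⟩
  exact h y z

/-- The exponent of `L` modulo `derived B` exceeds the exponent of the centre, and brackets have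
order `p`. -/
structure Thick (p : ℕ) (B : L →+ L →+ L) {k : ℕ} (x : Fin (k + 1) → L) (a : Fin (k + 1) → ℕ)
    (e : ℕ) : Prop where
  rigid : Rigid p B
  basis : RelBasis (derived B) x (fun i => p ^ a i)
  anti : Antitone a
  one_le : ∀ i, 1 ≤ a i
  zero : a 0 = e + 1
  exp : ∀ z ∈ center B, p ^ e • z = 0
  br : ∀ y z, p • B y z = 0
  ne : ∃ y z, B y z ≠ 0

namespace Thick

variable {k : ℕ} {x : Fin (k + 1) → L} {a : Fin (k + 1) → ℕ} {e : ℕ} (hT : Thick p B x a e)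
include hT

theorem nsmul_mem_center (y : L) : p • y ∈ center B := Rigid.nsmul_mem_center hT.br y

theorem one_le_e : 1 ≤ e := by
  by_contra h
  obtain ⟨y, z, hyz⟩ := hT.ne
  have := hT.exp _ (hT.rigid.derived_le_center (br_mem_derived B y z))
  rw [show e = 0 by omega, pow_zero, one_smul] at this
  exact hyz this

theorem pow_succ_nsmul (y : L) : p ^ (e + 1) • y = 0 := by
  rw [pow_succ, mul_smul]
  exact hT.exp _ (hT.nsmul_mem_center y)

theorem mem_center_of_br [Finite L] {v : L} {i : Fin (k + 1)} (hi : a i = e + 1)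
    (hv : ∀ j, j ≠ i → B v (x j) = 0) : v ∈ center B := by
  have := hT.rigid.nsmul_mem_center_of_exponent hT.basis (c := 0) (by simpa using hT.br) hT.exp
    (i := i) (by simp [hi]) (v := v) (fun j hj => by rw [hv j hj, smul_zero])
  simpa using this

theorem derived_le_centralTorsion : derived B ≤ centralTorsion B p := fun _ hd =>
  ⟨hT.rigid.derived_le_center hd, nsmul_derived hT.br hd⟩

theorem pow_nsmul_mem : p ^ e • x 0 ∈ centralTorsion B p := by
  obtain ⟨e, rfl⟩ := Nat.exists_eq_add_of_le' hT.one_le_e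
  refine ⟨?_, ?_⟩
  · rw [pow_succ', mul_smul]
    exact hT.nsmul_mem_center _
  · rw [← mul_smul, ← pow_succ']
    exact hT.pow_succ_nsmul _

theorem pow_nsmul_notMem : p ^ e • x 0 ∉ derived B := by
  intro h
  have h1 := (hT.basis.zsmul_mem_iff 0 (p ^ e : ℤ)).mp (by
    convert h using 1
    rw [← natCast_zsmul]; push_cast; rfl)
  rw [hT.zero] at h1
  have h2 := Nat.le_of_dvd (pow_pos hT.rigid.prime.pos _)
    (show p ^ (e + 1) ∣ p ^ e by exact_mod_cast h1)
  exact absurd h2 (not_le.mpr (Nat.pow_lt_pow_right hT.rigid.prime.one_lt (by omega)))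

theorem card_derived_lt [Finite L] : Nat.card (derived B) < Nat.card (centralTorsion B p) := by
  refine lt_of_le_of_ne (card_le_of_le hT.derived_le_centralTorsion) fun h => ?_
  have := AddSubgroup.eq_of_le_of_card_ge hT.derived_le_centralTorsion h.ge
  exact hT.pow_nsmul_notMem (this ▸ hT.pow_nsmul_mem)

theorem derived_le_zmultiples [Finite L] (hD : Nat.card (derived B) ≤ p) {y z : L}
    (h : B y z ≠ 0) : derived B ≤ AddSubgroup.zmultiples (B y z) := by
  have hle : AddSubgroup.zmultiples (B y z) ≤ derived B := by simpa using br_mem_derived B y z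
  have hc : Nat.card (AddSubgroup.zmultiples (B y z)) = p := by
    have := Fact.mk hT.rigid.prime
    rw [Nat.card_zmultiples]
    exact addOrderOf_eq_prime_iff.mpr ⟨hT.br y z, h⟩
  exact (AddSubgroup.eq_of_le_of_card_ge hle (by rw [hc]; exact hD)).ge

theorem false_of_card_centralTorsion_eq_sq [Finite L] (hk : 2 ≤ k)
    (hc : Nat.card (centralTorsion B p) = p ^ 2) : False := by
  have hR := hT.rigid
  have hp := hR.prime
  obtain ⟨m, hm⟩ := hR.exists_card_eq_pow (derived B)
  have hlt := hT.card_derived_lt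
  rw [hm, hc] at hlt
  have hm2 : m < 2 := (Nat.pow_lt_pow_iff_right hp.one_lt).mp hlt
  obtain ⟨y, z, hyz⟩ := hT.ne
  have hDw := hT.derived_le_zmultiples (by
    rw [hm]; exact (Nat.pow_le_pow_right hp.pos (by omega : m ≤ 1)).trans_eq (pow_one p)) hyz
  have hker : (nsmulAddMonoidHom p : L →+ L).ker ≤ centralTorsion B p := by
    intro Y hY
    refine ⟨?_, hY⟩
    by_contra hYZ
    obtain ⟨i, hi⟩ := hR.exists_br_notMem hT.basis hT.one_le hY hYZ (hT.br y z)
    exact hi (hDw (br_mem_derived B _ _))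
  have h1 := hT.basis.le_card_torsion hp.pos hT.one_le
  have h2 := h1.trans (card_le_of_le hker)
  rw [hc, Fintype.card_fin, Nat.pow_le_pow_iff_right hp.one_lt] at h2
  omega

end Thick

theorem RelBasis.shear_three [Finite L] {A : ℕ} (hA : 2 ≤ A) (hbr : ∀ y z, p • B y z = 0)
    {x u v : L} (hb : RelBasis (derived B) ![x, u, v] ![p ^ A, p, p]) (hp : 0 < p) (θ φ : ℤ) :
    RelBasis (derived B) ![x + θ • u, u, v + φ • u] ![p ^ A, p, p] := by
  have hu : p • u ∈ derived B := hb.mem 1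
  refine RelBasis.of_dvd_of_card ?_ ?_ ?_
  · intro i; fin_cases i
    · change p ^ A • (x + θ • u) ∈ derived B
      rw [smul_add, smul_comm _ θ,
        pow_nsmul_eq_zero hA (fun d hd => nsmul_derived hbr hd) hu, smul_zero, add_zero]
      exact hb.mem 0
    · exact hu
    · change p • (v + φ • u) ∈ derived B
      rw [smul_add, smul_comm _ φ]
      exact AddSubgroup.add_mem _ (hb.mem 2) (AddSubgroup.zsmul_mem _ hu _)
  · intro s hs
    have key := hb.dvd ![s 0, s 1 + θ * s 0 + φ * s 2, s 2] (by
      convert hs using 1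
      simp [Fin.sum_univ_three]
      module)
    have h0 : ((p ^ A : ℕ) : ℤ) ∣ s 0 := key 0
    have h1 : (p : ℤ) ∣ s 1 + θ * s 0 + φ * s 2 := key 1
    have h2 : (p : ℤ) ∣ s 2 := key 2
    have h3 : (p : ℤ) ∣ s 0 := dvd_trans (by
      push_cast; exact dvd_pow_self _ (by omega)) h0
    intro i; fin_cases i
    · exact h0
    · exact (dvd_add_left (h3.mul_left θ)).mp ((dvd_add_left (h2.mul_left φ)).mp h1)
    · exact h2
  · refine (hb.card_eq fun i => ?_).le
    fin_cases i
    exacts [pow_pos hp _, hp, hp]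

namespace Rigid

variable (hR : Rigid p B)
include hR

theorem false_of_commuting_grading [Finite L] (hbr : ∀ y z, p • B y z = 0) {A : ℕ}
    {x u v : L} (hb : RelBasis (derived B) ![x, u, v] ![p ^ A, p, p]) (hxu : B x u = 0)
    (hi : ∀ r s : ℤ, r • B u v + s • B x v = 0 → (p : ℤ) ∣ r ∧ (p : ℤ) ∣ s)
    (hx : p ^ A • x = 0) {r s : ℤ} (hu : p • u = s • B x v) (hv : p • v = r • B u v) : False := by
  refine hR.sign_grading hb ![false, true, false] (fun b => if b then
    AddSubgroup.zmultiples (B x v) else AddSubgroup.zmultiples (B u v)) ?_ ?_ ?_ ?_ (i := 2) rfl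
    hR.prime.one_lt.ne'
  · intro b; cases b <;> simpa using br_mem_derived B _ _
  · simp only [if_true, Bool.false_eq_true, if_false]
    rw [AddSubgroup.disjoint_def]
    rintro _ ⟨s, rfl⟩ ⟨r, h⟩
    obtain ⟨-, h1⟩ := hi r (-s) (by
      have h : r • B u v = s • B x v := h
      rw [h]; module)
    exact (zsmul_eq_zsmul (t := 0) (by simpa using Int.dvd_neg.mp h1) (hbr x v)).trans (zero_smul _ _)
  · intro i; fin_cases i
    · simp [hx]
    · simp [hu, AddSubgroup.zsmul_mem]
    · simp [hv, AddSubgroup.zsmul_mem]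
  · have hux : B u x = 0 := by rw [hR.skew, hxu, neg_zero]
    intro i j; fin_cases i <;> fin_cases j <;>
      simp [hR.alt, hxu, hux, hR.skew v u, hR.skew v x]

theorem false_of_commuting_grading' [Finite L] (hbr : ∀ y z, p • B y z = 0) {A : ℕ}
    {x u v : L} (hb : RelBasis (derived B) ![x, u, v] ![p ^ A, p, p]) (hxu : B x u = 0)
    (hi : ∀ r s : ℤ, r • B u v + s • B x v = 0 → (p : ℤ) ∣ r ∧ (p : ℤ) ∣ s)
    (hx : p ^ A • x = 0) {r s : ℤ} (hu : p • u = r • B u v) (hv : p • v = s • B x v) : False := by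
  refine hR.sign_grading hb ![true, false, true] (fun b => if b then
    AddSubgroup.zmultiples (B x v) else AddSubgroup.zmultiples (B u v)) ?_ ?_ ?_ ?_ (i := 1) rfl
    hR.prime.one_lt.ne'
  · intro b; cases b <;> simpa using br_mem_derived B _ _
  · simp only [if_true, Bool.false_eq_true, if_false]
    rw [AddSubgroup.disjoint_def]
    rintro _ ⟨s, rfl⟩ ⟨r, h⟩
    obtain ⟨-, h1⟩ := hi r (-s) (by
      have h : r • B u v = s • B x v := h
      rw [h]; module)
    exact (zsmul_eq_zsmul (t := 0) (by simpa using Int.dvd_neg.mp h1) (hbr x v)).trans (zero_smul _ _)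
  · intro i; fin_cases i
    · simp [hx]
    · simp [hu, AddSubgroup.zsmul_mem]
    · simp [hv, AddSubgroup.zsmul_mem]
  · have hux : B u x = 0 := by rw [hR.skew, hxu, neg_zero]
    intro i j; fin_cases i <;> fin_cases j <;>
      simp [hR.alt, hxu, hux, hR.skew v u, hR.skew v x]

theorem false_of_commuting [Finite L] (hbr : ∀ y z, p • B y z = 0) {A : ℕ} (hA : 2 ≤ A)
    {x u v : L} (hb : RelBasis (derived B) ![x, u, v] ![p ^ A, p, p]) (hxu : B x u = 0)
    (hx : p ^ A • x = 0) (hc : Nat.card (derived B) = p ^ 2) : False := by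
  have hp := hR.prime
  have hux : B u x = 0 := by rw [hR.skew, hxu, neg_zero]
  have hD : derived B ≤ adjoin ⊥ ![B u v, B x v] := by
    have h0 : B u v ∈ adjoin ⊥ ![B u v, B x v] := self_mem_adjoin (e := ![B u v, B x v]) 0
    have h1 : B x v ∈ adjoin ⊥ ![B u v, B x v] := self_mem_adjoin (e := ![B u v, B x v]) 1
    refine derived_le fun y z => hR.br_mem hb hR.derived_le_center (fun i j => ?_) y z
    fin_cases i <;> fin_cases j <;>
      simp [hR.alt, hxu, hux, hR.skew v u, hR.skew v x, h0, h1]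
  have hi : ∀ r s : ℤ, r • B u v + s • B x v = 0 → (p : ℤ) ∣ r ∧ (p : ℤ) ∣ s := by
    intro r s h
    have key := dvd_of_card_eq (S := derived B) (e := ![B u v, B x v]) (s := ![r, s]) hp.pos
      (fun d hd => nsmul_derived hbr hd)
      (fun i => by fin_cases i <;> exact br_mem_derived B _ _) hD (by simpa using hc)
      (by simpa using h)
    exact ⟨key 0, key 1⟩
  have hcoord : ∀ d ∈ derived B, ∃ r s : ℤ, d = r • B u v + s • B x v := by
    intro d hd
    obtain ⟨c, d', hd', h⟩ := hD hd
    rw [AddSubgroup.mem_bot] at hd'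
    exact ⟨c 0, c 1, by simpa [hd'] using h⟩
  obtain ⟨c₁, c₂, hu⟩ := hcoord (p • u) (hb.mem 1)
  obtain ⟨d₁, d₂, hv⟩ := hcoord (p • v) (hb.mem 2)
  have hpu : p ^ A • u = 0 :=
    pow_nsmul_eq_zero hA (fun d hd => nsmul_derived hbr hd) (hb.mem 1)
  by_cases h2 : (p : ℤ) ∣ c₂
  · have h2' := zsmul_eq_zsmul (t := 0) (by simpa using h2) (hbr x v)
    by_cases h1 : (p : ℤ) ∣ c₁
    · have h1' := zsmul_eq_zsmul (t := 0) (by simpa using h1) (hbr u v)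
      have hu0 : p • u = 0 := by rw [hu, h1', h2']; simp
      have := hR.transvection_mem_center hb (Y := u) (w := B u v) (s := ![0, 0, 1])
        (fun i => by fin_cases i <;> simp [hux, hR.alt])
        (fun i => by fin_cases i <;> simp [hu0]) 2
      have huv : B u v = 0 := by
        rw [mem_center] at this
        simpa using this v
      have := (hi 1 0 (by simp [huv])).1
      exact hp.one_lt.ne' (Nat.dvd_one.mp (by exact_mod_cast this))
    · obtain ⟨t, ht⟩ := hR.exists_dvd_mul_sub h1 (-d₁)
      have hb' := hb.shear_three hA hbr hp.pos 0 t
      rw [zero_smul, add_zero] at hb'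
      refine hR.false_of_commuting_grading' hbr hb' hxu (fun r s h => hi r s ?_) hx (r := c₁)
        (s := d₂) ?_ ?_
      · simpa [hR.alt, hxu] using h
      · simp only [map_add, map_zsmul, hR.alt]
        linear_combination (norm := module) hu + h2'
      · have h3 := zsmul_eq_zsmul (s := c₁ * t + d₁) (t := 0) (by simpa using ht) (hbr u v)
        simp only [map_add, map_zsmul, hxu]
        linear_combination (norm := module) hv + t • hu + t • h2' + h3
  · obtain ⟨θ, hθ⟩ := hR.exists_dvd_mul_sub h2 c₁
    obtain ⟨φ, hφ⟩ := hR.exists_dvd_mul_sub h2 (-d₂)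
    refine hR.false_of_commuting_grading hbr (hb.shear_three hA hbr hp.pos θ φ) ?_
      (fun r s h => ?_) ?_ (s := c₂) (r := d₁ + φ * c₁) ?_ ?_
    · simp [hR.alt, hxu]
    · have key := hi (r + θ * s) s (by
        simp only [map_add, map_zsmul, hR.alt, hxu, AddMonoidHom.add_apply,
          AddMonoidHom.zsmul_apply] at h
        linear_combination (norm := module) h)
      exact ⟨(dvd_add_left (key.2.mul_left θ)).mp key.1, key.2⟩
    · rw [smul_add, smul_comm _ θ, hx, hpu, smul_zero, add_zero]
    · have h3 := zsmul_eq_zsmul hθ (hbr u v)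
      simp only [map_add, map_zsmul, hR.alt, hxu, AddMonoidHom.add_apply,
          AddMonoidHom.zsmul_apply]
      linear_combination (norm := module) hu - h3
    · have h3 := zsmul_eq_zsmul hφ (hbr x v)
      simp only [map_add, map_zsmul, hR.alt]
      linear_combination (norm := module) hv + φ • hu + h3

theorem false_of_relation [Finite L] (hbr : ∀ y z, p • B y z = 0) {A : ℕ} (hA : 2 ≤ A)
    {x y z : L} (hb : RelBasis (derived B) ![x, z, y] ![p ^ A, p, p]) (hx : p ^ A • x = 0)
    (hc : Nat.card (derived B) = p ^ 2) {r s t : ℤ}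
    (h : r • B y z + s • B x y + t • B x z = 0) (hs : ¬ (p : ℤ) ∣ s) : False := by
  obtain ⟨m, hm⟩ := hR.exists_dvd_mul_sub hs 1
  have hb' := (hb.shear_three hA hbr hR.prime.pos (-(m * r)) (m * t)).reindex (Equiv.swap 1 2)
  have hb'' : RelBasis (derived B) ![x + (-(m * r)) • z, y + (m * t) • z, z] ![p ^ A, p, p] := by
    convert hb' using 1 <;> · ext i; fin_cases i <;> rfl
  refine hR.false_of_commuting hbr hA hb'' ?_ ?_ hc
  · have h3 := zsmul_eq_zsmul hm (hbr x y)
    simp only [map_add, map_zsmul, hR.alt, AddMonoidHom.add_apply, AddMonoidHom.zsmul_apply,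
      hR.skew z y]
    linear_combination (norm := module) m • h - h3
  · rw [smul_add, smul_comm _ (-(m * r)), hx,
      pow_nsmul_eq_zero hA (fun d hd => nsmul_derived hbr hd)
        (show p • z ∈ derived B from hb.mem 1), smul_zero, add_zero]

end Rigid

namespace Thick

section

variable {x : Fin 3 → L} {a : Fin 3 → ℕ} {e : ℕ} (hT : Thick p B x a e)
include hT

theorem br_ne_zero [Finite L] : B (x 1) (x 2) ≠ 0 := by
  intro h
  have hR := hT.rigid
  have h1 : x 1 ∈ center B := hT.mem_center_of_br hT.zero fun j hj => by
    fin_cases j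
    exacts [absurd rfl hj, hR.alt _, h]
  have h2 : x 2 ∈ center B := hT.mem_center_of_br hT.zero fun j hj => by
    fin_cases j
    exacts [absurd rfl hj, by rw [hR.skew]; simpa using h, hR.alt _]
  obtain ⟨y, z, hyz⟩ := hT.ne
  refine hyz ?_
  have := hR.br_mem (S := ⊥) hT.basis hR.derived_le_center (fun i j => ?_) y z
  · simpa using this
  · rw [AddSubgroup.mem_bot]
    fin_cases i
    · fin_cases j
      exacts [hR.alt _, hR.br_right_eq_zero h1, hR.br_right_eq_zero h2]
    · exact h1 _
    · exact h2 _

theorem lt_card_derived [Finite L] : p < Nat.card (derived B) := by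
  by_contra! hD
  have hR := hT.rigid
  have hle := hT.derived_le_zmultiples hD hT.br_ne_zero
  obtain ⟨s, hs⟩ := AddSubgroup.mem_zmultiples_iff.mp (hle (br_mem_derived B (x 0) (x 1)))
  obtain ⟨t, ht⟩ := AddSubgroup.mem_zmultiples_iff.mp (hle (br_mem_derived B (x 0) (x 2)))
  have hZ : x 0 - t • x 1 + s • x 2 ∈ center B := by
    refine hR.mem_center_of_basis hT.basis hR.derived_le_center fun i => ?_
    fin_cases i
    · simp only [map_add, map_sub, map_zsmul, AddMonoidHom.add_apply, AddMonoidHom.sub_apply,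
        AddMonoidHom.zsmul_apply, Fin.zero_eta, hR.alt, hR.skew (x 1) (x 0), hR.skew (x 2) (x 0)]
      linear_combination (norm := module) (-t) • hs + s • ht
    · simp only [map_add, map_sub, map_zsmul, AddMonoidHom.add_apply, AddMonoidHom.sub_apply,
        AddMonoidHom.zsmul_apply, Fin.mk_one, hR.alt, hR.skew (x 2) (x 1)]
      linear_combination (norm := module) -hs
    · simp only [map_add, map_sub, map_zsmul, AddMonoidHom.add_apply, AddMonoidHom.sub_apply,
        AddMonoidHom.zsmul_apply, Fin.reduceFinMk, hR.alt]
      linear_combination (norm := module) -ht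
  have key := hT.basis.dvd ![p ^ e, -(p ^ e * t), p ^ e * s] (by
    have h := hT.exp _ hZ
    rw [← natCast_zsmul] at h
    convert (derived B).zero_mem
    rw [← h, Fin.sum_univ_three]
    simp only [Matrix.cons_val_zero, Matrix.cons_val_one, Matrix.cons_val]
    push_cast
    module) 0
  simp only [hT.zero, Matrix.cons_val_zero] at key
  have h2 := Nat.le_of_dvd (pow_pos hR.prime.pos _)
    (show p ^ (e + 1) ∣ p ^ e by exact_mod_cast key)
  exact absurd h2 (not_le.mpr (Nat.pow_lt_pow_right hR.prime.one_lt (by omega)))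

theorem apply_one_eq_one [Finite L] (hD : Nat.card (derived B) = p ^ 2)
    (hc : Nat.card (centralTorsion B p) = p ^ 3) : a 1 = 1 := by
  have hR := hT.rigid
  by_contra ha
  obtain ⟨b, hb⟩ : ∃ b, a 1 = b + 2 := Nat.exists_eq_add_of_le' (by
    have := hT.one_le 1; omega)
  by_cases hw : ∃ w ∈ center B, p ^ (b + 1) • w ≠ 0
  · obtain ⟨w, hw, hpw⟩ := hw
    obtain ⟨w', hw', h1, h2⟩ := hR.exists_of_nsmul_ne_zero hw hpw
    have := hR.coord_smul_eq_zero hT.basis (i := 0) (j := 1) (by decide) (z := p • x 1) (w := w')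
      ⟨hT.nsmul_mem_center _, by
        rw [hT.zero, pow_succ', mul_smul, hT.exp _ (hT.nsmul_mem_center _), smul_zero]⟩
      ⟨hw', by rw [hb]; exact h1⟩ (s := ![0, p, 0]) (d := 0) (zero_mem _)
      (by simp [Fin.sum_univ_three])
    refine h2 ?_
    rw [pow_succ, mul_smul]
    simp only [Matrix.cons_val_one, Matrix.cons_val_zero, natCast_zsmul] at this
    rw [this, smul_zero]
  · push Not at hw
    have hx1 : p ^ (b + 1) • x 1 ∈ centralTorsion B p := by
      refine ⟨?_, ?_⟩
      · rw [pow_succ', mul_smul]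
        exact hT.nsmul_mem_center _
      · rw [smul_comm]
        exact hw _ (hT.nsmul_mem_center _)
    obtain ⟨s, hs, h⟩ := exists_relation (κ := Fin 2) p hT.derived_le_centralTorsion
      (e := ![p ^ e • x 0, p ^ (b + 1) • x 1])
      (by intro i; fin_cases i; exacts [hT.pow_nsmul_mem, hx1]) (by
        rw [hD, hc, Fintype.card_fin, ← pow_add]
        exact Nat.pow_lt_pow_right hR.prime.one_lt (by omega))
    have key := hT.basis.dvd ![p ^ e * s 0, p ^ (b + 1) * s 1, 0] (by
      rw [Fin.sum_univ_two] at h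
      rw [Fin.sum_univ_three]
      simp only [Matrix.cons_val_zero, Matrix.cons_val_one, Matrix.cons_val, ← natCast_zsmul,
        zero_smul, add_zero] at h ⊢
      convert h using 1
      push_cast
      module)
    have h0 := key 0
    have h1 := key 1
    have hp0 : (p : ℤ) ≠ 0 := by exact_mod_cast hR.prime.ne_zero
    simp only [hT.zero, hb, Matrix.cons_val_zero, Matrix.cons_val_one] at h0 h1
    push_cast at h0 h1
    rw [pow_succ] at h0
    rw [show b + 2 = b + 1 + 1 from rfl, pow_succ (p : ℤ) (b + 1)] at h1
    obtain ⟨i, hi⟩ := hs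
    fin_cases i
    · exact hi ((mul_dvd_mul_iff_left (pow_ne_zero e hp0)).mp h0)
    · exact hi ((mul_dvd_mul_iff_left (pow_ne_zero (b + 1) hp0)).mp h1)

theorem false_of_three [Finite L] (hc : Nat.card (centralTorsion B p) = p ^ 3) : False := by
  have hR := hT.rigid
  have hp := hR.prime
  have hD : Nat.card (derived B) = p ^ 2 := by
    obtain ⟨m, hm⟩ := hR.exists_card_eq_pow (derived B)
    have h1 := hT.card_derived_lt
    have h2 := hT.lt_card_derived
    rw [hm, hc] at h1
    rw [hm, ← Nat.pow_one p, ← pow_mul, one_mul] at h2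
    have h1 := (Nat.pow_lt_pow_iff_right hp.one_lt).mp h1
    have h2 := (Nat.pow_lt_pow_iff_right hp.one_lt).mp h2
    rw [hm, show m = 2 by omega]
  have ha1 := hT.apply_one_eq_one hD hc
  have ha2 : a 2 = 1 := by
    have := hT.anti (show (1 : Fin 3) ≤ 2 by decide)
    have := hT.one_le 2
    omega
  have hb : RelBasis (derived B) ![x 0, x 1, x 2] ![p ^ (e + 1), p, p] := by
    convert hT.basis using 1
    · ext i; fin_cases i <;> rfl
    · ext i; fin_cases i <;> simp [hT.zero, ha1, ha2]
  have hb' : RelBasis (derived B) ![x 0, x 2, x 1] ![p ^ (e + 1), p, p] := by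
    convert hb.reindex (Equiv.swap 1 2) using 1 <;> · ext i; fin_cases i <;> rfl
  have hA : 2 ≤ e + 1 := by have := hT.one_le_e; omega
  have hx := hT.pow_succ_nsmul (x 0)
  obtain ⟨s, hs, h⟩ := exists_relation (κ := Fin 3) p (bot_le : ⊥ ≤ derived B)
    (e := ![B (x 1) (x 2), B (x 0) (x 1), B (x 0) (x 2)])
    (by intro i; fin_cases i <;> exact br_mem_derived B _ _) (by
      rw [hD, Fintype.card_fin, AddSubgroup.card_bot, mul_one]
      exact Nat.pow_lt_pow_right hp.one_lt (by omega))
  simp only [Fin.sum_univ_three, AddSubgroup.mem_bot, Matrix.cons_val_zero, Matrix.cons_val_one,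
    Matrix.cons_val] at h
  by_cases h1 : (p : ℤ) ∣ s 1
  · by_cases h2 : (p : ℤ) ∣ s 2
    · have h1' := zsmul_eq_zsmul (t := 0) (by simpa using h1) (hT.br (x 0) (x 1))
      have h2' := zsmul_eq_zsmul (t := 0) (by simpa using h2) (hT.br (x 0) (x 2))
      rw [h1', h2', zero_smul, zero_smul, add_zero, add_zero] at h
      obtain ⟨i, hi⟩ := hs
      fin_cases i
      exacts [hT.br_ne_zero (hR.zsmul_eq_zero_of_coprime h hi), hi h1, hi h2]
    · exact hR.false_of_relation hT.br hA hb hx hD (r := -s 0) (s := s 2) (t := s 1)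
        (by rw [hR.skew (x 2) (x 1)]; linear_combination (norm := module) h) h2
  · exact hR.false_of_relation hT.br hA hb' hx hD h h1

end

end Thick

end

section

variable {L : Type*} [AddCommGroup L] {p : ℕ} {B : L →+ L →+ L}

theorem centralSocle_le_centralTorsion {c : ℕ} : centralSocle p B c ≤ centralTorsion B p := by
  intro w h
  refine ⟨?_, smul_eq_zero_of_mem_centralSocle h⟩
  obtain ⟨z, hz, -, rfl⟩ := mem_centralSocle.mp h
  exact AddSubgroup.nsmul_mem _ hz _

namespace Rigid

variable (hR : Rigid p B)
include hR

theorem sum_lt_of_card_lt [Finite L] {ι : Type*} [Fintype ι] {x : ι → L} {a f : ι → ℕ}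
    (hb : RelBasis (derived B) x (fun i => p ^ a i))
    (hf : ∀ i, p ^ f i ≤ Nat.card (centralTorsion B (p ^ a i))) {N : ℕ}
    (hlt : Nat.card {φ : L ≃+ L // IsLieAut B φ} < p ^ N) : ∑ i, f i < N := by
  have h1 := Finset.prod_le_prod' fun i (_ : i ∈ Finset.univ) => hf i
  rw [Finset.prod_pow_eq_pow_sum] at h1
  exact (Nat.pow_lt_pow_iff_right hR.prime.one_lt).mp ((h1.trans (hR.prod_card_le hb)).trans_lt hlt)

/-- Brackets of maximal order involve a third basis element. -/
theorem false_of_nsmul_mem_center [Finite L] {k : ℕ} {x : Fin (k + 2) → L} {a : Fin (k + 2) → ℕ}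
    (hb : RelBasis (derived B) x (fun i => p ^ a i)) (ha : Antitone a) (h1 : 1 ≤ a 0) {c : ℕ}
    (hex : ∀ y z, p ^ (c + 1) • B y z = 0) {y₀ z₀ : L} (hne : p ^ c • B y₀ z₀ ≠ 0)
    (hj : ∀ j, j ≠ 0 → j ≠ 1 → p ^ c • x j ∈ center B) : False := by
  obtain ⟨e, he⟩ := Nat.exists_eq_add_of_le' h1
  have hker : ∀ S : AddSubgroup L, (∀ i j, p ^ c • B (x i) (x j) ∈ S) →
      ∀ y z, p ^ c • B y z ∈ S := fun S h =>
    hR.br_mem (S := S.comap (nsmulAddMonoidHom (p ^ c))) hb hR.derived_le_center h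
  have hl : ∀ j, p ^ c • x j ∈ center B → ∀ y, p ^ c • B (x j) y = 0 := fun j h y => by
    simpa using h y
  have hr : ∀ j, p ^ c • x j ∈ center B → ∀ y, p ^ c • B y (x j) = 0 := fun j h y => by
    rw [hR.skew, smul_neg, hl j h, neg_zero]
  by_cases hZ : ∀ z ∈ center B, p ^ e • z = 0
  · have hx1 : p ^ c • x 1 ∈ center B :=
      hR.nsmul_mem_center_of_exponent hb hex hZ (i := 0) (by simp [he]) fun j hj0 => by
        by_cases hj1 : j = 1
        · rw [hj1, hR.alt, smul_zero]
        · exact hr j (hj j hj0 hj1) _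
    have hj' : ∀ j, j ≠ 0 → p ^ c • x j ∈ center B := fun j hj0 => by
      by_cases hj1 : j = 1
      · rwa [hj1]
      · exact hj j hj0 hj1
    refine hne ((AddSubgroup.mem_bot).mp (hker ⊥ (fun i j => ?_) y₀ z₀))
    rw [AddSubgroup.mem_bot]
    by_cases hi0 : i = 0
    · by_cases hj0 : j = 0
      · rw [hi0, hj0, hR.alt, smul_zero]
      · exact hr j (hj' j hj0) _
    · exact hl i (hj' i hi0) _
  · push Not at hZ
    obtain ⟨z, hz, hze⟩ := hZ
    have hle := hR.centralSocle_le hb ha he hz hze (hR.exponent_eq hb ha he hz hze hex hne)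
      (S := AddSubgroup.zmultiples (p ^ c • B (x 0) (x 1))) (fun i j => by
        by_cases hi : i = 0 ∨ i = 1
        · by_cases hj' : j = 0 ∨ j = 1
          · rcases hi with rfl | rfl <;> rcases hj' with rfl | rfl
            · simp [hR.alt]
            · exact AddSubgroup.mem_zmultiples _
            · rw [hR.skew (x 1), smul_neg, neg_mem_iff]
              exact AddSubgroup.mem_zmultiples _
            · simp [hR.alt]
          · push Not at hj'
            simp [hr j (hj j hj'.1 hj'.2)]
        · push Not at hi
          simp [hl i (hj i hi.1 hi.2)])
    have h1 := (hR.le_card_centralSocle hb hex hne).trans ((card_le_of_le hle).trans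
      (hR.card_zmultiples_le (by rw [← mul_smul, ← pow_succ', hex])))
    exact absurd h1 (not_le.mpr (by simpa using Nat.pow_lt_pow_right hR.prime.one_lt one_lt_two))

/-- The case where brackets have order `p`. -/
theorem false_of_elementary [Finite L] {k : ℕ} {x : Fin (k + 2) → L} {a : Fin (k + 2) → ℕ}
    (hb : RelBasis (derived B) x (fun i => p ^ a i)) (ha : Antitone a) (h1 : ∀ i, 1 ≤ a i)
    (hbr : ∀ y z, p • B y z = 0) {y₀ z₀ : L} (hne : B y₀ z₀ ≠ 0) {m : ℕ}
    (hm : Nat.card (centralTorsion B p) = p ^ m) (hm2 : 2 ≤ m) (hk : 1 ≤ k)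
    (hlt : (k + 2) * m < 12) : False := by
  obtain ⟨e, he⟩ := Nat.exists_eq_add_of_le' (h1 0)
  by_cases hZ : ∀ z ∈ center B, p ^ e • z = 0
  · have hT : Thick p B x a e := ⟨hR, hb, ha, h1, he, hZ, hbr, y₀, z₀, hne⟩
    rcases hm2.eq_or_lt with rfl | hm3
    · exact hT.false_of_card_centralTorsion_eq_sq (by omega) hm
    · obtain rfl : k = 1 := by nlinarith
      obtain rfl : m = 3 := by omega
      exact hT.false_of_three hm
  · push Not at hZ
    obtain ⟨z, hz, hze⟩ := hZ
    have ha1 := hR.exponent_eq hb ha he hz hze (c := 0) (by simpa using hbr) (by simpa using hne)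
    have hsoc : ∀ w ∈ center B, p • w = 0 → w ∈ derived B := fun w hw hpw =>
      hR.mem_derived_of_exponent hb ha he hz hze hw (by rw [ha1]; simpa using hpw)
    have hT : Thin p B x a := ⟨hR, hb, h1 0, fun i hi => by
      have := ha (show 1 ≤ i from Fin.one_le_of_ne_zero hi)
      have := h1 i
      omega, hbr, hsoc⟩
    have hD : Nat.card (derived B) = p ^ m := by
      rw [← hm]
      congr 2
      exact le_antisymm (fun d hd => ⟨hR.derived_le_center hd, nsmul_derived hbr hd⟩)
        fun w hw => hsoc w hw.1 hw.2
    have hk3 : k ≤ 3 := by nlinarith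
    have hm3 : m ≤ 3 := by nlinarith
    interval_cases k <;> interval_cases m <;> first | omega | skip
    · exact hT.false_of_three hD
    · exact hT.false_of_three_free hD
    · exact hT.false_of_four hD
    · exact hT.false_of_five hD

theorem le_card_lieAut [Finite L] (hne : ∃ y z, B y z ≠ 0) :
    p ^ 12 ≤ Nat.card {φ : L ≃+ L // IsLieAut B φ} := by
  classical
  by_contra! hlt
  have hp := hR.prime
  obtain ⟨n, a, x, ha, h1, hb⟩ := exists_relBasis hp hR.torsion (derived B)
  obtain ⟨k, rfl⟩ : ∃ k, n = k + 2 := Nat.exists_eq_add_of_le' (by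
    by_contra! hn
    obtain ⟨y, z, h⟩ := hne
    have : Subsingleton (Fin n) := Fin.subsingleton_iff_le_one.mpr (by omega)
    refine h ((AddSubgroup.mem_bot).mp (hR.br_mem hb hR.derived_le_center (fun i j => ?_) y z))
    rw [Subsingleton.elim i j, hR.alt]
    exact AddSubgroup.zero_mem _)
  have hE : ∃ b, ∀ y z, p ^ b • B y z = 0 := ⟨a 1, hR.nsmul_br_eq_zero hb ha⟩
  obtain ⟨c, hc⟩ : ∃ c, Nat.find hE = c + 1 := Nat.exists_eq_succ_of_ne_zero fun h => by
    obtain ⟨y, z, hyz⟩ := hne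
    have := Nat.find_spec hE y z
    rw [h, pow_zero, one_smul] at this
    exact hyz this
  have hex : ∀ y z, p ^ (c + 1) • B y z = 0 := hc ▸ Nat.find_spec hE
  obtain ⟨y₀, z₀, hyz⟩ : ∃ y z, p ^ c • B y z ≠ 0 := by
    have := Nat.find_min hE (m := c) (by omega)
    push Not at this
    exact this
  obtain ⟨m, hm⟩ := hR.exists_card_eq_pow (centralTorsion B p)
  have hS := hR.le_card_centralSocle hb hex hyz
  have hm2 : 2 ≤ m := (Nat.pow_le_pow_iff_right hp.one_lt).mp
    (hm ▸ hS.trans (card_le_of_le centralSocle_le_centralTorsion))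
  have hmt : ∀ t, 1 ≤ t → p ^ m ≤ Nat.card (centralTorsion B (p ^ t)) := fun t ht => by
    rw [← hm]
    simpa using card_le_of_le (centralTorsion_mono (B := B) (p := p) ht)
  have hk : 1 ≤ k := by
    by_contra! h0
    obtain rfl : k = 0 := by omega
    refine hR.false_of_nsmul_mem_center hb ha (h1 0) hex hyz fun j hj0 hj1 => ?_
    fin_cases j
    exacts [absurd rfl hj0, absurd rfl hj1]
  rcases Nat.eq_zero_or_pos c with rfl | hc0
  · have := hR.sum_lt_of_card_lt hb (f := fun _ => m) (fun i => hmt _ (h1 i)) hlt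
    rw [Finset.sum_const, Finset.card_univ, Fintype.card_fin, smul_eq_mul] at this
    exact hR.false_of_elementary hb ha h1 (by simpa using hex) (by simpa using hyz) hm hm2 hk this
  have hbig : ∀ i, c + 1 ≤ a i → p ^ (m + 2) ≤ Nat.card (centralTorsion B (p ^ a i)) := by
    intro i hi
    refine le_trans ?_ (card_le_of_le (centralTorsion_mono hi))
    rw [card_centralTorsion_succ, pow_add]
    exact Nat.mul_le_mul (hmt c hc0) hS
  have hsum := hR.sum_lt_of_card_lt hb (f := fun i => if c + 1 ≤ a i then m + 2 else m)
    (fun i => by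
      split_ifs with h
      exacts [hbig i h, hmt _ (h1 i)]) hlt
  have ha1 : c + 1 ≤ a 1 := hc ▸ Nat.find_min' hE (hR.nsmul_br_eq_zero hb ha)
  have ha0 : c + 1 ≤ a 0 := ha1.trans (ha (Fin.zero_le _))
  rw [Fin.sum_univ_succ, Fin.sum_univ_succ, if_pos ha0,
    if_pos (show c + 1 ≤ a (Fin.succ 0) from ha1)] at hsum
  have hrest : k * m ≤ ∑ i : Fin k, if c + 1 ≤ a i.succ.succ then m + 2 else m := by
    calc k * m = ∑ _i : Fin k, m := by simp
      _ ≤ _ := Finset.sum_le_sum fun i _ => by split_ifs <;> omega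
  obtain rfl : k = 1 := by nlinarith
  refine hR.false_of_nsmul_mem_center hb ha (h1 0) hex hyz fun j hj0 hj1 => ?_
  obtain rfl : j = 2 := by
    fin_cases j
    exacts [absurd rfl hj0, absurd rfl hj1, rfl]
  have ha2 : a 2 ≤ c := by
    by_contra! h
    rw [Fin.sum_univ_one, if_pos (show c + 1 ≤ a (Fin.succ (Fin.succ 0)) from h)] at hsum
    omega
  rw [← Nat.sub_add_cancel ha2, pow_add, mul_smul]
  exact AddSubgroup.nsmul_mem _ (hR.derived_le_center (hb.mem 2)) _

end Rigid

end

section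

open scoped commutatorElement

section Baer

variable {G : Type*} [Group G] (hC : ∀ x y z : G, Commute ⁅x, y⁆ z)
include hC

theorem commutatorElement_mul_left (x y z : G) : ⁅x * y, z⁆ = ⁅x, z⁆ * ⁅y, z⁆ := by
  rw [commutatorElement_mul_left_eq_conj_mul, (hC y z x).symm.eq, mul_inv_cancel_right,
    (hC y z _).eq]

theorem commutatorElement_mul_right (x y z : G) : ⁅x, y * z⁆ = ⁅x, y⁆ * ⁅x, z⁆ := by
  rw [commutatorElement_mul_right_eq_mul_conj, mul_assoc, mul_assoc, ← mul_assoc y, ← (hC x z y).eq, mul_inv_cancel_right]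

variable {j : ℕ} (hj : ∀ x y : G, ⁅x, y⁆ ^ (2 * j + 1) = 1)

omit hC in
theorem commutatorElement_left_eq_one_of_commute {z : G} (hz : ∀ x, Commute z x) (x : G) :
    ⁅z, x⁆ = 1 := (hz x).commutator_eq

omit hC in
theorem commutatorElement_right_eq_one_of_commute {z : G} (hz : ∀ x, Commute z x) (x : G) :
    ⁅x, z⁆ = 1 := (hz x).symm.commutator_eq

theorem commutatorElement_mul_pow_left (x y z : G) :
    ⁅x * y * ⁅x, y⁆ ^ j, z⁆ = ⁅x, z⁆ * ⁅y, z⁆ := by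
  rw [commutatorElement_mul_left hC, commutatorElement_mul_left hC,
    commutatorElement_left_eq_one_of_commute (fun w => (hC x y w).pow_left j), mul_one]

theorem commutatorElement_mul_pow_right (x y z : G) :
    ⁅z, x * y * ⁅x, y⁆ ^ j⁆ = ⁅z, x⁆ * ⁅z, y⁆ := by
  rw [commutatorElement_mul_right hC, commutatorElement_mul_right hC,
    commutatorElement_right_eq_one_of_commute (fun w => (hC x y w).pow_left j), mul_one]

/-- Baer's addition on a group of class two whose commutators have odd order. -/
abbrev baerAddCommGroup : AddCommGroup G where
  add x y := x * y * ⁅x, y⁆ ^ j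
  zero := 1
  neg x := x⁻¹
  add_assoc x y z := by
    change x * y * ⁅x, y⁆ ^ j * z * ⁅x * y * ⁅x, y⁆ ^ j, z⁆ ^ j =
      x * (y * z * ⁅y, z⁆ ^ j) * ⁅x, y * z * ⁅y, z⁆ ^ j⁆ ^ j
    rw [commutatorElement_mul_pow_left hC, commutatorElement_mul_pow_right hC,
      (hC x z _).mul_pow, (hC x y _).mul_pow, mul_assoc (x * y), ((hC x y z).pow_left j).eq,
      ((hC x z _).pow_left j).eq]
    simp only [mul_assoc]
    rw [((hC y z (⁅x, z⁆ ^ j)).pow_left j).eq,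
      ((hC y z (⁅x, y⁆ ^ j * ⁅x, z⁆ ^ j)).pow_left j).eq, mul_assoc]
  zero_add x := by change 1 * x * ⁅1, x⁆ ^ j = x; simp
  add_zero x := by change x * 1 * ⁅x, 1⁆ ^ j = x; simp
  nsmul n x := x ^ n
  nsmul_zero x := pow_zero x
  nsmul_succ n x := by
    change x ^ (n + 1) = x ^ n * x * ⁅x ^ n, x⁆ ^ j
    rw [((Commute.refl x).pow_left n).commutator_eq, one_pow, mul_one, pow_succ]
  zsmul n x := x ^ n
  zsmul_zero' x := zpow_zero x
  zsmul_succ' n x := by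
    change x ^ ((n + 1 : ℕ) : ℤ) = x ^ (n : ℤ) * x * ⁅x ^ (n : ℤ), x⁆ ^ j
    rw [((Commute.refl x).zpow_left n).commutator_eq, one_pow, mul_one, zpow_natCast, zpow_natCast,
      pow_succ]
  zsmul_neg' n x := by
    change x ^ Int.negSucc n = (x ^ ((n + 1 : ℕ) : ℤ))⁻¹
    rw [zpow_negSucc, zpow_natCast]
  neg_add_cancel x := by
    change x⁻¹ * x * ⁅x⁻¹, x⁆ ^ j = 1
    rw [((Commute.refl x).inv_left).commutator_eq]; simp
  add_comm x y := by
    change x * y * ⁅x, y⁆ ^ j = y * x * ⁅y, x⁆ ^ j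
    have h : x * y = ⁅x, y⁆ * (y * x) := by simp [commutatorElement_def, mul_assoc]
    rw [h, (hC x y _).eq, mul_assoc, ← pow_succ', ← commutatorElement_inv x y, inv_pow]
    congr 1
    rw [eq_inv_iff_mul_eq_one, ← pow_add, ← hj x y]
    congr 1; ring

/-- The commutator, as a bilinear map for Baer's addition. -/
def baerBracket :
    letI := baerAddCommGroup hC hj
    G →+ G →+ G :=
  letI := baerAddCommGroup hC hj
  AddMonoidHom.mk' (fun x => AddMonoidHom.mk' (fun y => ⁅x, y⁆) fun y z => by
      change ⁅x, y * z * ⁅y, z⁆ ^ j⁆ = ⁅x, y⁆ * ⁅x, z⁆ * ⁅⁅x, y⁆, ⁅x, z⁆⁆ ^ j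
      rw [commutatorElement_mul_pow_right hC, (hC x y _).commutator_eq, one_pow, mul_one])
    fun x y => by
      ext z
      change ⁅x * y * ⁅x, y⁆ ^ j, z⁆ = ⁅x, z⁆ * ⁅y, z⁆ * ⁅⁅x, z⁆, ⁅y, z⁆⁆ ^ j
      rw [commutatorElement_mul_pow_left hC, (hC x z _).commutator_eq, one_pow, mul_one]

theorem map_mul_of_isLieAut :
    letI := baerAddCommGroup hC hj
    ∀ φ : G ≃+ G, IsLieAut (baerBracket hC hj) φ → ∀ x y : G, φ (x * y) = φ x * φ y := by
  let := baerAddCommGroup hC hj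
  intro φ hφ x y
  have key : ∀ x y : G, x * y = x + y + -(j • baerBracket hC hj x y) := fun x y => by
    change x * y = x * y * ⁅x, y⁆ ^ j * (⁅x, y⁆ ^ j)⁻¹ *
      ⁅x * y * ⁅x, y⁆ ^ j, (⁅x, y⁆ ^ j)⁻¹⁆ ^ j
    rw [commutatorElement_right_eq_one_of_commute fun w => ((hC x y w).pow_left j).inv_left]
    simp
  rw [key, map_add, map_add, map_neg, map_nsmul, hφ, ← key]

end Baer

theorem _root_.IsPGroup.eq_one_of_sq_eq_one {p : ℕ} (hodd : Odd p) {G : Type*} [Group G]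
    (h : IsPGroup p G) {g : G} (hg : g ^ 2 = 1) : g = 1 := by
  obtain ⟨n, hn⟩ := h g
  have := pow_gcd_eq_one.mpr ⟨hg, hn⟩
  rwa [Nat.Coprime.gcd_eq_one (Nat.coprime_two_left.mpr hodd.pow), pow_one] at this

theorem le_card_mulAut {p : ℕ} (hp : p.Prime) (hodd : Odd p) {G : Type*} [Group G]
    [Finite G] [Nontrivial G] (hpG : IsPGroup p G)
    (hab : ∀ φ ψ : MulAut G, φ * ψ = ψ * φ)
    (hpA : IsPGroup p (MulAut G)) :
    p ^ 12 ≤ Nat.card (MulAut G) := by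
  have hC : ∀ x y z : G, Commute ⁅x, y⁆ z := fun x y z => by
    have h : MulAut.conj ⁅x, y⁆ = 1 := by
      rw [map_commutatorElement]
      exact Commute.commutator_eq (hab _ _)
    have := DFunLike.congr_fun h z
    rwa [MulAut.conj_apply, MulAut.one_apply, mul_inv_eq_iff_eq_mul] at this
  have := Fact.mk hp
  obtain ⟨n, hn⟩ := IsPGroup.iff_card.mp hpG
  obtain ⟨j, hj⟩ : Odd (Nat.card G) := hn ▸ hodd.pow
  let := baerAddCommGroup hC (j := j) fun x y => hj ▸ pow_card_eq_one'
  set B := baerBracket hC (j := j) fun x y => hj ▸ pow_card_eq_one'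
  have hne : ∃ y z, B y z ≠ 0 := by
    by_contra! h
    have hcomm : ∀ x y : G, x * y = y * x := fun x y =>
      commutatorElement_eq_one_iff_mul_comm.mp (h x y)
    let ι : MulAut G := MulEquiv.mk' (Equiv.inv G) fun x y => by
      simp [mul_inv_rev, hcomm y⁻¹]
    have hι : ι = 1 := hpA.eq_one_of_sq_eq_one hodd (by rw [sq]; ext x; exact inv_inv x)
    obtain ⟨x, hx⟩ := exists_ne (1 : G)
    refine hx (hpG.eq_one_of_sq_eq_one hodd ?_)
    have : x⁻¹ = x := DFunLike.congr_fun hι x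
    rw [sq, ← inv_eq_iff_mul_eq_one, this]
  let F : {φ : G ≃+ G // IsLieAut B φ} → MulAut G := fun φ =>
    MulEquiv.mk' φ.1.toEquiv (map_mul_of_isLieAut hC _ φ.1 φ.2)
  have hF : Function.Injective F := fun φ ψ h => Subtype.ext (AddEquiv.ext fun x =>
    DFunLike.congr_fun h x)
  have hR : Rigid p B := by
    refine ⟨hp, hodd, fun x => ⟨n, ?_⟩, commutatorElement_self, fun x y z => (hC x y z).commutator_eq,
      fun φ ψ hφ hψ x => ?_, fun φ hφ h x => ?_⟩
    · rw [← hn]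
      exact pow_card_eq_one'
    · exact DFunLike.congr_fun (hab (F ⟨φ, hφ⟩) (F ⟨ψ, hψ⟩)) x
    · exact DFunLike.congr_fun (hpA.eq_one_of_sq_eq_one hodd (g := F ⟨φ, hφ⟩) (by
        rw [sq]; ext x; exact h x)) x
  exact (hR.le_card_lieAut hne).trans (Nat.card_le_card_of_injective F hF)

end

end AbelianAut

/-- Hegarty, Ban–Yu: for `p` odd, no abelian `p`-group of order less than `p ^ 12`
is the automorphism group of a non-trivial `p`-group. -/
theorem abelian_pGroup_aut_card_ge_p_pow_twelve
    (p : ℕ) (hp : p.Prime) (hodd : Odd p)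
    (G : Type*) [Group G] [Finite G] [Nontrivial G] (hpG : IsPGroup p G)
    (hab : ∀ φ ψ : MulAut G, φ * ψ = ψ * φ)
    (hpA : IsPGroup p (MulAut G)) :
    p ^ 12 ≤ Nat.card (MulAut G) :=
  AbelianAut.le_card_mulAut hp hodd hpG hab hpA
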